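/- Let K be an algebraically closed field of characteristic 0 and 𝔤 a (split) semisimple Lie algebra over K. Then every primitive ideal I of U(𝔤) (the annihilator of a simple left U(𝔤)-module) is of the form I = Ann_{U(𝔤)}(L(μ)) for some weight μ ∈ 𝔥*, where L(μ) is the simple highest weight module of highest weight μ. -/

import Mathlib

open UniversalEnvelopingAlgebra

/-- The root space of `g` relative to a Lie subalgebra `H` and a linear form `α` on `H`:
the set of `x ∈ g` with `⁅h, x⁆ = α(h) • x` for all `h ∈ H`. -/
def rootSpaceOf {K g : Type*} [Field K] [LieRing g] [LieAlgebra K g]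
    (H : LieSubalgebra K g) (α : Module.Dual K ↥H) : Submodule K g where
  carrier := {x : g | ∀ h : ↥H, ⁅(h : g), x⁆ = α h • x}
  add_mem' := fun {a b} ha hb h => by rw [lie_add, ha h, hb h, smul_add]
  zero_mem' := fun h => by simp
  smul_mem' := fun c a ha h => by rw [lie_smul, ha h, smul_comm]

/-- A triangular decomposition `g = 𝔫⁻ ⊕ 𝔥 ⊕ 𝔫⁺` of a split semisimple Lie algebra,
together with its root data: a splitting Cartan subalgebra `𝔥`, the set of positive
roots `Φ⁺` (so that `𝔫⁺` is the sum of the root spaces of the positive roots and `𝔫⁻`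
the sum of the root spaces of their negatives), and the coroot `α∨ ∈ 𝔥` of each root. -/
structure TriangularDecomposition (K g : Type*) [Field K] [LieRing g] [LieAlgebra K g] where
  H : LieSubalgebra K g
  nneg : LieSubalgebra K g
  npos : LieSubalgebra K g
  isCartan : H.IsCartanSubalgebra
  decomp : ∀ x : g, ∃! t : ↥nneg × ↥H × ↥npos, ((t.1 : g) + (t.2.1 : g) + (t.2.2 : g)) = x
  posRoots : Finset (Module.Dual K ↥H)
  posRoots_ne_zero : ∀ α ∈ posRoots, α ≠ 0
  npos_eq : npos.toSubmodule = ⨆ α ∈ posRoots, rootSpaceOf H α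
  nneg_eq : nneg.toSubmodule = ⨆ α ∈ posRoots, rootSpaceOf H (-α)
  coroot : Module.Dual K ↥H → ↥H
  coroot_self_eq_two : ∀ α ∈ posRoots, α (coroot α) = (2 : K)

variable {K g : Type*} [Field K] [LieRing g] [LieAlgebra K g]

/-- `ρ`, the half sum of the positive roots. -/
noncomputable def TriangularDecomposition.rho (T : TriangularDecomposition K g) :
    Module.Dual K ↥T.H :=
  (2 : K)⁻¹ • ∑ α ∈ T.posRoots, α

/-- A weight `λ ∈ 𝔥*` is dominant if `(λ + ρ)(α∨)` is not a negative integer for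
every positive root `α`. -/
def TriangularDecomposition.IsDominant (T : TriangularDecomposition K g)
    (lam : Module.Dual K ↥T.H) : Prop :=
  ∀ α ∈ T.posRoots, ∀ n : ℕ, (lam + T.rho) (T.coroot α) ≠ -(n + 1 : K)

/-- The left ideal of `U(g)` generated by `𝔫⁺` and `{h - λ(h) : h ∈ 𝔥}`. -/
def vermaIdeal (T : TriangularDecomposition K g) (lam : Module.Dual K ↥T.H) :
    Ideal (UniversalEnvelopingAlgebra K g) :=
  Ideal.span
    (Set.range (fun x : ↥T.npos => ι K (x : g)) ∪
     Set.range (fun h : ↥T.H =>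
       ι K (h : g) - algebraMap K (UniversalEnvelopingAlgebra K g) (lam h)))

/-- The Verma module `M(λ) = U(g)/(U(g)·𝔫⁺ + Σ_h U(g)·(h − λ(h)))`, a left `U(g)`-module. -/
def VermaModule (T : TriangularDecomposition K g) (lam : Module.Dual K ↥T.H) :=
  UniversalEnvelopingAlgebra K g ⧸ vermaIdeal T lam

noncomputable instance (T : TriangularDecomposition K g) (lam : Module.Dual K ↥T.H) :
    AddCommGroup (VermaModule T lam) :=
  inferInstanceAs (AddCommGroup (UniversalEnvelopingAlgebra K g ⧸ vermaIdeal T lam))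

noncomputable instance (T : TriangularDecomposition K g) (lam : Module.Dual K ↥T.H) :
    Module (UniversalEnvelopingAlgebra K g) (VermaModule T lam) :=
  inferInstanceAs (Module (UniversalEnvelopingAlgebra K g)
    (UniversalEnvelopingAlgebra K g ⧸ vermaIdeal T lam))

/-- The annihilator of a left `A`-module `M`, as a two-sided ideal of `A`. -/
def annihilatorTwoSided (A : Type*) [Ring A] (M : Type*) [AddCommGroup M] [Module A M] :
    TwoSidedIdeal A :=
  TwoSidedIdeal.mk' {a : A | ∀ m : M, a • m = 0}
    (fun m => by simp)
    (fun {x y} hx hy m => by simp [add_smul, hx m, hy m])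
    (fun {x} hx m => by simp [neg_smul, hx m])
    (fun {x y} hy m => by rw [mul_smul, hy m, smul_zero])
    (fun {x y} hx m => by rw [mul_smul, hx (y • m)])

/-- The submodule `I·M` of a left `A`-module `M`, for `I` a two-sided ideal of `A`. -/
def idealSmul {A : Type*} [Ring A] (I : TwoSidedIdeal A)
    (M : Type*) [AddCommGroup M] [Module A M] : Submodule A M :=
  Submodule.span A {x : M | ∃ a ∈ I, ∃ m : M, x = a • m}

universe u v

set_option linter.unusedSectionVars false
section PartA1

variable {K g : Type*} [Field K] [LieRing g] [LieAlgebra K g]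

lemma lie_mem_rootSpaceOf {H : LieSubalgebra K g} {σ τ : Module.Dual K H} {x y : g}
    (hx : x ∈ rootSpaceOf H σ) (hy : y ∈ rootSpaceOf H τ) : ⁅x, y⁆ ∈ rootSpaceOf H (σ + τ) := by
  intro h
  rw [leibniz_lie, hx h, hy h, smul_lie, lie_smul, ← add_smul]; rfl

lemma toEnd_pow_mem_rootSpaceOf {H : LieSubalgebra K g} {σ τ : Module.Dual K H} {x y : g}
    (hx : x ∈ rootSpaceOf H σ) (hy : y ∈ rootSpaceOf H τ) (n : ℕ) :
    (LieModule.toEnd K g g x ^ n) y ∈ rootSpaceOf H (τ + n • σ) := by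
  induction n with
  | zero => simpa using hy
  | succ n ih =>
    rw [pow_succ', Module.End.mul_apply, LieModule.toEnd_apply_apply]
    have := lie_mem_rootSpaceOf hx ih
    convert this using 1
    rw [succ_nsmul]; abel_nf

lemma iSupIndep_rootSpaceOf {H : LieSubalgebra K g}
    (hab : ∀ h h' : H, ⁅(h : g), (h' : g)⁆ = 0) :
    iSupIndep (rootSpaceOf H) := by
  have h1 : ∀ (i j : H) (φ : K), Set.MapsTo (LieModule.toEnd K g g (i : g))
      ((LieModule.toEnd K g g (j : g)).maxGenEigenspace φ)
      ((LieModule.toEnd K g g (j : g)).maxGenEigenspace φ) := by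
    intro i j φ
    apply Module.End.mapsTo_maxGenEigenspace_of_comm
    change _ * _ = _ * _
    ext x
    simp only [Module.End.mul_apply, LieModule.toEnd_apply_apply]
    rw [leibniz_lie, hab]; simp
  have h2 := Module.End.independent_iInf_maxGenEigenspace_of_forall_mapsTo
    (fun h : H => LieModule.toEnd K g g (h : g)) h1
  have h3 := h2.comp (f := fun σ : Module.Dual K H => (σ : H → K)) DFunLike.coe_injective
  refine h3.mono ?_
  intro σ x hx
  simp only [Function.comp, Submodule.mem_iInf]
  intro h
  apply Module.End.mem_maxGenEigenspace _ _ _ |>.2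
  refine ⟨1, ?_⟩
  simp [hx h]

/-- working hypotheses -/
structure HGr (H : LieSubalgebra K g) (F : Finset (Module.Dual K H)) : Prop where
  ab : ∀ h h' : H, ⁅(h : g), (h' : g)⁆ = 0
  top : ⨆ σ ∈ F, rootSpaceOf H σ = ⊤
  zero : rootSpaceOf H 0 = H.toSubmodule
  sep : ∀ h : H, (∀ σ ∈ F, rootSpaceOf H σ ≠ ⊥ → σ h = 0) → h = 0

variable {H : LieSubalgebra K g} {F : Finset (Module.Dual K H)}

lemma HGr.mem_F (G : HGr H F) {σ : Module.Dual K H} {x : g} (hx : x ∈ rootSpaceOf H σ)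
    (hx0 : x ≠ 0) : σ ∈ F := by
  by_contra hσ
  have h1 := iSupIndep_rootSpaceOf G.ab σ
  have h2 : (⨆ σ ∈ F, rootSpaceOf H σ) ≤ ⨆ j, ⨆ (_ : j ≠ σ), rootSpaceOf H j := by
    refine iSup₂_le fun τ hτ => le_iSup₂_of_le τ ?_ le_rfl
    rintro rfl; exact hσ hτ
  rw [G.top] at h2
  exact hx0 (Submodule.disjoint_def.1 h1 x hx (h2 trivial))

variable [CharZero K]

lemma HGr.nilp (G : HGr H F) {σ τ : Module.Dual K H} {x y : g} (hσ : σ ≠ 0)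
    (hx : x ∈ rootSpaceOf H σ) (hy : y ∈ rootSpaceOf H τ) :
    ∃ n : ℕ, (LieModule.toEnd K g g x ^ n) y = 0 := by
  by_contra! hc
  have h1 : ∀ n : ℕ, τ + n • σ ∈ F := fun n =>
    G.mem_F (toEnd_pow_mem_rootSpaceOf hx hy n) (hc n)
  refine Set.infinite_of_injective_forall_mem (f := fun n : ℕ => τ + n • σ) ?_ h1 F.finite_toSet
  intro a b hab
  have : a • σ = b • σ := by simpa using hab
  rw [← Nat.cast_smul_eq_nsmul K, ← Nat.cast_smul_eq_nsmul K] at this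
  exact_mod_cast smul_left_injective K hσ this

/-- last nonzero vector in a string -/
lemma HGr.last (G : HGr H F) {σ τ : Module.Dual K H} {x y : g} (hσ : σ ≠ 0)
    (hx : x ∈ rootSpaceOf H σ) (hy : y ∈ rootSpaceOf H τ) (hy0 : y ≠ 0) :
    ∃ (n : ℕ) (z : g), z ∈ rootSpaceOf H (τ + n • σ) ∧ z ≠ 0 ∧ ⁅x, z⁆ = 0 := by
  obtain ⟨n, hn1, hn2⟩ := Nat.exists_not_and_succ_of_not_zero_of_exists
    (p := fun n => (LieModule.toEnd K g g x ^ n) y = 0) (by simpa using hy0) (G.nilp hσ hx hy)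
  refine ⟨n, _, toEnd_pow_mem_rootSpaceOf hx hy n, hn1, ?_⟩
  rw [pow_succ'] at hn2
  exact hn2

/-- if `[x,y] = h` is nonzero then the root does not vanish on it -/
lemma HGr.root_ne_zero (G : HGr H F) {σ : Module.Dual K H} {x y : g} (hσ : σ ≠ 0)
    (hx : x ∈ rootSpaceOf H σ) (hy : y ∈ rootSpaceOf H (-σ)) {h : H} (hh : ⁅x, y⁆ = (h : g))
    (h0 : h ≠ 0) : σ h ≠ 0 := by
  intro hs
  apply h0
  apply G.sep
  intro τ _ hτ
  obtain ⟨z, hz, hz0⟩ := Submodule.exists_mem_ne_zero_of_ne_bot hτ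
  obtain ⟨n, w, hw, hw0, hxw⟩ := G.last hσ hx hz hz0
  have hhw : ∀ m : ℕ, ⁅(h : g), (LieModule.toEnd K g g y ^ m) w⁆
      = τ h • (LieModule.toEnd K g g y ^ m) w := by
    intro m
    have := toEnd_pow_mem_rootSpaceOf hy hw m h
    rw [this]; simp [hs]
  have key : ∀ m : ℕ, ⁅x, (LieModule.toEnd K g g y ^ (m + 1)) w⁆ =
      ((m + 1 : K) * τ h) • (LieModule.toEnd K g g y ^ m) w := by
    intro m
    induction m with
    | zero =>
      have := hhw 0
      simp only [pow_zero, Module.End.one_apply] at this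
      simp [leibniz_lie x, hxw, hh, this]
    | succ m ih =>
      rw [pow_succ', Module.End.mul_apply, LieModule.toEnd_apply_apply, leibniz_lie x, hh, hhw, ih,
        lie_smul, ← LieModule.toEnd_apply_apply K, ← Module.End.mul_apply, ← pow_succ', ← add_smul]
      congr 1; push_cast; ring
  obtain ⟨m, hm1, hm2⟩ := Nat.exists_not_and_succ_of_not_zero_of_exists
    (p := fun n => (LieModule.toEnd K g g y ^ n) w = 0) (by simpa using hw0)
    (G.nilp (neg_ne_zero.2 hσ) hy hw)
  have := key m
  rw [hm2, lie_zero, eq_comm, smul_eq_zero_iff_left hm1, mul_eq_zero] at this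
  exact this.resolve_left (Nat.cast_add_one_ne_zero m)

/-- roots with nontrivial bracket with their negative -/
def IsR (H : LieSubalgebra K g) (γ : Module.Dual K H) : Prop :=
  γ ≠ 0 ∧ ∃ x ∈ rootSpaceOf H γ, ∃ y ∈ rootSpaceOf H (-γ), ⁅x, y⁆ ≠ 0

lemma IsR.neg {γ : Module.Dual K H} (hγ : IsR H γ) : IsR H (-γ) := by
  obtain ⟨h0, x, hx, y, hy, hxy⟩ := hγ
  refine ⟨neg_ne_zero.2 h0, y, hy, x, by simpa using hx, ?_⟩
  rw [← lie_skew]; exact neg_ne_zero.2 hxy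

lemma HGr.lie_mem_H (G : HGr H F) {γ : Module.Dual K H} {x y : g} (hx : x ∈ rootSpaceOf H γ)
    (hy : y ∈ rootSpaceOf H (-γ)) : ∃ h : H, ⁅x, y⁆ = h := by
  have := lie_mem_rootSpaceOf hx hy
  rw [add_neg_cancel, G.zero] at this
  exact ⟨⟨_, this⟩, rfl⟩

/-- sl2 triple -/
structure Tri (H : LieSubalgebra K g) (γ : Module.Dual K H) (h : H) (e f : g) : Prop where
  he : e ∈ rootSpaceOf H γ
  hf : f ∈ rootSpaceOf H (-γ)
  ef : ⁅e, f⁆ = h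
  two : γ h = 2

lemma HGr.tri_of (G : HGr H F) {γ : Module.Dual K H} (h0 : γ ≠ 0) {x y : g}
    (hx : x ∈ rootSpaceOf H γ) (hy : y ∈ rootSpaceOf H (-γ)) {h : H} (hh : ⁅x, y⁆ = h)
    (hne : h ≠ 0) : ∃ c : K, c ≠ 0 ∧ Tri H γ (c • h) x (c • y) := by
  have hne' := G.root_ne_zero h0 hx hy hh hne
  refine ⟨2 / γ h, by simpa using hne', hx, Submodule.smul_mem _ _ hy, ?_, ?_⟩
  · rw [lie_smul, hh]; rfl
  · rw [map_smul, smul_eq_mul]; field_simp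

lemma HGr.tri (G : HGr H F) {γ : Module.Dual K H} (hγ : IsR H γ) :
    ∃ h e f, Tri H γ h e f := by
  obtain ⟨h0, x, hx, y, hy, hxy⟩ := hγ
  obtain ⟨h, hh⟩ := G.lie_mem_H hx hy
  obtain ⟨c, -, hc⟩ := G.tri_of h0 hx hy hh (by rintro rfl; simp [hh] at hxy)
  exact ⟨_, _, _, hc⟩

lemma Tri.isR {γ : Module.Dual K H} {h : H} {e f : g} (t : Tri H γ h e f) : IsR H γ := by
  refine ⟨?_, e, t.he, f, t.hf, ?_⟩
  · rintro rfl; simpa using t.two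
  · rw [t.ef]; intro hh
    have : h = 0 := by exact_mod_cast hh
    have h2 := t.two
    rw [this] at h2; simp at h2

lemma Tri.neg {γ : Module.Dual K H} {h : H} {e f : g} (t : Tri H γ h e f) :
    Tri H (-γ) (-h) f e := by
  refine ⟨t.hf, by simpa using t.he, ?_, by simp [t.two]⟩
  rw [← lie_skew, t.ef]; rfl

lemma Tri.isSl2 {γ : Module.Dual K H} {h : H} {e f : g} (t : Tri H γ h e f) :
    IsSl2Triple (h : g) e f := by
  refine ⟨?_, t.ef, ?_, ?_⟩
  · intro hh
    have h2 := t.two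
    have : h = 0 := by exact_mod_cast hh
    rw [this] at h2; simp at h2
  · rw [t.he h, t.two, two_smul, two_nsmul]
  · rw [t.hf h, LinearMap.neg_apply, t.two, neg_smul, two_smul, two_nsmul]

lemma HGr.refl_aux (G : HGr H F) {γ : Module.Dual K H} {h : H} {e f : g} (t : Tri H γ h e f)
    {σ : Module.Dual K H} (hσ : rootSpaceOf H σ ≠ ⊥) :
    ∃ i l : ℕ, σ h + 2 * i = l ∧ ∀ a ≤ l, rootSpaceOf H (σ + i • γ - a • γ) ≠ ⊥ := by
  obtain ⟨z, hz, hz0⟩ := Submodule.exists_mem_ne_zero_of_ne_bot hσ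
  obtain ⟨i, w, hw, hw0, hew⟩ := G.last t.isR.1 t.he hz hz0
  have P : t.isSl2.HasPrimitiveVectorWith w (σ h + 2 * i) := by
    refine ⟨hw0, ?_, hew⟩
    rw [hw h]; simp [t.two, mul_comm]
  obtain ⟨n, hn1, hn2⟩ := Nat.exists_not_and_succ_of_not_zero_of_exists
    (p := fun n => (LieModule.toEnd K g g f ^ n) w = 0) (by simpa using hw0)
    (G.nilp (neg_ne_zero.2 t.isR.1) t.hf hw)
  have hl : σ h + 2 * i = n := by
    have := P.lie_e_pow_succ_toEnd_f n
    rw [hn2, lie_zero, eq_comm, smul_eq_zero_iff_left hn1, mul_eq_zero, sub_eq_zero] at this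
    exact this.resolve_left (Nat.cast_add_one_ne_zero n)
  refine ⟨i, n, hl, fun a ha => ?_⟩
  have h1 := P.pow_toEnd_f_ne_zero_of_eq_nat hl ha
  have h2 := toEnd_pow_mem_rootSpaceOf t.hf hw a
  intro hb
  have : σ + i • γ - a • γ = σ + i • γ + a • -γ := by simp [sub_eq_add_neg]
  rw [this] at hb
  rw [hb] at h2
  exact h1 (by simpa using h2)

lemma HGr.int (G : HGr H F) {γ : Module.Dual K H} {h : H} {e f : g} (t : Tri H γ h e f)
    {σ : Module.Dual K H} (hσ : rootSpaceOf H σ ≠ ⊥) : ∃ m : ℤ, σ h = m := by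
  obtain ⟨i, l, hl, -⟩ := G.refl_aux t hσ
  exact ⟨l - 2 * i, by push_cast; rw [← hl]; ring⟩

lemma HGr.refl (G : HGr H F) {γ : Module.Dual K H} {h : H} {e f : g} (t : Tri H γ h e f)
    {σ : Module.Dual K H} (hσ : rootSpaceOf H σ ≠ ⊥) : rootSpaceOf H (σ - σ h • γ) ≠ ⊥ := by
  obtain ⟨m, hm⟩ := G.int t hσ
  obtain ⟨i, l, hl, ha⟩ := G.refl_aux t hσ
  obtain ⟨i', l', hl', ha'⟩ := G.refl_aux t.neg hσ
  rw [hm] at hl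
  simp only [map_neg, hm] at hl'
  have e1 : m + 2 * i = l := by exact_mod_cast hl
  have e2 : -m + 2 * i' = l' := by exact_mod_cast hl'
  rcases le_total 0 m with h0 | h0
  · obtain ⟨k, rfl⟩ := Int.eq_ofNat_of_zero_le h0
    have := ha (k + i) (by lia)
    convert this using 2
    rw [hm, add_smul]
    simp [Nat.cast_smul_eq_nsmul]
  · obtain ⟨k, hk⟩ := Int.eq_ofNat_of_zero_le (neg_nonneg.2 h0)
    have := ha' (k + i') (by lia)
    convert this using 2
    have : m = -(k : ℤ) := by lia
    rw [hm, this, add_smul]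
    push_cast
    module

end PartA1

set_option linter.unusedSectionVars false
section PartA2

open Polynomial

lemma aeval_end_congr {K V : Type*} [Field K] [AddCommGroup V] [Module K V]
    {A B : Module.End K V} (W : Submodule K V) (hA : ∀ w ∈ W, A w ∈ W) (hAB : ∀ w ∈ W, A w = B w)
    (p : K[X]) {w : V} (hw : w ∈ W) : aeval A p w = aeval B p w := by
  have h : ∀ n : ℕ, (A ^ n) w = (B ^ n) w ∧ (A ^ n) w ∈ W := by
    intro n
    induction n with
    | zero => simpa using hw
    | succ n ih =>
      rw [pow_succ', pow_succ']
      simp only [Module.End.mul_apply]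
      rw [← ih.1]
      exact ⟨hAB _ ih.2, hA _ ih.2⟩
  induction p using Polynomial.induction_on' with
  | add p q hp hq => simp [hp, hq]
  | monomial n a => simp [aeval_monomial, (h n).1]

lemma aeval_semiconj {K V : Type*} [Field K] [AddCommGroup V] [Module K V]
    {A B E : Module.End K V} (h : E * A = B * E) (p : K[X]) :
    E * aeval A p = aeval B p * E := by
  induction p using Polynomial.induction_on' with
  | add p q hp hq => simp [hp, hq, mul_add, add_mul]
  | monomial n a =>
    have : SemiconjBy E A B := h
    have := this.pow_right n
    simp only [aeval_monomial]
    rw [mul_assoc, ← this.eq, ← mul_assoc, ← mul_assoc, Algebra.commutes]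

lemma aeval_mem_of_stable {K V : Type*} [Field K] [AddCommGroup V] [Module K V]
    {A : Module.End K V} (W : Submodule K V) (hA : ∀ w ∈ W, A w ∈ W)
    (p : K[X]) {w : V} (hw : w ∈ W) : aeval A p w ∈ W := by
  have h : ∀ n : ℕ, (A ^ n) w ∈ W := by
    intro n
    induction n with
    | zero => simpa using hw
    | succ n ih =>
      rw [pow_succ']
      exact hA _ ih
  induction p using Polynomial.induction_on' with
  | add p q hp hq => simpa using W.add_mem hp hq
  | monomial n a => simpa [aeval_monomial] using W.smul_mem a (h n)

lemma sl2_poly {K V : Type*} [Field K] [CharZero K] [AddCommGroup V] [Module K V]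
    {E F L : Module.End K V} (hEF : E * F = F * E + L) (hLE : L * E = E * L + (2 : K) • E)
    (hLF : L * F = F * L - (2 : K) • F)
    (k : ℕ) : ∀ (m : ℕ) (v : V), L v = (m : K) • v → (E ^ k) v = 0 →
      ∃ p : K[X], aeval (F * E) p v = 0 ∧ ∀ a : ℕ, 0 < a → p.eval (-(a : K)) ≠ 0 := by
  induction k with
  | zero => intro m v _ h; exact ⟨1, by simpa using h, by simp⟩
  | succ k ih =>
    intro m v hv hk
    have hv1 : L (E v) = ((m + 2 : ℕ) : K) • E v := by
      have := LinearMap.congr_fun hLE v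
      simp only [Module.End.mul_apply, LinearMap.add_apply, LinearMap.smul_apply, hv] at this
      rw [this, map_smul]; push_cast; rw [add_smul]
    obtain ⟨p, hp, hp2⟩ := ih (m + 2) (E v) hv1 (by rw [pow_succ] at hk; exact hk)
    refine ⟨X * p.comp (X - C ((m + 2 : ℕ) : K)), ?_, ?_⟩
    · rw [map_mul, aeval_X, aeval_comp, Module.End.mul_apply, Module.End.mul_apply]
      have h1 : E * (aeval (F * E) (X - C ((m + 2 : ℕ) : K)) ) =
          (F * E + L - algebraMap K _ ((m + 2 : ℕ) : K)) * E := by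
        simp only [map_sub, aeval_X, aeval_C]
        rw [mul_sub, sub_mul, ← mul_assoc, hEF, Algebra.commutes]
      have h2 := LinearMap.congr_fun (aeval_semiconj h1 p) v
      simp only [Module.End.mul_apply] at h2
      rw [h2]
      have h3 : aeval (F * E) p (E v) = aeval (F * E + L - algebraMap K _ ((m + 2 : ℕ) : K)) p (E v) := by
        apply aeval_end_congr (Module.End.eigenspace L ((m + 2 : ℕ) : K))
        · intro w hw
          rw [Module.End.mem_eigenspace_iff] at hw ⊢
          have h4 := LinearMap.congr_fun hLF (E w)
          have h5 := LinearMap.congr_fun hLE w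
          simp only [Module.End.mul_apply, LinearMap.add_apply, LinearMap.smul_apply,
            LinearMap.sub_apply] at h4 h5 ⊢
          rw [h4, h5, hw]
          simp
        · intro w hw
          rw [Module.End.mem_eigenspace_iff] at hw
          simp only [LinearMap.sub_apply, LinearMap.add_apply, hw, Module.algebraMap_end_apply,
            add_sub_cancel_right]
        · rw [Module.End.mem_eigenspace_iff]; exact hv1
      rw [← h3, hp, map_zero]
    · intro a ha
      simp only [eval_mul, eval_X, eval_comp, eval_sub, eval_C]
      have := hp2 (a + (m + 2)) (by lia)
      have h6 : (-(a : K) - ((m + 2 : ℕ) : K)) = -((a + (m + 2) : ℕ) : K) := by push_cast; ring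
      rw [h6]
      refine mul_ne_zero ?_ this
      simpa using ha.ne'

lemma sl2_surj {K V : Type*} [Field K] [CharZero K] [AddCommGroup V] [Module K V]
    {E F L : Module.End K V} (hEF : E * F = F * E + L) (hLE : L * E = E * L + (2 : K) • E)
    (hLF : L * F = F * L - (2 : K) • F)
    (k : ℕ) (m : ℕ) (hm : 0 < m) (W : Submodule K V) (hW : ∀ w ∈ W, L w = (m : K) • w)
    (hFE : ∀ w ∈ W, F (E w) ∈ W) (v : V) (hv : v ∈ W) (hk : (E ^ k) v = 0) :
    ∃ u ∈ W, v = E (F u) := by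
  obtain ⟨p, hp, hp2⟩ := sl2_poly hEF hLE hLF k m v (hW v hv) hk
  have hco : IsCoprime (X - C (-(m : K))) p := by
    rw [(irreducible_X_sub_C _).coprime_iff_not_dvd, dvd_iff_isRoot]
    exact hp2 m hm
  obtain ⟨a, b, hab⟩ := hco
  have h1 := congrArg (fun q => aeval (F * E) q v) hab
  simp only [map_add, map_mul, LinearMap.add_apply, Module.End.mul_apply, hp, map_zero, add_zero,
    map_one, Module.End.one_apply] at h1
  have h2 : aeval (F * E) a (aeval (F * E) (X - C (-(m : K))) v) =
      aeval (F * E) (X - C (-(m : K))) (aeval (F * E) a v) := by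
    rw [← Module.End.mul_apply, ← map_mul, mul_comm, map_mul, Module.End.mul_apply]
  rw [h2] at h1
  have hst := aeval_mem_of_stable (A := F * E) W hFE a hv
  refine ⟨_, hst, ?_⟩
  have h3 := LinearMap.congr_fun hEF (aeval (F * E) a v)
  simp only [Module.End.mul_apply, LinearMap.add_apply] at h3
  rw [h3, hW _ hst]
  conv_lhs => rw [← h1]
  simp [Nat.cast_smul_eq_nsmul]

variable {K g : Type*} [Field K] [LieRing g] [LieAlgebra K g] [CharZero K]
variable {H : LieSubalgebra K g} {F : Finset (Module.Dual K H)}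

lemma HGr.surj (G : HGr H F) {γ : Module.Dual K H} {h : H} {e f : g} (t : Tri H γ h e f)
    {σ : Module.Dual K H} {m : ℕ} (hm : 0 < m) (hσ : σ h = m) {x : g} (hx : x ∈ rootSpaceOf H σ) :
    ∃ w ∈ rootSpaceOf H (σ - γ), x = ⁅e, w⁆ := by
  obtain ⟨k, hk⟩ := G.nilp t.isR.1 t.he hx
  obtain ⟨u, hu, h1⟩ := sl2_surj (E := LieModule.toEnd K g g e) (F := LieModule.toEnd K g g f)
    (L := LieModule.toEnd K g g h) (by
      ext y; simp [← t.ef]) (by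
      ext y; simp [leibniz_lie (h : g) e, t.he h, t.two, add_comm]) (by
      ext y; simp [leibniz_lie (h : g) f, t.hf h, t.two]; abel) k m hm (rootSpaceOf H σ)
      (by intro w hw; simp [hw h, hσ])
      (by
        intro w hw
        have := lie_mem_rootSpaceOf t.hf (lie_mem_rootSpaceOf t.he hw)
        simpa using this) x hx hk
  refine ⟨⁅f, u⁆, ?_, h1⟩
  have := lie_mem_rootSpaceOf t.hf hu
  rwa [neg_add_eq_sub] at this

lemma HGr.one_dim (G : HGr H F) {γ : Module.Dual K H} {h : H} {e f : g} (t : Tri H γ h e f)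
    {x : g} (hx : x ∈ rootSpaceOf H γ) : ∃ c : K, x = c • e := by
  obtain ⟨w, hw, hxw⟩ := G.surj t (m := 2) (by norm_num) (by exact_mod_cast t.two) hx
  rw [sub_self, G.zero] at hw
  have := t.he ⟨w, hw⟩
  refine ⟨-γ ⟨w, hw⟩, ?_⟩
  rw [hxw, ← lie_skew, neg_smul, ← this]

lemma HGr.two_mul (G : HGr H F) {γ : Module.Dual K H} (hγ : IsR H γ) :
    rootSpaceOf H ((2 : K) • γ) = ⊥ := by
  obtain ⟨h, e, f, t⟩ := G.tri hγ
  rw [Submodule.eq_bot_iff]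
  intro x hx
  obtain ⟨w, hw, hxw⟩ := G.surj t (m := 4) (by norm_num) (by simp [t.two]; norm_num) hx
  rw [two_smul, add_sub_cancel_right] at hw
  obtain ⟨c, rfl⟩ := G.one_dim t hw
  simp [hxw]

lemma HGr.isR_of_lie (G : HGr H F) {β ε : Module.Dual K H} (hβ : β ≠ 0) {y z : g}
    (hz : z ∈ rootSpaceOf H β) (hy : y ∈ rootSpaceOf H ε) (hyz : ⁅y, z⁆ ≠ 0)
    (hR : IsR H (β + ε)) : IsR H β := by
  by_contra hnR
  have hβR : ∀ a ∈ rootSpaceOf H (-β), ⁅a, z⁆ = 0 := by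
    intro a ha
    by_contra hne
    exact hnR ⟨hβ, z, hz, a, ha, by rw [← lie_skew]; exact neg_ne_zero.2 hne⟩
  have hw : ⁅y, z⁆ ∈ rootSpaceOf H (β + ε) := by
    rw [add_comm]; exact lie_mem_rootSpaceOf hy hz
  obtain ⟨h, e, f, t⟩ := G.tri hR
  obtain ⟨c, hc⟩ := G.one_dim t hw
  have hc0 : c ≠ 0 := by rintro rfl; simp [hc] at hyz
  have h1 : ⁅f, ⁅y, z⁆⁆ = -(c • (h : g)) := by
    rw [hc, lie_smul, ← lie_skew, t.ef, smul_neg]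
  rw [leibniz_lie, hβR _ (by
    have := lie_mem_rootSpaceOf t.hf hy
    convert this using 2
    abel_nf), zero_add] at h1
  have hfz : ⁅f, z⁆ ∈ rootSpaceOf H (-ε) := by
    have := lie_mem_rootSpaceOf t.hf hz
    convert this using 2
    abel_nf
  have hε : ε ≠ 0 := by
    rintro rfl
    exact hnR (by simpa using hR)
  obtain ⟨h', hh'⟩ := G.lie_mem_H hy hfz
  have hh2 : h' = (-c) • h := by
    apply Subtype.ext
    rw [← hh', h1]; simp
  have hne : h' ≠ 0 := by
    rw [hh2]
    refine smul_ne_zero (neg_ne_zero.2 hc0) ?_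
    intro hz
    have := t.two
    simp [hz] at this
  obtain ⟨d, hd, t'⟩ := G.tri_of hε hy hfz hh' hne
  rw [hh2, smul_smul] at t'
  generalize hcd : d * -c = q at t'
  have hq : q ≠ 0 := by rw [← hcd]; exact mul_ne_zero hd (neg_ne_zero.2 hc0)
  -- `γ = q • ε`
  set γ := β + ε with hγ
  have hεh : ε h = 2 / q := by
    have := t'.two
    rw [map_smul, smul_eq_mul] at this
    rw [← this]; field_simp
  have hmem : ∀ n : ℕ, rootSpaceOf H (γ + (2 * n : K) • (γ - q • ε)) ≠ ⊥ := by
    intro n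
    induction n with
    | zero =>
      simp only [Nat.cast_zero, mul_zero, zero_smul, add_zero]
      intro hb
      have := t.he
      rw [hb] at this
      exact t.isSl2.e_ne_zero (by simpa using this)
    | succ n ih =>
      have h3 := G.refl t (G.refl t' ih)
      convert h3 using 2
      simp only [map_smul, LinearMap.add_apply, LinearMap.sub_apply, LinearMap.smul_apply, t.two,
        hεh, smul_eq_mul]
      have h5 : q * (2 / q) = 2 := by field_simp
      rw [h5]
      push_cast
      match_scalars <;> field_simp <;> ring
  have hγε : γ = q • ε := by
    by_contra hne
    have hne' : γ - q • ε ≠ 0 := sub_ne_zero.2 hne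
    refine Set.infinite_of_injective_forall_mem
      (f := fun n : ℕ => γ + (2 * n : K) • (γ - q • ε)) ?_ ?_ F.finite_toSet
    · intro a b hab
      have : (2 * a : K) • (γ - q • ε) = (2 * b : K) • (γ - q • ε) := by simpa using hab
      have := smul_left_injective K hne' this
      simpa using this
    · intro n
      obtain ⟨x, hx, hx0⟩ := Submodule.exists_mem_ne_zero_of_ne_bot (hmem n)
      exact G.mem_F hx hx0
  have hεb : rootSpaceOf H ε ≠ ⊥ := by
    intro hb
    have := t'.he
    rw [hb] at this
    exact t'.isSl2.e_ne_zero (by simpa using this)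
  have hγb : rootSpaceOf H γ ≠ ⊥ := by simpa using hmem 0
  have hβb : rootSpaceOf H β ≠ ⊥ := by
    intro hb
    rw [hb] at hz
    exact hyz (by simp [(Submodule.mem_bot K).1 hz])
  obtain ⟨a, ha⟩ := G.int t hεb
  obtain ⟨b, hb⟩ := G.int t' hγb
  rw [hεh] at ha
  rw [map_smul, t.two, smul_eq_mul] at hb
  have hab : a * b = 4 := by
    have : (a : K) * b = 4 := by rw [← ha, ← hb]; field_simp; norm_num
    exact_mod_cast this
  have hbq : q = b / 2 := by rw [← hb]; field_simp
  have hbd : b ∣ 4 := ⟨a, by rw [← hab]; ring⟩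
  have hb4 : b ≤ 4 := Int.le_of_dvd (by norm_num) hbd
  have hb4' : -4 ≤ b := by
    have := Int.le_of_dvd (by norm_num) ((neg_dvd).2 hbd)
    lia
  have hRε : IsR H ε := t'.isR
  have hcases : b = 4 ∨ b = 2 ∨ b = 1 ∨ b = -1 ∨ b = -2 ∨ b = -4 := by
    interval_cases b <;> lia
  have hβe : β = γ - ε := by rw [hγ]; abel
  rcases hcases with rfl | rfl | rfl | rfl | rfl | rfl
  · apply hγb
    rw [hγε, hbq]
    have := G.two_mul hRε
    convert this using 2; norm_num
  · apply hβ
    rw [hβe, hγε, hbq]; norm_num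
  · apply hεb
    have := G.two_mul hR
    convert this using 2
    rw [hγε, hbq]; module
  · apply hεb
    have := G.two_mul hR.neg
    convert this using 2
    rw [hγε, hbq]; push_cast; module
  · apply hβb
    have := G.two_mul hRε.neg
    convert this using 2
    rw [hβe, hγε, hbq]; push_cast; module
  · apply hγb
    rw [hγε, hbq]
    have := G.two_mul hRε.neg
    convert this using 2
    push_cast; module

end PartA2

set_option linter.unusedSectionVars false
section PartA3
variable {K g : Type*} [Field K] [LieRing g] [LieAlgebra K g]

lemma TriangularDecomposition.sup_eq_top (T : TriangularDecomposition K g) :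
    T.H.toSubmodule ⊔ ((⨆ α ∈ T.posRoots, rootSpaceOf T.H α) ⊔
      ⨆ α ∈ T.posRoots, rootSpaceOf T.H (-α)) = ⊤ := by
  rw [← T.npos_eq, ← T.nneg_eq, eq_top_iff]
  intro x _
  obtain ⟨⟨a, b, c⟩, h, -⟩ := T.decomp x
  rw [← h]
  refine add_mem (add_mem ?_ ?_) ?_
  · exact Submodule.mem_sup_right (Submodule.mem_sup_right a.2)
  · exact Submodule.mem_sup_left b.2
  · exact Submodule.mem_sup_right (Submodule.mem_sup_left c.2)

/-- two-step induction: a property closed under addition, holding on H and root spaces -/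
lemma TriangularDecomposition.induct (T : TriangularDecomposition K g) {W : Submodule K g}
    (h0 : T.H.toSubmodule ≤ W) (h1 : ∀ α ∈ T.posRoots, rootSpaceOf T.H α ≤ W)
    (h2 : ∀ α ∈ T.posRoots, rootSpaceOf T.H (-α) ≤ W) (x : g) : x ∈ W := by
  have : T.H.toSubmodule ⊔ ((⨆ α ∈ T.posRoots, rootSpaceOf T.H α) ⊔
      ⨆ α ∈ T.posRoots, rootSpaceOf T.H (-α)) ≤ W :=
    sup_le h0 (sup_le (iSup₂_le h1) (iSup₂_le h2))
  rw [T.sup_eq_top] at this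
  exact this trivial

lemma lie_lie_rootSpaceOf {H : LieSubalgebra K g} {σ : Module.Dual K H} {x : g}
    (hx : x ∈ rootSpaceOf H σ) (h h' : H) : ⁅⁅(h : g), (h' : g)⁆, x⁆ = 0 := by
  rw [lie_lie, hx h', hx h, lie_smul, lie_smul, hx h', hx h, smul_smul, smul_smul, mul_comm,
    sub_self]

lemma TriangularDecomposition.abelian [LieAlgebra.IsSemisimple K g]
    (T : TriangularDecomposition K g) (h h' : T.H) : ⁅(h : g), (h' : g)⁆ = 0 := by
  let D : Submodule K g := Submodule.span K {x | ∃ h h' : T.H, x = ⁅(h : g), (h' : g)⁆}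
  have hD : D ≤ T.H.toSubmodule := by
    apply Submodule.span_le.2
    rintro _ ⟨a, b, rfl⟩
    exact T.H.lie_mem a.2 b.2
  have hlie : ∀ {x m : g}, m ∈ D → ⁅x, m⁆ ∈ D := by
    intro x m hm
    have : x ∈ D.comap (LieModule.toEnd K g g (-m) : g →ₗ[K] g) := by
      apply T.induct (W := D.comap (LieModule.toEnd K g g (-m) : g →ₗ[K] g))
      · intro y hy
        simp only [Submodule.mem_comap, LieModule.toEnd_apply_apply, neg_lie]
        rw [← lie_skew, neg_neg]
        exact Submodule.subset_span ⟨⟨y, hy⟩, ⟨m, hD hm⟩, rfl⟩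
      all_goals
        intro α _ y hy
        simp only [Submodule.mem_comap, LieModule.toEnd_apply_apply, neg_lie]
        suffices ⁅m, y⁆ = 0 by rw [this]; simp
        induction hm using Submodule.span_induction with
        | mem z hz => obtain ⟨a, b, rfl⟩ := hz; exact lie_lie_rootSpaceOf hy a b
        | zero => simp
        | add u v _ _ hu hv => simp [hu, hv]
        | smul c u _ hu => simp [hu]
    rw [← lie_skew, ← neg_lie]; exact this
  let J : LieIdeal K g := { D with lie_mem := hlie }
  have hJ : ∀ x ∈ J, x ∈ T.H := fun x hx => hD hx
  let φ : J →ₗ⁅K⁆ T.H :=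
    { toFun := fun x => ⟨x.1, hJ x.1 x.2⟩
      map_add' := fun _ _ => rfl
      map_smul' := fun _ _ => rfl
      map_lie' := rfl }
  have hφ : Function.Injective φ := by
    intro a b hab
    apply Subtype.ext
    exact congrArg (fun z : T.H => (z : g)) hab
  have := T.isCartan.nilpotent
  have : LieAlgebra.IsSolvable T.H := inferInstance
  have : LieAlgebra.IsSolvable J := hφ.lieAlgebra_isSolvable
  have hbot : J = ⊥ := LieAlgebra.HasTrivialRadical.eq_bot_of_isSolvable J
  have : ⁅(h : g), (h' : g)⁆ ∈ J := Submodule.subset_span ⟨h, h', rfl⟩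
  rw [hbot] at this
  simpa using this

open Classical in
/-- the finite set of possible weights -/
noncomputable def TriangularDecomposition.FF (T : TriangularDecomposition K g) :
    Finset (Module.Dual K T.H) :=
  insert 0 (T.posRoots ∪ T.posRoots.image (fun α => -α))

lemma TriangularDecomposition.hgr [LieAlgebra.IsSemisimple K g]
    (T : TriangularDecomposition K g) : HGr T.H T.FF := by
  have hle : T.H.toSubmodule ≤ rootSpaceOf T.H 0 := by
    intro x hx h
    simpa using T.abelian h ⟨x, hx⟩
  have hzero : rootSpaceOf T.H 0 = T.H.toSubmodule := by
    refine le_antisymm ?_ hle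
    intro x hx
    have hx' : x ∈ (⊤ : Submodule K g) := trivial
    rw [← T.sup_eq_top] at hx'
    obtain ⟨h, hh, y, hy, rfl⟩ := Submodule.mem_sup.1 hx'
    have hy0 : y ∈ rootSpaceOf T.H 0 := by
      have := sub_mem hx (hle hh)
      simpa using this
    have hi := iSupIndep_rootSpaceOf T.abelian 0
    have hle2 : ((⨆ α ∈ T.posRoots, rootSpaceOf T.H α) ⊔
      ⨆ α ∈ T.posRoots, rootSpaceOf T.H (-α)) ≤ ⨆ j, ⨆ (_ : j ≠ 0), rootSpaceOf T.H j := by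
      refine sup_le (iSup₂_le fun α hα => le_iSup₂_of_le α (T.posRoots_ne_zero α hα) le_rfl)
        (iSup₂_le fun α hα => le_iSup₂_of_le (-α) (neg_ne_zero.2 (T.posRoots_ne_zero α hα)) le_rfl)
    have : y = 0 := Submodule.disjoint_def.1 hi y hy0 (hle2 hy)
    simpa [this] using hh
  refine ⟨T.abelian, ?_, hzero, ?_⟩
  · rw [eq_top_iff]
    intro x _
    refine T.induct ?_ ?_ ?_ x
    · rw [← hzero]; exact le_iSup₂_of_le 0 (by simp [FF]) le_rfl
    · intro α hα; exact le_iSup₂_of_le α (by simp [FF, hα]) le_rfl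
    · intro α hα; exact le_iSup₂_of_le (-α) (by simp [FF, hα]) le_rfl
  · intro h hh
    have hc : (h : g) ∈ LieAlgebra.center K g := by
      rw [LieModule.mem_maxTrivSubmodule]
      intro x
      rw [← lie_skew, neg_eq_zero]
      have hroot : ∀ σ ∈ T.FF, rootSpaceOf T.H σ ≤
          LinearMap.ker (LieModule.toEnd K g g (h : g) : g →ₗ[K] g) := by
        intro σ hσ y hy
        simp only [LinearMap.mem_ker, LieModule.toEnd_apply_apply]
        rw [hy h]
        by_cases hb : rootSpaceOf T.H σ = ⊥
        · rw [hb] at hy; simp [(Submodule.mem_bot K).1 hy]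
        · rw [hh σ hσ hb, zero_smul]
      have := T.induct (W := LinearMap.ker (LieModule.toEnd K g g (h : g) : g →ₗ[K] g))
        (by rw [← hzero]; exact hroot 0 (by simp [FF]))
        (fun α hα => hroot α (by simp [FF, hα])) (fun α hα => hroot (-α) (by simp [FF, hα])) x
      exact this
    rw [LieAlgebra.center_eq_bot] at hc
    have : (h : g) = 0 := by simpa using hc
    exact_mod_cast this

variable [CharZero K] [LieAlgebra.IsSemisimple K g]
variable {H : LieSubalgebra K g} {F : Finset (Module.Dual K H)}

lemma HGr.induct (G : HGr H F) {W : Submodule K g}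
    (h : ∀ σ, rootSpaceOf H σ ≤ W) (x : g) : x ∈ W := by
  have : ⨆ σ ∈ F, rootSpaceOf H σ ≤ W := iSup₂_le fun σ _ => h σ
  rw [G.top] at this
  exact this trivial

lemma HGr.all_isR (G : HGr H F) {β : Module.Dual K H} (hβ : β ≠ 0) (hβb : rootSpaceOf H β ≠ ⊥) :
    IsR H β := by
  by_contra hnR
  let D : Submodule K g := ⨆ β : {β : Module.Dual K H // β ≠ 0 ∧ ¬ IsR H β}, rootSpaceOf H β.1
  have hlie : ∀ {x m : g}, m ∈ D → ⁅x, m⁆ ∈ D := by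
    intro x m hm
    have : D ≤ D.comap (LieModule.toEnd K g g x : g →ₗ[K] g) := by
      refine iSup_le fun β z hz => ?_
      obtain ⟨β, hβ, hβR⟩ := β
      simp only [Submodule.mem_comap, LieModule.toEnd_apply_apply]
      have := G.induct (W := D.comap (LieModule.toEnd K g g (-z) : g →ₗ[K] g)) ?_ x
      · rw [← lie_skew, ← neg_lie]; exact this
      intro ε y hy
      simp only [Submodule.mem_comap, LieModule.toEnd_apply_apply, neg_lie, lie_skew]
      by_cases h0 : ⁅y, z⁆ = 0
      · rw [h0]; exact zero_mem _
      have hw : ⁅y, z⁆ ∈ rootSpaceOf H (β + ε) := by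
        rw [add_comm]; exact lie_mem_rootSpaceOf hy hz
      have hne : β + ε ≠ 0 := by
        intro h1
        have : ε = -β := (neg_eq_of_add_eq_zero_right h1).symm
        rw [this] at hy
        exact hβR ⟨hβ, z, hz, y, hy, by rw [← lie_skew]; exact neg_ne_zero.2 h0⟩
      have hnR' : ¬ IsR H (β + ε) := fun hR => hβR (G.isR_of_lie hβ hz hy h0 hR)
      exact Submodule.mem_iSup_of_mem (⟨β + ε, hne, hnR'⟩ :
        {β : Module.Dual K H // β ≠ 0 ∧ ¬ IsR H β}) hw
    exact this hm
  let J : LieIdeal K g := { D with lie_mem := hlie }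
  have hJH : ∀ x ∈ J, x ∈ rootSpaceOf H 0 → x = 0 := by
    intro x hx hx0
    refine Submodule.disjoint_def.1 (iSupIndep_rootSpaceOf G.ab 0) x hx0 ?_
    have : D ≤ ⨆ j, ⨆ (_ : j ≠ 0), rootSpaceOf H j :=
      iSup_le fun β => le_iSup₂_of_le β.1 β.2.1 le_rfl
    exact this hx
  obtain ⟨J', hJ'⟩ := exists_isCompl J
  have hdisj : ∀ x ∈ J, x ∈ J' → x = 0 := by
    intro x h1 h2
    have := hJ'.disjoint.le_bot (show x ∈ J ⊓ J' from ⟨h1, h2⟩)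
    simpa using this
  have hHJ' : ∀ h : H, (h : g) ∈ J' := by
    intro h
    have : (h : g) ∈ J ⊔ J' := by rw [hJ'.sup_eq_top]; trivial
    rw [LieSubmodule.mem_sup] at this
    obtain ⟨n, hn, n', hn', hnn⟩ := this
    have : n = 0 := by
      apply hJH n hn
      intro h'
      have h1 : ⁅(h' : g), n⁆ ∈ J := lie_mem_right K g J _ _ hn
      have h2 : ⁅(h' : g), n'⁆ ∈ J' := lie_mem_right K g J' _ _ hn'
      have h3 : ⁅(h' : g), n⁆ = -⁅(h' : g), n'⁆ := by
        rw [eq_neg_iff_add_eq_zero, ← lie_add, hnn, G.ab]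
      have := hdisj _ h1 (by rw [h3]; exact neg_mem h2)
      rw [this]; simp
    rw [← hnn, this, zero_add]; exact hn'
  obtain ⟨z, hz, hz0⟩ := Submodule.exists_mem_ne_zero_of_ne_bot hβb
  have hzJ : z ∈ J := Submodule.mem_iSup_of_mem (⟨β, hβ, hnR⟩ :
        {β : Module.Dual K H // β ≠ 0 ∧ ¬ IsR H β}) hz
  apply hz0
  apply hJH z hzJ
  intro h
  have h1 : ⁅(h : g), z⁆ ∈ J := lie_mem_right K g J _ _ hzJ
  have h2 : ⁅(h : g), z⁆ ∈ J' := lie_mem_left K g J' _ _ (hHJ' h)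
  rw [hdisj _ h1 h2]; simp

lemma HGr.finite (G : HGr H F) : Module.Finite K g := by
  have hH : Module.Finite K (rootSpaceOf H 0) := by
    rw [G.zero]
    let φ : H →ₗ[K] ({σ // σ ∈ F ∧ rootSpaceOf H σ ≠ ⊥} → K) := LinearMap.pi fun σ => σ.1
    have : Finite {σ // σ ∈ F ∧ rootSpaceOf H σ ≠ ⊥} :=
      Set.Finite.subset (t := {σ | σ ∈ F ∧ rootSpaceOf H σ ≠ ⊥}) F.finite_toSet fun σ hσ => hσ.1
    apply Module.Finite.of_injective φ
    rw [← LinearMap.ker_eq_bot, Submodule.eq_bot_iff]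
    intro h hh
    refine G.sep h fun σ hσ hb => ?_
    exact congrFun hh ⟨σ, hσ, hb⟩
  have hall : ∀ σ, Module.Finite K (rootSpaceOf H σ) := by
    intro σ
    by_cases h0 : σ = 0
    · rw [h0]; exact hH
    by_cases hb : rootSpaceOf H σ = ⊥
    · rw [hb]; infer_instance
    obtain ⟨h, e, f, t⟩ := G.tri (G.all_isR h0 hb)
    have : rootSpaceOf H σ = Submodule.span K {e} := by
      apply le_antisymm
      · intro x hx
        obtain ⟨c, rfl⟩ := G.one_dim t hx
        exact Submodule.smul_mem _ _ (Submodule.mem_span_singleton_self e)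
      · rw [Submodule.span_singleton_le_iff_mem]; exact t.he
    rw [this]; infer_instance
  have : Module.Finite K (⊤ : Submodule K g) := by
    rw [← G.top, ← Finset.sup_eq_iSup]
    exact Submodule.finite_finset_sup F _
  exact Module.finite_def.2 (by rwa [Module.Finite.iff_fg] at this)

lemma TriangularDecomposition.finite (T : TriangularDecomposition K g) : Module.Finite K g :=
  T.hgr.finite

end PartA3

set_option linter.unusedSectionVars false
section PartA4
variable {K g : Type*} [Field K] [LieRing g] [LieAlgebra K g]

lemma TriangularDecomposition.disj (T : TriangularDecomposition K g) {a b c : g}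
    (ha : a ∈ T.nneg) (hb : b ∈ T.H) (hc : c ∈ T.npos) (h : a + b + c = 0) :
    a = 0 ∧ b = 0 ∧ c = 0 := by
  obtain ⟨t, -, ht⟩ := T.decomp 0
  have h1 := ht (⟨a, ha⟩, ⟨b, hb⟩, ⟨c, hc⟩) h
  have h2 := ht (0, 0, 0) (by simp)
  rw [← h2] at h1
  simp only [Prod.mk.injEq] at h1
  obtain ⟨x, y, z⟩ := h1
  exact ⟨congrArg Subtype.val x, congrArg Subtype.val y, congrArg Subtype.val z⟩

lemma TriangularDecomposition.disj_pn (T : TriangularDecomposition K g) {a : g}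
    (ha : a ∈ T.npos) (hb : a ∈ T.nneg) : a = 0 :=
  (T.disj hb (zero_mem T.H) (neg_mem ha) (by simp)).1

lemma TriangularDecomposition.disj_ph (T : TriangularDecomposition K g) {a : g}
    (ha : a ∈ T.npos) (hb : a ∈ T.H) : a = 0 :=
  (T.disj (zero_mem T.nneg) hb (neg_mem ha) (by simp)).2.1

lemma TriangularDecomposition.le_npos (T : TriangularDecomposition K g) {σ : Module.Dual K T.H}
    (hσ : σ ∈ T.posRoots) {x : g} (hx : x ∈ rootSpaceOf T.H σ) : x ∈ T.npos := by
  have : x ∈ T.npos.toSubmodule := by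
    rw [T.npos_eq]; exact Submodule.mem_iSup_of_mem σ (Submodule.mem_iSup_of_mem hσ hx)
  exact this

lemma TriangularDecomposition.le_nneg (T : TriangularDecomposition K g) {σ : Module.Dual K T.H}
    (hσ : σ ∈ T.posRoots) {x : g} (hx : x ∈ rootSpaceOf T.H (-σ)) : x ∈ T.nneg := by
  have : x ∈ T.nneg.toSubmodule := by
    rw [T.nneg_eq]; exact Submodule.mem_iSup_of_mem σ (Submodule.mem_iSup_of_mem hσ hx)
  exact this

variable [CharZero K] [LieAlgebra.IsSemisimple K g]

open Classical in
/-- the actual positive roots -/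
noncomputable def TriangularDecomposition.Q (T : TriangularDecomposition K g) :
    Finset (Module.Dual K T.H) := T.posRoots.filter fun σ => rootSpaceOf T.H σ ≠ ⊥

open Classical in
/-- all weights -/
noncomputable def TriangularDecomposition.RR (T : TriangularDecomposition K g) :
    Finset (Module.Dual K T.H) := T.FF.filter fun σ => rootSpaceOf T.H σ ≠ ⊥

variable (T : TriangularDecomposition K g)

lemma TriangularDecomposition.mem_Q {σ : Module.Dual K T.H} :
    σ ∈ T.Q ↔ σ ∈ T.posRoots ∧ rootSpaceOf T.H σ ≠ ⊥ := by
  classical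
  simp [Q]

lemma TriangularDecomposition.mem_RR {σ : Module.Dual K T.H} :
    σ ∈ T.RR ↔ rootSpaceOf T.H σ ≠ ⊥ := by
  classical
  simp only [RR, Finset.mem_filter, and_iff_right_iff_imp]
  intro h
  obtain ⟨z, hz, hz0⟩ := Submodule.exists_mem_ne_zero_of_ne_bot h
  exact T.hgr.mem_F hz hz0

lemma TriangularDecomposition.mem_FF {σ : Module.Dual K T.H} :
    σ ∈ T.FF ↔ σ = 0 ∨ σ ∈ T.posRoots ∨ -σ ∈ T.posRoots := by
  classical
  simp only [FF, Finset.mem_insert, Finset.mem_union, Finset.mem_image]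
  constructor
  · rintro (h | h | ⟨a, h, rfl⟩) <;> simp_all
  · rintro (h | h | h)
    · simp_all
    · simp_all
    · exact Or.inr (Or.inr ⟨_, h, by simp⟩)

lemma TriangularDecomposition.mem_Q_of {σ : Module.Dual K T.H} {x : g}
    (hx : x ∈ rootSpaceOf T.H σ) (hx0 : x ≠ 0) (hp : x ∈ T.npos) : σ ∈ T.Q := by
  rw [T.mem_Q]
  refine ⟨?_, fun h => hx0 (by rw [h] at hx; simpa using hx)⟩
  rcases T.mem_FF.1 (T.hgr.mem_F hx hx0) with rfl | h | h
  · rw [T.hgr.zero] at hx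
    exact absurd (T.disj_ph hp hx) hx0
  · exact h
  · exact absurd (T.disj_pn hp (T.le_nneg h (by simpa using hx))) hx0

lemma TriangularDecomposition.neg_notMem {σ : Module.Dual K T.H} (h : σ ∈ T.Q)
    (h' : -σ ∈ T.Q) : False := by
  rw [T.mem_Q] at h h'
  obtain ⟨z, hz, hz0⟩ := Submodule.exists_mem_ne_zero_of_ne_bot h.2
  exact hz0 (T.disj_pn (T.le_npos h.1 hz) (T.le_nneg h'.1 (by simpa using hz)))

lemma TriangularDecomposition.mem_Q_or {σ : Module.Dual K T.H} (h0 : σ ≠ 0)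
    (h : rootSpaceOf T.H σ ≠ ⊥) : σ ∈ T.Q ∨ -σ ∈ T.Q := by
  obtain ⟨z, hz, hz0⟩ := Submodule.exists_mem_ne_zero_of_ne_bot h
  have hn : rootSpaceOf T.H (-σ) ≠ ⊥ := by
    obtain ⟨-, x, hx, y, hy, hxy⟩ := T.hgr.all_isR h0 h
    intro hb
    rw [hb] at hy
    rw [Submodule.mem_bot] at hy
    simp [hy] at hxy
  rcases T.mem_FF.1 (T.hgr.mem_F hz hz0) with h1 | h1 | h1
  · exact absurd h1 h0
  · exact Or.inl (T.mem_Q.2 ⟨h1, h⟩)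
  · exact Or.inr (T.mem_Q.2 ⟨h1, hn⟩)

lemma TriangularDecomposition.up {β : Module.Dual K T.H} {h : T.H} {e f : g}
    (hβ : β ∈ T.Q) (t : Tri T.H β h e f) {σ : Module.Dual K T.H} (hσ : σ ∈ T.Q) {m : ℤ}
    (hm : m < 0) (hs : σ h = m) : σ + β ∈ T.Q := by
  have := T.finite
  obtain ⟨z, hz, hz0⟩ := Submodule.exists_mem_ne_zero_of_ne_bot (T.mem_Q.1 hσ).2
  have hne : ⁅e, z⁆ ≠ 0 := by
    intro h0
    have P : t.isSl2.HasPrimitiveVectorWith z (m : K) := ⟨hz0, by rw [hz h, hs], h0⟩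
    obtain ⟨n, hn⟩ := P.exists_nat
    have : m = n := by exact_mod_cast hn
    lia
  refine T.mem_Q_of (x := ⁅e, z⁆) ?_ hne ?_
  · rw [add_comm]; exact lie_mem_rootSpaceOf t.he hz
  · exact T.npos.lie_mem (T.le_npos (T.mem_Q.1 hβ).1 t.he) (T.le_npos (T.mem_Q.1 hσ).1 hz)

lemma TriangularDecomposition.up' {β : Module.Dual K T.H} {h : T.H} {e f : g}
    (hβ : β ∈ T.Q) (t : Tri T.H β h e f) {σ : Module.Dual K T.H} (hσ : σ ∈ T.Q) {k : ℕ}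
    (hs : σ h = -k) (j : ℕ) (hj : 2 * j ≤ k + 1) : σ + j • β ∈ T.Q := by
  induction j with
  | zero => simpa using hσ
  | succ j ih =>
    have := T.up hβ t (ih (by lia)) (m := -k + 2 * j) (by lia) (by simp [hs, t.two, mul_comm])
    rw [succ_nsmul, ← add_assoc]; exact this

lemma TriangularDecomposition.refl_mem {β : Module.Dual K T.H} {h : T.H} {e f : g}
    (hβ : β ∈ T.Q) (t : Tri T.H β h e f) {σ : Module.Dual K T.H} (hσ : σ ∈ T.Q) {k : ℕ}
    (hs : σ h = -k) : σ - σ h • β ∈ T.Q := by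
  have hb := T.hgr.refl t (T.mem_Q.1 hσ).2
  have h0 : σ - σ h • β ≠ 0 := by
    intro h1
    have h2 : σ h - σ h * 2 = 0 := by
      have := congrArg (fun φ : Module.Dual K T.H => φ h) h1
      simpa [t.two] using this
    have h3 : σ h = 0 := by linear_combination -h2
    rw [h3, zero_smul, sub_zero] at h1
    exact T.posRoots_ne_zero σ (T.mem_Q.1 hσ).1 h1
  rcases T.mem_Q_or h0 hb with h1 | h1
  · exact h1
  exfalso
  have e1 := T.up' hβ t hσ hs
  have e2 := T.up' hβ t h1 (k := k) (by simp [hs, t.two]; ring)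
  have key : -(σ - σ h • β) = -σ - k • β := by
    rw [hs]; module
  rw [key] at e2
  rcases Nat.even_or_odd' k with ⟨j, rfl | rfl⟩
  · refine T.neg_notMem (e1 j (by lia)) ?_
    convert e2 j (by lia) using 1
    module
  · refine T.neg_notMem (e1 j (by lia)) ?_
    convert e2 (j + 1) (by lia) using 1
    module

lemma TriangularDecomposition.sum_pos {β : Module.Dual K T.H} {h : T.H} {e f : g}
    (hβ : β ∈ T.Q) (t : Tri T.H β h e f) : ∃ n : ℕ, 0 < n ∧ ∑ σ ∈ T.Q, σ h = n := by
  classical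
  have hp : ∀ σ : Module.Dual K T.H, ∃ m : ℤ, σ ∈ T.Q → σ h = m := by
    intro σ
    by_cases hσ : σ ∈ T.Q
    · obtain ⟨m, hm⟩ := T.hgr.int t (T.mem_Q.1 hσ).2
      exact ⟨m, fun _ => hm⟩
    · exact ⟨0, fun h => absurd h hσ⟩
  choose p hp using hp
  have hsum : ∑ σ ∈ T.Q, σ h = ((∑ σ ∈ T.Q, p σ : ℤ) : K) := by
    push_cast
    exact Finset.sum_congr rfl hp
  have hpos : 0 < ∑ σ ∈ T.Q, p σ := by
    rw [← Finset.sum_filter_add_sum_filter_not T.Q (fun σ => σ - σ h • β ∈ T.Q)]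
    have h1 : ∑ σ ∈ T.Q with σ - σ h • β ∈ T.Q, p σ = 0 := by
      refine Finset.sum_involution (fun σ _ => σ - σ h • β) ?_ ?_ ?_ ?_
      · intro σ hσ
        simp only [Finset.mem_filter] at hσ
        have a := hp _ hσ.1
        have b := hp _ hσ.2
        have : ((p σ + p (σ - σ h • β) : ℤ) : K) = 0 := by
          push_cast; rw [← a, ← b]; simp [t.two]; ring
        exact_mod_cast this
      · intro σ hσ hne heq
        simp only [Finset.mem_filter] at hσ
        have a := hp _ hσ.1
        rw [sub_eq_self, smul_eq_zero] at heq
        rcases heq with h1 | h1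
        · rw [h1] at a; apply hne; exact_mod_cast a.symm
        · exact T.posRoots_ne_zero β (T.mem_Q.1 hβ).1 h1
      · intro σ hσ
        simp only [Finset.mem_filter] at hσ ⊢
        refine ⟨hσ.2, ?_⟩
        convert hσ.1 using 1
        simp [t.two]; module
      · intro σ hσ
        simp [t.two]; module
    rw [h1, zero_add]
    apply Finset.sum_pos
    · intro σ hσ
      simp only [Finset.mem_filter] at hσ
      by_contra hle
      push Not at hle
      obtain ⟨k, hk⟩ := Int.eq_ofNat_of_zero_le (neg_nonneg.2 hle)
      apply hσ.2
      apply T.refl_mem hβ t hσ.1 (k := k)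
      rw [hp σ hσ.1]
      have : p σ = -k := by lia
      rw [this]; simp
    · refine ⟨β, ?_⟩
      simp only [Finset.mem_filter]
      refine ⟨hβ, fun h1 => T.neg_notMem hβ ?_⟩
      convert h1 using 1
      rw [t.two]; module
  obtain ⟨n, hn⟩ := Int.eq_ofNat_of_zero_le hpos.le
  exact ⟨n, by lia, by rw [hsum, hn]; simp⟩

/-- the trace form on H -/
lemma TriangularDecomposition.form_eq {β : Module.Dual K T.H} {h : T.H} {e f : g}
    (t : Tri T.H β h e f) (h' : T.H) :
    2 * ∑ τ ∈ T.RR, τ h * τ h' = β h' * ∑ τ ∈ T.RR, τ h * τ h := by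
  have key : ∑ τ ∈ T.RR, τ h * τ h' = ∑ τ ∈ T.RR, (τ h - τ h * 2) * (τ h' - τ h * β h') := by
    refine Finset.sum_nbij' (fun τ => τ - τ h • β) (fun τ => τ - τ h • β) ?_ ?_ ?_ ?_ ?_
    · intro τ hτ
      exact T.mem_RR.2 (T.hgr.refl t (T.mem_RR.1 hτ))
    · intro τ hτ
      exact T.mem_RR.2 (T.hgr.refl t (T.mem_RR.1 hτ))
    · intro τ hτ
      simp [t.two]; module
    · intro τ hτ
      simp [t.two]; module
    · intro τ hτ
      simp [t.two]
      ring
  have : ∑ τ ∈ T.RR, (τ h - τ h * 2) * (τ h' - τ h * β h') =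
      - ∑ τ ∈ T.RR, τ h * τ h' + β h' * ∑ τ ∈ T.RR, τ h * τ h := by
    rw [Finset.mul_sum, ← Finset.sum_neg_distrib, ← Finset.sum_add_distrib]
    exact Finset.sum_congr rfl fun τ _ => by ring
  rw [this] at key
  linear_combination key

lemma TriangularDecomposition.form_nat {β : Module.Dual K T.H} {h : T.H} {e f : g}
    (t : Tri T.H β h e f) : ∃ n : ℕ, 0 < n ∧ ∑ τ ∈ T.RR, τ h * τ h = n := by
  have hp : ∀ σ : Module.Dual K T.H, ∃ m : ℤ, σ ∈ T.RR → σ h = m := by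
    intro σ
    by_cases hσ : σ ∈ T.RR
    · obtain ⟨m, hm⟩ := T.hgr.int t (T.mem_RR.1 hσ)
      exact ⟨m, fun _ => hm⟩
    · exact ⟨0, fun h => absurd h hσ⟩
  choose p hp using hp
  have hβ : β ∈ T.RR := by
    rw [T.mem_RR]
    intro hb
    have := t.he
    rw [hb, Submodule.mem_bot] at this
    have h2 := t.ef
    rw [this, zero_lie] at h2
    have : h = 0 := by exact_mod_cast h2.symm
    have h3 := t.two
    rw [this, map_zero] at h3
    exact two_ne_zero h3.symm
  have hsum : ∑ σ ∈ T.RR, σ h * σ h = ((∑ σ ∈ T.RR, p σ * p σ : ℤ) : K) := by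
    push_cast
    exact Finset.sum_congr rfl fun σ hσ => by rw [hp σ hσ]
  have hpos : 0 < ∑ σ ∈ T.RR, p σ * p σ := by
    apply Finset.sum_pos' (fun σ _ => mul_self_nonneg _)
    refine ⟨β, hβ, ?_⟩
    have := hp β hβ
    rw [t.two] at this
    have : p β = 2 := by exact_mod_cast this.symm
    rw [this]; norm_num
  obtain ⟨n, hn⟩ := Int.eq_ofNat_of_zero_le hpos.le
  exact ⟨n, by lia, by rw [hsum, hn]; simp⟩

lemma TriangularDecomposition.exists_delta :
    ∃ δ : T.H, ∀ σ ∈ T.Q, ∃ n : ℕ, 0 < n ∧ σ δ = n := by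
  classical
  have h1 : ∀ σ : Module.Dual K T.H, ∃ h : T.H, ∃ e f : g, σ ∈ T.Q → Tri T.H σ h e f := by
    intro σ
    by_cases hσ : σ ∈ T.Q
    · obtain ⟨h, e, f, t⟩ := T.hgr.tri (T.hgr.all_isR (T.posRoots_ne_zero σ (T.mem_Q.1 hσ).1)
        (T.mem_Q.1 hσ).2)
      exact ⟨h, e, f, fun _ => t⟩
    · exact ⟨0, 0, 0, fun h => absurd h hσ⟩
  choose h e f ht using h1
  have h2 : ∀ σ : Module.Dual K T.H, ∃ n : ℕ, 0 < n ∧ (σ ∈ T.Q →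
      ∑ τ ∈ T.RR, τ (h σ) * τ (h σ) = n) := by
    intro σ
    by_cases hσ : σ ∈ T.Q
    · obtain ⟨n, hn, h⟩ := T.form_nat (ht σ hσ)
      exact ⟨n, hn, fun _ => h⟩
    · exact ⟨1, one_pos, fun h => absurd h hσ⟩
  choose N hN0 hN using h2
  let P : ℕ := ∏ σ ∈ T.Q, N σ
  refine ⟨∑ β ∈ T.Q, ((P : K) * (2 * (N β : K)⁻¹)) • h β, ?_⟩
  intro σ hσ
  obtain ⟨n, hn, hns⟩ := T.sum_pos hσ (ht σ hσ)
  have hNK : ∀ σ, (N σ : K) ≠ 0 := fun σ => by exact_mod_cast (hN0 σ).ne'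
  have e1 : ∀ β ∈ T.Q, σ (h β) = 2 * (N σ : K)⁻¹ * ∑ τ ∈ T.RR, τ (h σ) * τ (h β) := by
    intro β hβ
    have := T.form_eq (ht σ hσ) (h β)
    rw [hN σ hσ] at this
    have h3 := hNK σ
    field_simp
    linear_combination -this
  have e2 : ∀ β ∈ T.Q, β (h σ) = 2 * (N β : K)⁻¹ * ∑ τ ∈ T.RR, τ (h σ) * τ (h β) := by
    intro β hβ
    have := T.form_eq (ht β hβ) (h σ)
    rw [hN β hβ] at this
    have h3 := hNK β
    have h4 : ∑ τ ∈ T.RR, τ (h β) * τ (h σ) = ∑ τ ∈ T.RR, τ (h σ) * τ (h β) :=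
      Finset.sum_congr rfl fun τ _ => mul_comm _ _
    rw [h4] at this
    field_simp
    linear_combination -this
  have e3 : σ (∑ β ∈ T.Q, ((P : K) * (2 * (N β : K)⁻¹)) • h β) =
      P * (2 * (N σ : K)⁻¹) * n := by
    rw [← hns, map_sum, Finset.mul_sum]
    refine Finset.sum_congr rfl fun β hβ => ?_
    rw [map_smul, smul_eq_mul, e1 β hβ, e2 β hβ]
    ring
  obtain ⟨q, hq⟩ : N σ ∣ P := Finset.dvd_prod_of_mem N hσ
  have hP : 0 < P := Finset.prod_pos fun σ _ => hN0 σ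
  refine ⟨2 * q * n, ?_, ?_⟩
  · have : 0 < q := by
      rcases Nat.eq_zero_or_pos q with h0 | h0
      · rw [h0] at hq; lia
      · exact h0
    positivity
  · rw [e3, hq]
    have := hNK σ
    push_cast
    field_simp

/-- a weight basis together with heights -/
structure TriangularDecomposition.HB (T : TriangularDecomposition K g) where
  δ : T.H
  N : ℕ
  b : Module.Basis (Fin N) K g
  w : Fin N → Module.Dual K T.H
  n : Fin N → ℤ
  mem : ∀ a, b a ∈ rootSpaceOf T.H (w a)
  wn : ∀ a, w a δ = n a
  pos : ∀ a, 0 < n a → b a ∈ T.npos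
  neg : ∀ a, n a < 0 → b a ∈ T.nneg
  zer : ∀ a, n a = 0 → b a ∈ T.H
  w_eq_zero : ∀ a, n a = 0 → w a = 0

lemma TriangularDecomposition.exists_hb : Nonempty T.HB := by
  classical
  have := T.finite
  obtain ⟨δ, hδ⟩ := T.exists_delta
  have hind := (iSupIndep_rootSpaceOf T.hgr.ab).comp (f := fun σ : T.FF => σ.1)
    Subtype.val_injective
  have hint : DirectSum.IsInternal (fun σ : T.FF => rootSpaceOf T.H σ.1) := by
    rw [DirectSum.isInternal_submodule_iff_iSupIndep_and_iSup_eq_top]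
    refine ⟨hind, ?_⟩
    rw [← T.hgr.top, iSup_subtype]
  let B := hint.collectedBasis (fun σ => Module.finBasis K (rootSpaceOf T.H σ.1))
  let E := Fintype.equivFin ((σ : T.FF) × Fin (Module.finrank K (rootSpaceOf T.H σ.1)))
  let b := B.reindex E
  have hmem : ∀ a, b a ∈ rootSpaceOf T.H (E.symm a).1.1 := by
    intro a
    simp only [b, Module.Basis.reindex_apply]
    exact hint.collectedBasis_mem _ _
  have hbot : ∀ a, rootSpaceOf T.H (E.symm a).1.1 ≠ ⊥ := by
    intro a h
    have := hmem a
    rw [h, Submodule.mem_bot] at this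
    exact b.ne_zero a this
  have hn : ∀ a, ∃ n : ℤ, (E.symm a).1.1 δ = n ∧ (0 < n → b a ∈ T.npos) ∧ (n < 0 → b a ∈ T.nneg)
      ∧ (n = 0 → b a ∈ T.H) ∧ (n = 0 → (E.symm a).1.1 = 0) := by
    intro a
    by_cases h0 : (E.symm a).1.1 = 0
    · refine ⟨0, by simp [h0], by simp, by simp, fun _ => ?_, fun _ => h0⟩
      have := hmem a
      rw [h0, T.hgr.zero] at this
      exact this
    rcases T.mem_Q_or h0 (hbot a) with h | h
    · obtain ⟨n, hn, h1⟩ := hδ _ h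
      exact ⟨n, by simpa using h1, fun _ => T.le_npos (T.mem_Q.1 h).1 (hmem a), by lia, by lia,
        by lia⟩
    · obtain ⟨n, hn, h1⟩ := hδ _ h
      refine ⟨-n, ?_, by lia, fun _ => T.le_nneg (T.mem_Q.1 h).1 (by simpa using hmem a), by lia,
        by lia⟩
      simp at h1
      push_cast
      rw [← h1, neg_neg]
  choose n h1 h2 h3 h4 h5 using hn
  exact ⟨⟨δ, _, b, fun a => (E.symm a).1.1, n, hmem, h1, h2, h3, h4, h5⟩⟩

end PartA4

set_option linter.unusedSectionVars false
set_option autoImplicit false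
open UniversalEnvelopingAlgebra
section PartB1
variable {K g : Type*} [Field K] [LieRing g] [LieAlgebra K g]

local notation "𝓤" => UniversalEnvelopingAlgebra K g
attribute [local instance] LieRing.ofAssociativeRing

lemma iota_lie (x y : g) : ι K ⁅x, y⁆ = ι K x * ι K y - ι K y * ι K x := by
  rw [LieHom.map_lie, Ring.lie_def]

lemma iota_comm (x y : g) : ι K x * ι K y = ι K y * ι K x + ι K ⁅x, y⁆ := by
  rw [iota_lie]; abel

/-- iota as a linear map -/
noncomputable def iotaL (K g : Type*) [Field K] [LieRing g] [LieAlgebra K g] :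
    g →ₗ[K] UniversalEnvelopingAlgebra K g := (ι K : g →ₗ⁅K⁆ UniversalEnvelopingAlgebra K g)

@[simp] lemma iotaL_apply (x : g) : iotaL K g x = ι K x := rfl

lemma U_adjoin : Algebra.adjoin K (Set.range (iotaL K g)) = ⊤ := by
  let S := Algebra.adjoin K (Set.range (iotaL K g))
  have hS : ∀ x : g, ι K x ∈ S := fun x => Algebra.subset_adjoin ⟨x, rfl⟩
  let f0 : g →ₗ⁅K⁆ S :=
    { toFun := fun x => ⟨ι K x, hS x⟩
      map_add' := fun x y => by ext; simp
      map_smul' := fun c x => by ext; simp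
      map_lie' := fun {x y} => by
        apply Subtype.ext
        change ι K ⁅x, y⁆ = _
        rw [iota_lie, Ring.lie_def]; rfl }
  have h : S.val.comp (lift K f0) = AlgHom.id K 𝓤 := by
    apply hom_ext
    ext x
    simp [f0]
  rw [eq_top_iff]
  intro u _
  have := congrArg (fun φ : 𝓤 →ₐ[K] 𝓤 => φ u) h
  simp only [AlgHom.comp_apply, AlgHom.id_apply] at this
  rw [← this]
  exact (lift K f0 u).2

/-- induction: left multiplication by generators -/
lemma U_induct {W : Submodule K 𝓤} (h1 : (1 : 𝓤) ∈ W)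
    (hm : ∀ (x : g) (u : 𝓤), u ∈ W → ι K x * u ∈ W) (u : 𝓤) : u ∈ W := by
  have key : ∀ v : 𝓤, ∀ u ∈ W, v * u ∈ W := by
    intro v
    have hv : v ∈ Algebra.adjoin K (Set.range (iotaL K g)) := by rw [U_adjoin]; trivial
    induction hv using Algebra.adjoin_induction with
    | mem x hx => obtain ⟨y, rfl⟩ := hx; exact fun u hu => hm y u hu
    | algebraMap r => intro u hu; rw [← Algebra.smul_def]; exact W.smul_mem _ hu
    | add x y _ _ hx hy => intro u hu; rw [add_mul]; exact add_mem (hx u hu) (hy u hu)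
    | mul x y _ _ hx hy => intro u hu; rw [mul_assoc]; exact hx _ (hy u hu)
  simpa using key u 1 h1

/-- filtration -/
noncomputable def Fil (K g : Type*) [Field K] [LieRing g] [LieAlgebra K g] (k : ℕ) :
    Submodule K (UniversalEnvelopingAlgebra K g) :=
  (1 ⊔ LinearMap.range (iotaL K g)) ^ k

lemma Fil_zero : Fil K g 0 = 1 := by simp [Fil]
lemma Fil_succ (k : ℕ) : Fil K g (k + 1) = (1 ⊔ LinearMap.range (iotaL K g)) * Fil K g k := by
  simp [Fil, pow_succ']
lemma Fil_mul (k l : ℕ) : Fil K g k * Fil K g l = Fil K g (k + l) := by simp [Fil, pow_add]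
lemma Fil_one : Fil K g 1 = 1 ⊔ LinearMap.range (iotaL K g) := by simp [Fil]

lemma Fil_le_succ (k : ℕ) : Fil K g k ≤ Fil K g (k + 1) := by
  rw [Fil_succ]
  intro u hu
  rw [← one_mul u]
  exact Submodule.mul_mem_mul (Submodule.mem_sup_left (Submodule.one_le.1 le_rfl)) hu

lemma Fil_mono {k l : ℕ} (h : k ≤ l) : Fil K g k ≤ Fil K g l :=
  monotone_nat_of_le_succ Fil_le_succ h

lemma one_mem_Fil (k : ℕ) : (1 : 𝓤) ∈ Fil K g k :=
  Fil_mono (Nat.zero_le k) (by rw [Fil_zero]; exact Submodule.one_le.1 le_rfl)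

lemma iota_mem_Fil (x : g) : ι K x ∈ Fil K g 1 := by
  rw [Fil_one]; exact Submodule.mem_sup_right ⟨x, rfl⟩

lemma mul_mem_Fil {k l : ℕ} {u v : 𝓤} (hu : u ∈ Fil K g k) (hv : v ∈ Fil K g l) :
    u * v ∈ Fil K g (k + l) := by
  rw [← Fil_mul]; exact Submodule.mul_mem_mul hu hv

lemma iota_mul_mem_Fil (x : g) {k : ℕ} {u : 𝓤} (hu : u ∈ Fil K g k) :
    ι K x * u ∈ Fil K g (k + 1) := by
  rw [add_comm]; exact mul_mem_Fil (iota_mem_Fil x) hu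

lemma exists_mem_Fil (u : 𝓤) : ∃ k, u ∈ Fil K g k := by
  let W : Submodule K 𝓤 :=
    { carrier := {u | ∃ k, u ∈ Fil K g k}
      add_mem' := by
        rintro a b ⟨k, hk⟩ ⟨l, hl⟩
        exact ⟨max k l, add_mem (Fil_mono (le_max_left _ _) hk) (Fil_mono (le_max_right _ _) hl)⟩
      zero_mem' := ⟨0, zero_mem _⟩
      smul_mem' := by
        rintro c a ⟨k, hk⟩
        exact ⟨k, Submodule.smul_mem _ _ hk⟩ }
  exact U_induct (W := W) ⟨0, one_mem_Fil 0⟩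
    (fun x u ⟨k, hk⟩ => ⟨k + 1, iota_mul_mem_Fil x hk⟩) u

/-- induction over the filtration step -/
lemma Fil_succ_le {k : ℕ} {W : Submodule K 𝓤} (h0 : Fil K g k ≤ W)
    (h1 : ∀ x : g, ∀ u ∈ Fil K g k, ι K x * u ∈ W) : Fil K g (k + 1) ≤ W := by
  rw [Fil_succ, Submodule.mul_le]
  intro m hm u hu
  obtain ⟨a, ha, b, ⟨x, rfl⟩, rfl⟩ := Submodule.mem_sup.1 hm
  obtain ⟨c, rfl⟩ := Submodule.mem_one.1 ha
  rw [add_mul, ← Algebra.smul_def]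
  exact add_mem (W.smul_mem _ (h0 hu)) (h1 x u hu)

lemma comm_mem_Fil (x : g) {k : ℕ} {u : 𝓤} (hu : u ∈ Fil K g k) :
    ι K x * u - u * ι K x ∈ Fil K g k := by
  induction k generalizing u with
  | zero =>
    rw [Fil_zero] at hu
    obtain ⟨c, rfl⟩ := Submodule.mem_one.1 hu
    rw [Algebra.commutes, sub_self]; exact zero_mem _
  | succ k ih =>
    let ad : 𝓤 →ₗ[K] 𝓤 := LinearMap.mulLeft K (ι K x) - LinearMap.mulRight K (ι K x)
    have : Fil K g (k + 1) ≤ (Fil K g (k + 1)).comap ad := by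
      apply Fil_succ_le
      · intro u hu; exact Fil_le_succ k (ih hu)
      · intro y u hu
        change ι K x * (ι K y * u) - (ι K y * u) * ι K x ∈ Fil K g (k + 1)
        have : ι K x * (ι K y * u) - (ι K y * u) * ι K x =
          ι K ⁅x, y⁆ * u + ι K y * (ι K x * u - u * ι K x) := by
          rw [iota_lie]; noncomm_ring
        rw [this]
        exact add_mem (iota_mul_mem_Fil _ hu) (iota_mul_mem_Fil _ (ih hu))
    exact this hu

lemma Fil_fg [Module.Finite K g] (k : ℕ) : (Fil K g k).FG := by
  apply Submodule.FG.pow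
  refine Submodule.FG.sup ?_ ?_
  · rw [Submodule.one_eq_span]; exact Submodule.fg_span_singleton 1
  · exact Module.Finite.fg_top.map (iotaL K g) |> fun h => by rwa [Submodule.map_top] at h

variable (T : TriangularDecomposition K g)

/-- elements with a factor in n plus or n minus, up to lower order -/
noncomputable def ZF : ℕ → Submodule K 𝓤
  | 0 => ⊥
  | k + 1 => Fil K g k ⊔ (T.nneg.toSubmodule ⊔ T.npos.toSubmodule).map (iotaL K g) * Fil K g k

lemma ZF_le_Fil (k : ℕ) : ZF T k ≤ Fil K g k := by
  cases k with
  | zero => exact bot_le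
  | succ k =>
    refine sup_le (Fil_le_succ k) ?_
    rw [Fil_succ]
    refine mul_le_mul' (le_sup_of_le_right ?_) le_rfl
    exact LinearMap.map_le_range

lemma ZF_succ_le {k : ℕ} {W : Submodule K 𝓤} (h0 : Fil K g k ≤ W)
    (h1 : ∀ x : g, x ∈ T.nneg.toSubmodule ⊔ T.npos.toSubmodule → ∀ u ∈ Fil K g k, ι K x * u ∈ W) :
    ZF T (k + 1) ≤ W := by
  refine sup_le h0 ?_
  rw [Submodule.mul_le]
  rintro _ ⟨x, hx, rfl⟩ u hu
  exact h1 x hx u hu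

lemma Fil_le_ZF (k : ℕ) : Fil K g k ≤ ZF T (k + 1) := le_sup_left

lemma iota_mul_mem_ZF {k : ℕ} {x : g} (hx : x ∈ T.nneg.toSubmodule ⊔ T.npos.toSubmodule) {u : 𝓤}
    (hu : u ∈ Fil K g k) : ι K x * u ∈ ZF T (k + 1) :=
  Submodule.mem_sup_right (Submodule.mul_mem_mul ⟨x, hx, rfl⟩ hu)

lemma ZF_le_succ (k : ℕ) : ZF T k ≤ ZF T (k + 1) := by
  cases k with
  | zero => exact bot_le
  | succ k =>
    exact ZF_succ_le T ((Fil_le_succ k).trans (Fil_le_ZF T _))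
      fun x hx u hu => iota_mul_mem_ZF T hx (Fil_le_succ k hu)

lemma ZF_mul_right {k l : ℕ} {u v : 𝓤} (hu : u ∈ ZF T k) (hv : v ∈ Fil K g l) :
    u * v ∈ ZF T (k + l) := by
  cases k with
  | zero =>
    have : u = 0 := hu
    rw [this, zero_mul]; exact zero_mem _
  | succ k =>
    have : ZF T (k + 1) ≤ (ZF T (k + 1 + l)).comap (LinearMap.mulRight K v) := by
      rw [add_right_comm]
      refine ZF_succ_le T (fun u hu => ?_) fun x hx u hu => ?_
      · exact Fil_le_ZF T _ (mul_mem_Fil hu hv)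
      · simp only [Submodule.mem_comap, LinearMap.mulRight_apply, mul_assoc]
        exact iota_mul_mem_ZF T hx (mul_mem_Fil hu hv)
    exact this hu

lemma iota_mul_ZF {k : ℕ} (y : g) {u : 𝓤} (hu : u ∈ ZF T k) : ι K y * u ∈ ZF T (k + 1) := by
  cases k with
  | zero =>
    have : u = 0 := hu
    rw [this, mul_zero]; exact zero_mem _
  | succ k =>
    have : ZF T (k + 1) ≤ (ZF T (k + 1 + 1)).comap (LinearMap.mulLeft K (ι K y)) := by
      refine ZF_succ_le T (fun u hu => ?_) fun x hx u hu => ?_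
      · exact Fil_le_ZF T _ (iota_mul_mem_Fil y hu)
      · simp only [Submodule.mem_comap, LinearMap.mulLeft_apply]
        rw [← mul_assoc, iota_comm, add_mul, mul_assoc]
        exact add_mem (iota_mul_mem_ZF T hx (iota_mul_mem_Fil y hu))
          (Fil_le_ZF T _ (iota_mul_mem_Fil _ hu))
    exact this hu

end PartB1

set_option linter.unusedSectionVars false
set_option autoImplicit false
set_option linter.unusedVariables false
set_option linter.unusedSimpArgs false
open UniversalEnvelopingAlgebra
section PartB2
variable {K g : Type*} [Field K] [LieRing g] [LieAlgebra K g]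
variable [CharZero K] [LieAlgebra.IsSemisimple K g]
variable (T : TriangularDecomposition K g)

local notation "𝓤" => UniversalEnvelopingAlgebra K g
attribute [local instance] LieRing.ofAssociativeRing

lemma basis_ind {N : ℕ} (b : Module.Basis (Fin N) K g) {P : g → Prop} (h0 : P 0)
    (hc : ∀ i, P (b i)) (ha : ∀ x y, P x → P y → P (x + y)) (hs : ∀ (c : K) x, P x → P (c • x))
    (v : g) : P v := by
  induction b.mem_span v using Submodule.span_induction with
  | mem x hx => obtain ⟨i, rfl⟩ := hx; exact hc i
  | zero => exact h0
  | add x y _ _ hx hy => exact ha x y hx hy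
  | smul c x _ hx => exact hs c x hx

lemma TriangularDecomposition.killing_nondeg (T : TriangularDecomposition K g) {x : g} (h : ∀ y, killingForm K g x y = 0) :
    x = 0 := by
  have := T.finite
  exact (LieAlgebra.IsKilling.killingForm_nondegenerate K g).1 x h

lemma TriangularDecomposition.exists_killing (T : TriangularDecomposition K g) (f : Module.Dual K g) :
    ∃ x, ∀ y, killingForm K g x y = f y := by
  have := T.finite
  refine ⟨(LinearMap.BilinForm.toDual (killingForm K g)
    (LieAlgebra.IsKilling.killingForm_nondegenerate K g)).symm f, fun y => ?_⟩
  rw [LinearMap.BilinForm.apply_toDual_symm_apply]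

lemma TriangularDecomposition.killing_H {σ : Module.Dual K T.H} (hσ : σ ≠ 0) (h : T.H) {x : g}
    (hx : x ∈ rootSpaceOf T.H σ) : killingForm K g h x = 0 := by
  obtain ⟨h', hh⟩ : ∃ h', σ h' ≠ 0 := by
    by_contra! hc
    exact hσ (LinearMap.ext hc)
  have h1 : killingForm K g ⁅(h : g), (h' : g)⁆ x = killingForm K g h ⁅(h' : g), x⁆ :=
    LieModule.traceForm_apply_lie_apply K g g _ _ _
  rw [T.abelian, hx h'] at h1
  simp only [map_zero, LinearMap.zero_apply, map_smul, smul_eq_mul] at h1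
  exact (mul_eq_zero.1 h1.symm).resolve_left hh

lemma TriangularDecomposition.killing_H_nn (h : T.H) {x : g}
    (hx : x ∈ T.nneg.toSubmodule ⊔ T.npos.toSubmodule) : killingForm K g h x = 0 := by
  have : T.nneg.toSubmodule ⊔ T.npos.toSubmodule ≤ LinearMap.ker (killingForm K g h) := by
    rw [T.npos_eq, T.nneg_eq]
    refine sup_le (iSup₂_le fun σ hσ x hx => ?_) (iSup₂_le fun σ hσ x hx => ?_)
    · exact T.killing_H (neg_ne_zero.2 (T.posRoots_ne_zero σ hσ)) h hx
    · exact T.killing_H (T.posRoots_ne_zero σ hσ) h hx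
  exact this hx

lemma TriangularDecomposition.killing_symm (T : TriangularDecomposition K g) (x y : g) : killingForm K g x y = killingForm K g y x :=
  LieModule.traceForm_comm K g g x y

lemma TriangularDecomposition.split (x : g) :
    ∃ h : T.H, ∃ y ∈ T.nneg.toSubmodule ⊔ T.npos.toSubmodule, x = h + y := by
  obtain ⟨⟨a, b, c⟩, h, -⟩ := T.decomp x
  refine ⟨b, a + c, add_mem (Submodule.mem_sup_left a.2) (Submodule.mem_sup_right c.2), ?_⟩
  rw [← h]; abel

lemma TriangularDecomposition.mem_H_of_perp {x : g}
    (hx : ∀ y ∈ T.nneg.toSubmodule ⊔ T.npos.toSubmodule, killingForm K g x y = 0) : x ∈ T.H := by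
  obtain ⟨h, y, hy, rfl⟩ := T.split x
  have : y = 0 := by
    apply T.killing_nondeg
    intro z
    obtain ⟨h', y', hy', rfl⟩ := T.split z
    rw [map_add, T.killing_symm y h', T.killing_H_nn h' hy, zero_add]
    have := hx y' hy'
    rwa [map_add, LinearMap.add_apply, T.killing_H_nn h hy', zero_add] at this
  rw [this, add_zero]; exact h.2

lemma TriangularDecomposition.mem_nn_of_perp {x : g}
    (hx : ∀ h : T.H, killingForm K g x h = 0) :
    x ∈ T.nneg.toSubmodule ⊔ T.npos.toSubmodule := by
  obtain ⟨h, y, hy, rfl⟩ := T.split x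
  have : (h : g) = 0 := by
    apply T.killing_nondeg
    intro z
    obtain ⟨h', y', hy', rfl⟩ := T.split z
    rw [map_add, T.killing_H_nn h hy', add_zero]
    have := hx h'
    rwa [map_add, LinearMap.add_apply, T.killing_symm y h', T.killing_H_nn h' hy, add_zero] at this
  rw [this, zero_add]; exact hy

variable {T} (D : T.HB)

lemma TriangularDecomposition.HB.exists_M : ∃ M : Matrix (Fin D.N) (Fin D.N) g,
    ∀ a c y, killingForm K g (M a c) y = LinearMap.toMatrix D.b D.b (LieModule.toEnd K g g y) a c := by
  have h : ∀ a c, ∃ x, ∀ y, killingForm K g x y =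
      LinearMap.toMatrix D.b D.b (LieModule.toEnd K g g y) a c := by
    intro a c
    let f : Module.Dual K g :=
      { toFun := fun y => LinearMap.toMatrix D.b D.b (LieModule.toEnd K g g y) a c
        map_add' := fun x y => by simp
        map_smul' := fun r x => by simp }
    exact T.exists_killing f
  choose M hM using h
  exact ⟨M, hM⟩

lemma TriangularDecomposition.HB.exists_central : ∃ (t : Fin D.N → g) (z : ℕ → 𝓤),
    (∀ a, t a ∈ T.H) ∧ (∀ d u, z d * u = u * z d) ∧
    Submodule.span K (Set.range t) = T.H.toSubmodule ∧
    ∀ d, z d - ∑ a, ι K (t a) ^ d ∈ ZF T d := by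
  classical
  obtain ⟨M, hM⟩ := D.exists_M
  have hval : ∀ (y : g) a c, LinearMap.toMatrix D.b D.b (LieModule.toEnd K g g y) a c =
      D.b.repr ⁅y, D.b c⁆ a := by
    intro y a c
    simp [LinearMap.toMatrix_apply]
  have hH : ∀ (h : T.H) a c, killingForm K g (M a c) h = if a = c then D.w a h else 0 := by
    intro h a c
    rw [hM, hval, D.mem c h]
    by_cases hac : a = c
    · subst hac; simp
    · simp [hac, Finsupp.single_apply, Ne.symm hac]
  have hn : ∀ a, ∀ y ∈ T.nneg.toSubmodule ⊔ T.npos.toSubmodule, killingForm K g (M a a) y = 0 := by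
    intro a
    have hr : ∀ σ : Module.Dual K T.H, σ ≠ 0 → ∀ y ∈ rootSpaceOf T.H σ,
        killingForm K g (M a a) y = 0 := by
      intro σ hσ y hy
      obtain ⟨h', hh⟩ : ∃ h', σ h' ≠ 0 := by
        by_contra! hc
        exact hσ (LinearMap.ext hc)
      have h1 : LinearMap.toMatrix D.b D.b (LieModule.toEnd K g g ⁅(h' : g), y⁆) a a = 0 := by
        have h2 : ∀ v : g, D.b.repr ⁅(h' : g), v⁆ a = D.w a h' * D.b.repr v a := by
          intro v
          refine basis_ind D.b (P := fun v => D.b.repr ⁅(h' : g), v⁆ a = D.w a h' * D.b.repr v a)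
            (by simp) (fun c => ?_) (fun x y hx hy => by simp [hx, hy, mul_add])
            (fun c x hx => by simp [hx]; ring) v
          rw [D.mem c h']
          by_cases hac : a = c
          · subst hac; simp
          · simp [Finsupp.single_apply, Ne.symm hac]
        rw [hval, lie_lie, map_sub, Finsupp.sub_apply, h2, D.mem a h', lie_smul, map_smul]
        simp
      rw [← hM, hy h', map_smul, smul_eq_mul] at h1
      exact (mul_eq_zero.1 h1).resolve_left hh
    intro y hy
    have : T.nneg.toSubmodule ⊔ T.npos.toSubmodule ≤ LinearMap.ker (killingForm K g (M a a)) := by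
      rw [T.npos_eq, T.nneg_eq]
      refine sup_le (iSup₂_le fun σ hσ x hx => ?_) (iSup₂_le fun σ hσ x hx => ?_)
      · exact hr _ (neg_ne_zero.2 (T.posRoots_ne_zero σ hσ)) _ hx
      · exact hr _ (T.posRoots_ne_zero σ hσ) _ hx
    exact this hy
  have htH : ∀ a, M a a ∈ T.H := fun a => T.mem_H_of_perp (hn a)
  let MU : Matrix (Fin D.N) (Fin D.N) 𝓤 := M.map (ι K)
  refine ⟨fun a => M a a, fun d => (MU ^ d).trace, htH, ?_, ?_, ?_⟩
  · -- central
    intro d u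
    have hgen : ∀ y : g, ι K y * (MU ^ d).trace = (MU ^ d).trace * ι K y := by
      intro y
      let Y0 := LinearMap.toMatrix D.b D.b (LieModule.toEnd K g g y)
      let Y : Matrix (Fin D.N) (Fin D.N) 𝓤 := Y0.map (algebraMap K 𝓤)
      let S : Matrix (Fin D.N) (Fin D.N) 𝓤 := Matrix.diagonal fun _ => ι K y
      have hlie : ∀ a c, ⁅y, M a c⁆ = ∑ e, (Y0 e c • M a e - Y0 a e • M e c) := by
        intro a c
        rw [← sub_eq_zero]
        apply T.killing_nondeg
        intro x
        have h1 : killingForm K g ⁅y, M a c⁆ x = - killingForm K g (M a c) ⁅y, x⁆ :=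
          LieModule.traceForm_apply_lie_apply' K g g _ _ _
        rw [map_sub, LinearMap.sub_apply, h1, hM, LieHom.map_lie, Ring.lie_def, map_sub,
          LinearMap.toMatrix_mul, LinearMap.toMatrix_mul, Matrix.sub_apply, Matrix.mul_apply,
          Matrix.mul_apply, map_sum, LinearMap.sum_apply]
        simp only [map_sub, LinearMap.sub_apply, map_smul, LinearMap.smul_apply, smul_eq_mul, hM]
        rw [Finset.sum_sub_distrib]
        simp only [Y0, mul_comm]
        ring
      have hcomm : Commute (S + Y) MU := by
        change (S + Y) * MU = MU * (S + Y)
        rw [add_mul, mul_add]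
        ext a c
        simp only [Matrix.add_apply]
        have e1 : (S * MU) a c = ι K y * ι K (M a c) := by simp [S, MU, Matrix.diagonal_mul]
        have e2 : (MU * S) a c = ι K (M a c) * ι K y := by simp [S, MU, Matrix.mul_diagonal]
        have e3 : (Y * MU) a c = ι K (∑ e, Y0 a e • M e c) := by
          rw [Matrix.mul_apply, map_sum]
          refine Finset.sum_congr rfl fun e _ => ?_
          simp [Y, MU, Algebra.smul_def]
        have e4 : (MU * Y) a c = ι K (∑ e, Y0 e c • M a e) := by
          rw [Matrix.mul_apply, map_sum]
          refine Finset.sum_congr rfl fun e _ => ?_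
          simp only [Y, MU, Matrix.map_apply, map_smul, Algebra.smul_def]
          rw [Algebra.commutes]
        rw [e1, e2, e3, e4, iota_comm, hlie, Finset.sum_sub_distrib, map_sub]
        abel
      have h2 := (hcomm.pow_right d).eq
      rw [add_mul, mul_add] at h2
      have h3 := congrArg Matrix.trace h2
      rw [Matrix.trace_add, Matrix.trace_add] at h3
      have h4 : (Y * MU ^ d).trace = (MU ^ d * Y).trace := by
        simp only [Matrix.trace, Matrix.diag_apply, Matrix.mul_apply]
        rw [Finset.sum_comm]
        refine Finset.sum_congr rfl fun a _ => Finset.sum_congr rfl fun c _ => ?_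
        simp only [Y, Matrix.map_apply]
        rw [Algebra.commutes]
      rw [h4] at h3
      have h5 := add_right_cancel h3
      simpa [S, Matrix.trace, Matrix.diagonal_mul, Matrix.mul_diagonal, Finset.mul_sum,
        Finset.sum_mul] using h5
    let W : Submodule K 𝓤 := LinearMap.ker (LinearMap.mulLeft K (MU ^ d).trace -
      LinearMap.mulRight K (MU ^ d).trace)
    have hW : ∀ u, u ∈ W ↔ (MU ^ d).trace * u = u * (MU ^ d).trace := by
      intro u
      simp [W, sub_eq_zero]
    rw [← hW]
    refine U_induct ?_ ?_ u
    · rw [hW]; simp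
    · intro x u hu
      rw [hW] at hu ⊢
      rw [← mul_assoc, ← hgen, mul_assoc, hu, mul_assoc]
  · -- span
    apply le_antisymm
    · rw [Submodule.span_le]; rintro _ ⟨a, rfl⟩; exact htH a
    intro h hh
    by_contra hns
    obtain ⟨f, hf1, hf2⟩ := Submodule.exists_le_ker_of_notMem hns
    -- modify f to vanish on nn
    let S : Submodule K g := T.nneg.toSubmodule ⊔ T.npos.toSubmodule
    have hdis : Disjoint T.H.toSubmodule S := by
      rw [Submodule.disjoint_def]
      intro x hx hxS
      obtain ⟨a, ha, c, hc, rfl⟩ := Submodule.mem_sup.1 hxS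
      have := T.disj ha (neg_mem hx) hc (by abel)
      rw [this.1, this.2.2, add_zero]
    have hcompl : IsCompl T.H.toSubmodule S := by
      refine ⟨hdis, ?_⟩
      rw [codisjoint_iff, eq_top_iff]
      intro x _
      obtain ⟨h, y, hy, rfl⟩ := T.split x
      exact add_mem (Submodule.mem_sup_left h.2) (Submodule.mem_sup_right hy)
    let p := Submodule.projectionOnto T.H.toSubmodule S hcompl
    let f' : Module.Dual K g := f ∘ₗ T.H.toSubmodule.subtype ∘ₗ p
    obtain ⟨x, hx⟩ := T.exists_killing f'
    have hxH : x ∈ T.H := by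
      apply T.mem_H_of_perp
      intro y hy
      rw [hx]
      have : p y = 0 := (Submodule.projectionOnto_apply_eq_zero_iff hcompl).2 hy
      simp [f', this]
    have hx0 : x = 0 := by
      have hc : x ∈ LieAlgebra.center K g := by
        rw [LieModule.mem_maxTrivSubmodule]
        intro v
        rw [← lie_skew, neg_eq_zero]
        refine basis_ind D.b (P := fun v => ⁅x, v⁆ = 0) (by simp) (fun c => ?_)
            (fun x y hx hy => by simp [hx, hy])
            (fun c x hx => by simp [hx]) v
        · have h1 := hH ⟨x, hxH⟩ c c
          rw [if_pos rfl, T.killing_symm, hx] at h1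
          have h2 : p (M c c) = ⟨M c c, htH c⟩ :=
            Submodule.projectionOnto_apply_left hcompl (⟨M c c, htH c⟩ : T.H.toSubmodule)
          have h3 : f' (M c c) = 0 := by
            simp only [f', LinearMap.comp_apply, h2]
            exact hf2 (Submodule.subset_span ⟨c, rfl⟩)
          rw [h3] at h1
          have := D.mem c ⟨x, hxH⟩
          rw [← h1, zero_smul] at this
          exact this
      rw [LieAlgebra.center_eq_bot] at hc
      simpa using hc
    have h2 : p h = ⟨h, hh⟩ :=
      Submodule.projectionOnto_apply_left hcompl (⟨h, hh⟩ : T.H.toSubmodule)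
    have h3 := hx h
    rw [hx0] at h3
    simp only [map_zero, LinearMap.zero_apply, f', LinearMap.comp_apply, h2] at h3
    exact hf1 h3.symm
  · intro d
    have hpow : ∀ d a c, (MU ^ d) a c - (if a = c then ι K (M a a) ^ d else 0) ∈ ZF T d := by
      intro d
      induction d with
      | zero =>
        intro a c
        by_cases hac : a = c
        · subst hac; simp
        · simp [hac]
      | succ d ih =>
        intro a c
        have hdec : (MU ^ (d + 1)) a c - (if a = c then ι K (M a a) ^ (d + 1) else 0) =
          ∑ e, (ι K (M a e) * (MU ^ d) e c -
            if a = e then (if a = c then ι K (M a a) ^ (d + 1) else 0) else 0) := by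
          rw [pow_succ', Matrix.mul_apply, Finset.sum_sub_distrib]
          simp [MU]
        rw [hdec]
        refine sum_mem fun e _ => ?_
        by_cases hae : a = e
        · subst hae
          rw [if_pos rfl]
          have := iota_mul_ZF T (M a a) (ih a c)
          convert this using 1
          by_cases hac : a = c
          · simp [hac, pow_succ', mul_sub]
          · simp [hac]
        · rw [if_neg hae, sub_zero]
          apply iota_mul_mem_ZF
          · apply T.mem_nn_of_perp
            intro h
            rw [hH, if_neg hae]
          · have h1 := ZF_le_Fil T d (ih e c)
            have h2 : (if e = c then ι K (M e e) ^ d else 0) ∈ Fil K g d := by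
              split_ifs
              · clear * -
                induction d with
                | zero => simpa using one_mem_Fil 0
                | succ d ih => rw [pow_succ']; exact iota_mul_mem_Fil _ ih
              · exact zero_mem _
            simpa using add_mem h1 h2
    have : (MU ^ d).trace - ∑ a, ι K (M a a) ^ d = ∑ a, ((MU ^ d) a a - ι K (M a a) ^ d) := by
      rw [Finset.sum_sub_distrib]; rfl
    rw [this]
    refine sum_mem fun a _ => ?_
    simpa using hpow d a a

end PartB2

set_option linter.unusedSectionVars false
set_option autoImplicit false
set_option linter.unusedVariables false
set_option linter.unusedSimpArgs false
open UniversalEnvelopingAlgebra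
section PartB3a
open MvPolynomial

lemma esymm_mem_psum (K : Type*) [Field K] [CharZero K] (N : ℕ) (k : ℕ) (hk : 0 < k) :
    esymm (Fin N) K k ∈ Ideal.span (Set.range fun d : ℕ => psum (Fin N) K (d + 1)) := by
  have h := MvPolynomial.mul_esymm_eq_sum (Fin N) K k
  have h2 : (k : MvPolynomial (Fin N) K) * esymm (Fin N) K k ∈
      Ideal.span (Set.range fun d : ℕ => psum (Fin N) K (d + 1)) := by
    rw [h]
    apply Ideal.mul_mem_left
    refine sum_mem fun a ha => ?_
    apply Ideal.mul_mem_left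
    rw [Finset.mem_filter, Finset.HasAntidiagonal.mem_antidiagonal] at ha
    apply Ideal.subset_span
    refine ⟨a.2 - 1, ?_⟩
    have : a.2 - 1 + 1 = a.2 := by omega
    simp only [this]
  have h3 := Ideal.mul_mem_left _ (C ((k : K)⁻¹)) h2
  rw [← mul_assoc, ← C_eq_coe_nat, ← C_mul, inv_mul_cancel₀ (by exact_mod_cast hk.ne'), C_1,
    one_mul] at h3
  exact h3

lemma X_pow_mem_psum (K : Type*) [Field K] [CharZero K] (N : ℕ) (a : Fin N) :
    (X a : MvPolynomial (Fin N) K) ^ N ∈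
      Ideal.span (Set.range fun d : ℕ => psum (Fin N) K (d + 1)) := by
  have h := MvPolynomial.prod_C_add_X_eq_sum_esymm K (Fin N)
  have h2 := congrArg (Polynomial.eval (-(X a : MvPolynomial (Fin N) K))) h
  rw [Polynomial.eval_prod, Finset.prod_eq_zero (Finset.mem_univ a) (by simp),
    Polynomial.eval_finsetSum, Finset.sum_range_succ'] at h2
  simp only [Polynomial.eval_mul, Polynomial.eval_C, Polynomial.eval_pow, Polynomial.eval_X,
    esymm_zero, one_mul, Fintype.card_fin, Nat.sub_zero] at h2
  have h3 : (-(X a : MvPolynomial (Fin N) K)) ^ N ∈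
      Ideal.span (Set.range fun d : ℕ => psum (Fin N) K (d + 1)) := by
    rw [eq_neg_of_add_eq_zero_right h2.symm]
    refine neg_mem (sum_mem fun i _ => ?_)
    exact Ideal.mul_mem_right _ _ (esymm_mem_psum K N _ (Nat.succ_pos _))
  rw [neg_pow] at h3
  have h4 := Ideal.mul_mem_left _ ((-1) ^ N) h3
  rwa [← mul_assoc, ← mul_pow, neg_one_mul, neg_neg, one_pow, one_mul] at h4

lemma homog_mem_psum (K : Type*) [Field K] [CharZero K] (N k : ℕ) (hk : N * N < k)
    (p : MvPolynomial (Fin N) K) (hp : p ∈ homogeneousSubmodule (Fin N) K k) :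
    p ∈ Ideal.span (Set.range fun d : ℕ => psum (Fin N) K (d + 1)) := by
  rw [p.as_sum]
  refine sum_mem fun m hm => ?_
  have hd : ∑ i, m i = k := by
    have := hp (mem_support_iff.1 hm)
    rw [Finsupp.weight_apply, Finsupp.sum_fintype _ _ (by simp)] at this
    simpa using this
  obtain ⟨a, ha⟩ : ∃ a, N ≤ m a := by
    by_contra! hcon
    have : ∑ i, m i ≤ ∑ i : Fin N, N := Finset.sum_le_sum fun i _ => (hcon i).le
    simp at this; omega
  have : monomial m (coeff m p) = monomial (m - Finsupp.single a N) (coeff m p) * X a ^ N := by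
    rw [X_pow_eq_monomial, monomial_mul, mul_one, tsub_add_cancel_of_le]
    rw [Finsupp.single_le_iff]; exact ha
  rw [this]
  exact Ideal.mul_mem_left _ _ (X_pow_mem_psum K N a)
end PartB3a

section PartB3
variable {K g : Type*} [Field K] [LieRing g] [LieAlgebra K g] [CharZero K]
  [LieAlgebra.IsSemisimple K g]

local notation "𝓤" => UniversalEnvelopingAlgebra K g
attribute [local instance] LieRing.ofAssociativeRing

/-- central elements with approximations -/
structure TriangularDecomposition.CZ (T : TriangularDecomposition K g) where
  N : ℕ
  t : Fin N → g
  z : ℕ → UniversalEnvelopingAlgebra K g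
  tH : ∀ a, t a ∈ T.H
  comm : ∀ d u, z d * u = u * z d
  span_eq : Submodule.span K (Set.range t) = T.H.toSubmodule
  approx : ∀ d, z d - ∑ a, ι K (t a) ^ d ∈ ZF T d

variable {T : TriangularDecomposition K g}

lemma TriangularDecomposition.exists_cz (T : TriangularDecomposition K g) : Nonempty T.CZ := by
  obtain ⟨D⟩ := T.exists_hb
  obtain ⟨t, z, h1, h2, h3, h4⟩ := D.exists_central
  exact ⟨⟨D.N, t, z, h1, h2, h3, h4⟩⟩

open scoped IsMulCommutative in
lemma TriangularDecomposition.CZ.exists_ev (Z : T.CZ) :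
    ∃ ev : MvPolynomial (Fin Z.N) K →ₐ[K] 𝓤, ∀ a, ev (MvPolynomial.X a) = ι K (Z.t a) := by
  have hc : ∀ x ∈ Set.range (fun a => ι K (Z.t a)), ∀ y ∈ Set.range (fun a => ι K (Z.t a)),
      x * y = y * x := by
    rintro _ ⟨a, rfl⟩ _ ⟨b, rfl⟩
    have := T.abelian ⟨_, Z.tH a⟩ ⟨_, Z.tH b⟩
    simp only at this
    simp only
    rw [iota_comm, this]; simp
  have := Algebra.isMulCommutative_adjoin K hc
  let A := Algebra.adjoin K (Set.range (fun a => ι K (Z.t a)))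
  refine ⟨A.val.comp (MvPolynomial.aeval fun a => ⟨ι K (Z.t a), Algebra.subset_adjoin ⟨a, rfl⟩⟩), ?_⟩
  intro a
  simp [A]

lemma TriangularDecomposition.CZ.red (Z : T.CZ) (G : ℕ → Submodule K 𝓤)
    (h1 : ∀ k, Fil K g k ≤ G (k + 1))
    (h2 : ∀ k, ∀ x ∈ T.nneg.toSubmodule ⊔ T.npos.toSubmodule, ∀ u ∈ Fil K g k,
      ι K x * u ∈ G (k + 1))
    (h3 : ∀ k d, ∀ u ∈ Fil K g k, Z.z (d + 1) * u ∈ G (k + (d + 1)))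
    (k : ℕ) (hk : Z.N * Z.N < k) : Fil K g k ≤ G k := by
  obtain ⟨ev, hev⟩ := Z.exists_ev
  have hZF : ∀ k, ZF T k ≤ G k := by
    intro k
    cases k with
    | zero => exact bot_le
    | succ k => exact ZF_succ_le T (h1 k) (h2 k)
  have hmon : ∀ (m : Fin Z.N →₀ ℕ) (c : K), ev (MvPolynomial.monomial m c) ∈ Fil K g m.degree := by
    intro m
    induction m using Finsupp.induction with
    | zero =>
      intro c
      have : (MvPolynomial.monomial 0 c : MvPolynomial (Fin Z.N) K) = algebraMap K _ c := rfl
      rw [this, AlgHom.commutes, Algebra.algebraMap_eq_smul_one]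
      exact Submodule.smul_mem _ _ (one_mem_Fil _)
    | single_add a b f ha hb ih =>
      intro c
      have : (MvPolynomial.monomial (Finsupp.single a b + f) c : MvPolynomial (Fin Z.N) K) =
        MvPolynomial.X a ^ b * MvPolynomial.monomial f c := by
        rw [MvPolynomial.X_pow_eq_monomial, MvPolynomial.monomial_mul, one_mul]
      rw [this, map_mul, map_pow, hev, map_add, Finsupp.degree_single]
      refine mul_mem_Fil ?_ (ih c)
      clear * -
      induction b with
      | zero => simpa using one_mem_Fil 0
      | succ d ih => rw [pow_succ']; exact iota_mul_mem_Fil _ ih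
  have hpsum : ∀ d, ∀ k, ∀ u ∈ Fil K g k,
      ev (MvPolynomial.psum (Fin Z.N) K (d + 1)) * u ∈ G (k + (d + 1)) := by
    intro d k u hu
    have e : ev (MvPolynomial.psum (Fin Z.N) K (d + 1)) = ∑ a, ι K (Z.t a) ^ (d + 1) := by
      simp [MvPolynomial.psum, hev]
    have e2 := hZF _ (ZF_mul_right T (Z.approx (d + 1)) hu)
    rw [add_comm _ k] at e2
    have := sub_mem (h3 k d u hu) e2
    rw [e]
    convert this using 1
    noncomm_ring
  have hid : ∀ p ∈ Ideal.span (Set.range fun d : ℕ => MvPolynomial.psum (Fin Z.N) K (d + 1)),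
      ∀ k, ev (MvPolynomial.homogeneousComponent k p) ∈ G k := by
    intro p hp
    induction hp using Submodule.closure_induction with
    | zero => intro k; simp
    | add x y _ _ hx hy => intro k; rw [map_add, map_add]; exact add_mem (hx k) (hy k)
    | smul_mem q x hx =>
      obtain ⟨d, rfl⟩ := hx
      intro k
      induction q using MvPolynomial.induction_on' with
      | add p q hp hq => rw [add_smul, map_add, map_add]; exact add_mem hp hq
      | monomial m c =>
        have hh : (MvPolynomial.monomial m c • MvPolynomial.psum (Fin Z.N) K (d + 1)).IsHomogeneous
            (m.degree + (d + 1)) := by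
          rw [smul_eq_mul]
          exact (MvPolynomial.isHomogeneous_monomial c rfl).mul (MvPolynomial.IsHomogeneous.sum _ _ _
            fun i _ => MvPolynomial.isHomogeneous_X_pow i _)
        rw [MvPolynomial.homogeneousComponent_of_mem hh]
        split_ifs with hk
        · rw [hk, smul_eq_mul, mul_comm, map_mul]
          exact hpsum d _ _ (hmon m c)
        · simp
  have hFil : ∀ k, Fil K g k ≤ (MvPolynomial.homogeneousSubmodule (Fin Z.N) K k).map ev.toLinearMap
      ⊔ ZF T k := by
    intro k
    induction k with
    | zero =>
      rw [Fil_zero, Submodule.one_le]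
      refine Submodule.mem_sup_left ⟨1, MvPolynomial.isHomogeneous_one _ _, by simp⟩
    | succ k ih =>
      refine Fil_succ_le ((Fil_le_ZF T k).trans le_sup_right) fun x u hu => ?_
      obtain ⟨h, y, hy, rfl⟩ := T.split x
      rw [map_add, add_mul]
      refine add_mem ?_ (Submodule.mem_sup_right (iota_mul_mem_ZF T hy hu))
      obtain ⟨_, ⟨p, hp, rfl⟩, v, hv, rfl⟩ := Submodule.mem_sup.1 (ih hu)
      rw [mul_add]
      refine add_mem ?_ (Submodule.mem_sup_right (iota_mul_ZF T _ hv))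
      refine Submodule.mem_sup_left ?_
      have hh : (h : g) ∈ Submodule.span K (Set.range Z.t) := by rw [Z.span_eq]; exact h.2
      generalize (h : g) = h' at hh
      induction hh using Submodule.span_induction with
      | zero => simp
      | add x y _ _ hx hy => rw [map_add, add_mul]; exact add_mem hx hy
      | smul c x _ hx => rw [map_smul, smul_mul_assoc]; exact Submodule.smul_mem _ _ hx
      | mem x hx =>
        obtain ⟨a, rfl⟩ := hx
        refine ⟨MvPolynomial.X a * p, ?_, by simp [hev]⟩
        rw [add_comm]
        exact (MvPolynomial.isHomogeneous_X K a).mul hp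
  refine (hFil k).trans (sup_le ?_ (hZF k))
  rintro _ ⟨p, hp, rfl⟩
  have := hid p (homog_mem_psum K Z.N k hk p hp) k
  rw [MvPolynomial.homogeneousComponent_of_mem hp, if_pos rfl] at this
  exact this
end PartB3

set_option linter.unusedSectionVars false
set_option autoImplicit false
set_option linter.unusedVariables false
set_option linter.unusedSimpArgs false
open UniversalEnvelopingAlgebra
section PartC1
variable {K g : Type*} [Field K] [LieRing g] [LieAlgebra K g]

local notation "𝓤" => UniversalEnvelopingAlgebra K g
attribute [local instance] LieRing.ofAssociativeRing
open Polynomial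

/-- words -/
noncomputable def wd {N : ℕ} (b : Fin N → g) (L : List (Fin N)) : 𝓤 :=
  (L.map fun i => ι K (b i)).prod

lemma wd_cons {N : ℕ} (b : Fin N → g) (i) (L : List (Fin N)) :
    wd (K := K) b (i :: L) = ι K (b i) * wd b L := by simp [wd]

lemma wd_mem {N : ℕ} (b : Fin N → g) (L : List (Fin N)) : wd b L ∈ Fil K g L.length := by
  induction L with
  | nil => simpa [wd] using one_mem_Fil 0
  | cons i L ih => rw [wd_cons]; exact iota_mul_mem_Fil _ ih

/-- the previous filtration step -/
noncomputable def Fil' (K g : Type*) [Field K] [LieRing g] [LieAlgebra K g] :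
    ℕ → Submodule K (UniversalEnvelopingAlgebra K g)
  | 0 => ⊥
  | k + 1 => Fil K g k

lemma iota_mul_mem_Fil' (x : g) {k : ℕ} {u : 𝓤} (hu : u ∈ Fil' K g k) :
    ι K x * u ∈ Fil' K g (k + 1) := by
  cases k with
  | zero => rw [(show u = 0 from hu), mul_zero]; exact zero_mem _
  | succ k => exact iota_mul_mem_Fil x hu

lemma wd_perm {N : ℕ} (b : Fin N → g) {L L' : List (Fin N)} (h : L.Perm L') :
    wd b L - wd b L' ∈ Fil' K g L.length := by
  induction h with
  | nil => simp
  | cons x h ih =>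
    rw [wd_cons, wd_cons, ← mul_sub]; exact iota_mul_mem_Fil' _ ih
  | swap x y l =>
    simp only [wd_cons]
    rw [← mul_assoc, ← mul_assoc, ← sub_mul, ← iota_lie]
    exact iota_mul_mem_Fil _ (wd_mem b l)
  | trans h1 h2 ih1 ih2 =>
    rw [← h1.length_eq] at ih2
    simpa using add_mem ih1 ih2

variable {S : Type*} [AddCommGroup S] [Module (UniversalEnvelopingAlgebra K g) S] [Module K[X] S]

/-- filtration on a module -/
noncomputable def Sf (K : Type*) {g S : Type*} [Field K] [LieRing g] [LieAlgebra K g]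
    [AddCommGroup S] [Module (UniversalEnvelopingAlgebra K g) S] [Module K[X] S]
    (F : Submodule K (UniversalEnvelopingAlgebra K g)) (s : S) : Submodule K[X] S :=
  Submodule.span _ ((fun u : UniversalEnvelopingAlgebra K g => u • s) '' (F : Set _))

lemma smul_mem_Sf {F : Submodule K 𝓤} {u : 𝓤} (hu : u ∈ F) (s : S) : u • s ∈ Sf K F s :=
  Submodule.subset_span ⟨u, hu, rfl⟩

lemma Sf_mono {F G : Submodule K 𝓤} (h : F ≤ G) (s : S) : Sf K F s ≤ Sf K G s :=
  Submodule.span_mono (Set.image_mono h)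

lemma Sf_smul (hc : ∀ (r : K[X]) (u : 𝓤) (x : S), r • (u • x) = u • (r • x))
    {F G : Submodule K 𝓤} {v : 𝓤} (hv : ∀ u ∈ F, v * u ∈ G) {s x : S} (hx : x ∈ Sf K F s) :
    v • x ∈ Sf K G s := by
  induction hx using Submodule.span_induction with
  | zero => rw [smul_zero]; exact zero_mem _
  | add x y _ _ hx hy => rw [smul_add]; exact add_mem hx hy
  | smul c x _ hx => rw [← hc]; exact Submodule.smul_mem _ _ hx
  | mem x hx =>
    obtain ⟨u, hu, rfl⟩ := hx
    simp only [← mul_smul]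
    exact smul_mem_Sf (hv u hu) s

lemma Fil_le_words {N : ℕ} (b : Module.Basis (Fin N) K g) (k : ℕ) :
    Fil K g k ≤ Submodule.span K (wd (K := K) b '' {L | L.length = k}) ⊔ Fil' K g k := by
  induction k with
  | zero =>
    rw [Fil_zero, Submodule.one_le]
    exact Submodule.mem_sup_left (Submodule.subset_span ⟨[], by simp, by simp [wd]⟩)
  | succ k ih =>
    refine Fil_succ_le le_sup_right fun x u hu => ?_
    obtain ⟨p, hp, v, hv, rfl⟩ := Submodule.mem_sup.1 (ih hu)
    clear hu
    rw [mul_add]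
    refine add_mem (Submodule.mem_sup_left ?_) (Submodule.mem_sup_right (iota_mul_mem_Fil' _ hv))
    have hx : x ∈ Submodule.span K (Set.range b) := by rw [b.span_eq]; trivial
    induction hx using Submodule.span_induction with
    | zero => simp
    | add x y _ _ hx hy => rw [map_add, add_mul]; exact add_mem hx hy
    | smul c x _ hx => rw [map_smul, smul_mul_assoc]; exact Submodule.smul_mem _ _ hx
    | mem x hx =>
      obtain ⟨i, rfl⟩ := hx
      induction hp using Submodule.span_induction with
      | zero => simp
      | add x y _ _ hx hy => rw [mul_add]; exact add_mem hx hy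
      | smul c x _ hx => rw [mul_smul_comm]; exact Submodule.smul_mem _ _ hx
      | mem x hx =>
        obtain ⟨L, hL, rfl⟩ := hx
        exact Submodule.subset_span ⟨i :: L, by simpa using hL, wd_cons _ _ _⟩

lemma quillen_aux [Module.Finite K g] [CharZero K]
    (hc : ∀ (r : K[X]) (u : 𝓤) (x : S), r • (u • x) = u • (r • x))
    (hC : ∀ (c : K) (x : S), (C c : K[X]) • x = algebraMap K 𝓤 c • x)
    (hinj : ∀ (r : K[X]) (x : S), r ≠ 0 → r • x = 0 → x = 0)
    (hsurj : ∀ (r : K[X]) (x : S), r ≠ 0 → ∃ y, r • y = x)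
    (s : S) (hs : s ≠ 0) (hgen : ∀ x, ∃ u : 𝓤, x = u • s) : False := by
  classical
  obtain ⟨N, ⟨b⟩⟩ : ∃ N, Nonempty (Module.Basis (Fin N) K g) :=
    ⟨_, ⟨Module.finBasis K g⟩⟩
  let P := MvPolynomial (Fin N) K[X]
  let lst : (Fin N →₀ ℕ) → List (Fin N) := fun m => (Finsupp.toMultiset m).toList
  have hlst : ∀ m, (lst m).length = m.degree := fun m => by
    simp only [lst, Multiset.length_toList, Finsupp.card_toMultiset]; rfl
  let Φ : P →ₗ[K[X]] S :=
    (MvPolynomial.basisMonomials (Fin N) K[X]).constr K[X] fun m => wd (K := K) b (lst m) • s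
  have hΦ : ∀ m r, Φ (MvPolynomial.monomial m r) = r • (wd (K := K) b (lst m) • s) := by
    intro m r
    have : (MvPolynomial.monomial m r : P) = r • MvPolynomial.basisMonomials (Fin N) K[X] m := by
      simp [MvPolynomial.smul_monomial]
    rw [this, map_smul, Module.Basis.constr_basis]
  have hΦX : ∀ k, ∀ p : P, p.IsHomogeneous k → ∀ i,
      Φ (MvPolynomial.X i * p) - ι K (b i) • Φ p ∈ Sf K (Fil' K g (k + 1)) s := by
    intro k p hp i
    rw [p.as_sum, Finset.mul_sum, map_sum, map_sum, Finset.smul_sum, ← Finset.sum_sub_distrib]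
    refine sum_mem fun m hm => ?_
    have hd : m.degree = k := by
      have := hp (MvPolynomial.mem_support_iff.1 hm)
      rw [← this]
      exact DFunLike.congr_fun Finsupp.degree_eq_weight_one m
    have : (MvPolynomial.X i * MvPolynomial.monomial m (MvPolynomial.coeff m p) : P) =
      MvPolynomial.monomial (Finsupp.single i 1 + m) (MvPolynomial.coeff m p) := by
      rw [MvPolynomial.X, MvPolynomial.monomial_mul, one_mul]
    rw [this, hΦ, hΦ, ← hc, ← smul_sub, ← mul_smul, ← sub_smul]
    refine Submodule.smul_mem _ _ (smul_mem_Sf ?_ s)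
    rw [← wd_cons]
    have hperm : (lst (Finsupp.single i 1 + m)).Perm (i :: lst m) := by
      rw [← Multiset.coe_eq_coe, ← Multiset.cons_coe]
      simp [lst]
    have := wd_perm (K := K) b hperm
    rw [hlst] at this
    convert this using 2
    simp [hd, add_comm]
  -- the ideal of relations
  have hcompX : ∀ (k : ℕ) (p : P) (i), MvPolynomial.homogeneousComponent (k + 1)
      (MvPolynomial.X i * p) = MvPolynomial.X i * MvPolynomial.homogeneousComponent k p := by
    intro k p i
    induction p using MvPolynomial.induction_on' with
    | add p q hp hq => rw [mul_add, map_add, map_add, hp, hq, mul_add]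
    | monomial m c =>
      have h1 : (MvPolynomial.monomial m c : P).IsHomogeneous m.degree :=
        MvPolynomial.isHomogeneous_monomial c rfl
      rw [MvPolynomial.homogeneousComponent_of_mem h1,
        MvPolynomial.homogeneousComponent_of_mem ((MvPolynomial.isHomogeneous_X _ i).mul h1)]
      by_cases hk : k = m.degree
      · rw [if_pos hk, if_pos (by omega)]
      · rw [if_neg hk, if_neg (by omega), mul_zero]
  have hcompX0 : ∀ (p : P) (i), MvPolynomial.homogeneousComponent 0
      (MvPolynomial.X i * p) = 0 := by
    intro p i
    rw [MvPolynomial.homogeneousComponent_zero, ← MvPolynomial.constantCoeff_eq]; simp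
  let Q : Ideal P :=
    { carrier := {p | ∀ k, Φ (MvPolynomial.homogeneousComponent k p) ∈ Sf K (Fil' K g k) s}
      add_mem' := fun {p q} hp hq k => by rw [map_add, map_add]; exact add_mem (hp k) (hq k)
      zero_mem' := fun k => by simp
      smul_mem' := by
        intro r p hp
        induction r using MvPolynomial.induction_on generalizing p with
        | C r =>
          intro k
          rw [smul_eq_mul, MvPolynomial.homogeneousComponent_C_mul, ← MvPolynomial.smul_eq_C_mul,
            map_smul]
          exact Submodule.smul_mem _ _ (hp k)
        | add r q hr hq =>
          intro k
          rw [add_smul, map_add, map_add]; exact add_mem (hr hp k) (hq hp k)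
        | mul_X r i hr =>
          rw [mul_smul]
          apply hr
          intro k
          rw [smul_eq_mul]
          cases k with
          | zero => rw [hcompX0]; simp
          | succ k =>
            rw [hcompX]
            have h1 := hΦX k _ (MvPolynomial.homogeneousComponent_isHomogeneous k p) i
            have h2 : ι K (b i) • Φ (MvPolynomial.homogeneousComponent k p) ∈
              Sf K (Fil' K g (k + 1)) s := Sf_smul hc (fun u hu => iota_mul_mem_Fil' _ hu) (hp k)
            simpa using add_mem h1 h2 }
  have hQ : ∀ k (p : P), p.IsHomogeneous k → (p ∈ Q ↔ Φ p ∈ Sf K (Fil' K g k) s) := by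
    intro k p hp
    constructor
    · intro h
      have := h k
      rwa [MvPolynomial.homogeneousComponent_of_mem hp, if_pos rfl] at this
    · intro h l
      rw [MvPolynomial.homogeneousComponent_of_mem hp]
      split_ifs with hl
      · rwa [hl]
      · simp
  let Qs : Ideal P :=
    { carrier := {p | ∃ r : K[X], r ≠ 0 ∧ MvPolynomial.C r * p ∈ Q}
      add_mem' := by
        rintro p q ⟨r, hr, hp⟩ ⟨r', hr', hq⟩
        refine ⟨r * r', mul_ne_zero hr hr', ?_⟩
        have := add_mem (Q.mul_mem_left (MvPolynomial.C r') hp) (Q.mul_mem_left (MvPolynomial.C r) hq)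
        convert this using 1
        rw [map_mul]; ring
      zero_mem' := ⟨1, one_ne_zero, by simp⟩
      smul_mem' := by
        rintro c p ⟨r, hr, hp⟩
        refine ⟨r, hr, ?_⟩
        rw [smul_eq_mul, mul_left_comm]
        exact Q.mul_mem_left _ hp }
  obtain ⟨f, hf0, hf⟩ : ∃ f : K[X], f ≠ 0 ∧ ∀ p ∈ Qs, MvPolynomial.C f * p ∈ Q := by
    obtain ⟨F, hF⟩ := (inferInstance : IsNoetherianRing P).noetherian Qs
    have hF' : ∀ p ∈ F, ∃ r : K[X], r ≠ 0 ∧ MvPolynomial.C r * p ∈ Q := fun p hp =>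
      (hF ▸ Submodule.subset_span hp : p ∈ Qs)
    choose! r hr0 hr using hF'
    refine ⟨∏ p ∈ F, r p, Finset.prod_ne_zero_iff.2 hr0, fun p hp => ?_⟩
    rw [← hF] at hp
    induction hp using Submodule.span_induction with
    | zero => simp
    | add x y _ _ hx hy => rw [mul_add]; exact add_mem hx hy
    | smul c x _ hx => rw [smul_eq_mul, mul_left_comm]; exact Q.mul_mem_left _ hx
    | mem x hx =>
      rw [← Finset.prod_erase_mul F r hx, map_mul, mul_assoc]
      exact Q.mul_mem_left _ (hr x hx)
  obtain ⟨c, hfc⟩ : ∃ c, f.eval c ≠ 0 := by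
    by_contra! h
    exact hf0 (Polynomial.funext (by simpa using h))
  obtain ⟨h, hh⟩ : ∃ h, f = (X - C c) * h + C (f.eval c) :=
    ⟨f /ₘ (X - C c), by rw [← Polynomial.modByMonic_X_sub_C_eq_C_eval, add_comm, Polynomial.modByMonic_add_div]⟩
  obtain ⟨y, hy⟩ := hsurj (X - C c) s (Polynomial.X_sub_C_ne_zero c)
  -- y lies in every step
  have hstep : ∀ k, y ∈ Sf K (Fil K g k) s → (X - C c : K[X]) • y ∈ Sf K (Fil' K g k) s →
      y ∈ Sf K (Fil' K g k) s := by
    intro k hyk hyk'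
    obtain ⟨p, hp, hpy⟩ : ∃ p : P, p.IsHomogeneous k ∧ y - Φ p ∈ Sf K (Fil' K g k) s := by
      clear hyk' hy
      induction hyk using Submodule.span_induction with
      | zero => exact ⟨0, MvPolynomial.isHomogeneous_zero _ _ _, by simp⟩
      | add x y _ _ hx hy =>
        obtain ⟨p, hp, hp'⟩ := hx
        obtain ⟨q, hq, hq'⟩ := hy
        refine ⟨p + q, hp.add hq, ?_⟩
        rw [map_add, add_sub_add_comm]
        exact add_mem hp' hq'
      | smul r x _ hx =>
        obtain ⟨p, hp, hp'⟩ := hx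
        refine ⟨r • p, (MvPolynomial.homogeneousSubmodule (Fin N) K[X] k).smul_mem _ hp, ?_⟩
        rw [map_smul, ← smul_sub]
        exact Submodule.smul_mem _ _ hp'
      | mem x hx =>
        obtain ⟨u, hu, rfl⟩ := hx
        obtain ⟨w, hw, v, hv, rfl⟩ := Submodule.mem_sup.1 (Fil_le_words b k hu)
        suffices ∃ p : P, p.IsHomogeneous k ∧ w • s - Φ p ∈ Sf K (Fil' K g k) s by
          obtain ⟨p, hp, hp'⟩ := this
          refine ⟨p, hp, ?_⟩
          have := add_mem hp' (smul_mem_Sf hv s)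
          convert this using 1
          simp only [add_smul]; abel
        clear hu
        induction hw using Submodule.span_induction with
        | zero => exact ⟨0, MvPolynomial.isHomogeneous_zero _ _ _, by simp⟩
        | add x y _ _ hx hy =>
          obtain ⟨p, hp, hp'⟩ := hx
          obtain ⟨q, hq, hq'⟩ := hy
          refine ⟨p + q, hp.add hq, ?_⟩
          rw [map_add, add_smul, add_sub_add_comm]
          exact add_mem hp' hq'
        | smul r x _ hx =>
          obtain ⟨p, hp, hp'⟩ := hx
          refine ⟨(C r : K[X]) • p,
            (MvPolynomial.homogeneousSubmodule (Fin N) K[X] k).smul_mem _ hp, ?_⟩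
          rw [map_smul, Algebra.smul_def, mul_smul, ← hC, ← smul_sub]
          exact Submodule.smul_mem _ _ hp'
        | mem x hx =>
          obtain ⟨L, hL, rfl⟩ := hx
          have hperm : L.Perm (lst (Multiset.toFinsupp (L : Multiset (Fin N)))) := by
            rw [← Multiset.coe_eq_coe]
            simp [lst]
          refine ⟨MvPolynomial.monomial (Multiset.toFinsupp (L : Multiset (Fin N))) 1,
            MvPolynomial.isHomogeneous_monomial _ ?_, ?_⟩
          · rw [← hlst, ← hperm.length_eq]; exact hL
          · rw [hΦ, one_smul, ← sub_smul]
            have := wd_perm (K := K) b hperm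
            rw [show L.length = k from hL] at this
            exact smul_mem_Sf this s
    have h1 : MvPolynomial.C (X - C c : K[X]) * p ∈ Q := by
      rw [← MvPolynomial.smul_eq_C_mul, hQ k, map_smul]
      · have := sub_mem hyk' (Submodule.smul_mem _ (X - C c : K[X]) hpy)
        simpa [smul_sub] using this
      · exact (MvPolynomial.homogeneousSubmodule (Fin N) K[X] k).smul_mem _ hp
    have h2 := hf p ⟨_, Polynomial.X_sub_C_ne_zero c, h1⟩
    rw [← MvPolynomial.smul_eq_C_mul, hQ k, map_smul] at h2
    · have h3 := add_mem (Submodule.smul_mem _ f hpy) h2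
      rw [← smul_add, sub_add_cancel, hh, add_smul, mul_comm, mul_smul] at h3
      have h4 := (Submodule.add_mem_iff_right _ (Submodule.smul_mem _ h hyk')).1 h3
      have h5 := Submodule.smul_mem _ (C (f.eval c)⁻¹) h4
      rwa [← mul_smul, ← C_mul, inv_mul_cancel₀ hfc, C_1, one_smul] at h5
    · exact (MvPolynomial.homogeneousSubmodule (Fin N) K[X] k).smul_mem _ hp
  have hs0 : s ∈ Sf K (Fil K g 0) s := by
    simpa using smul_mem_Sf (one_mem_Fil (K := K) (g := g) 0) s
  have hy0 : ∀ k, y ∈ Sf K (Fil K g k) s → y ∈ Sf K (Fil K g 0) s := by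
    intro k
    induction k with
    | zero => exact id
    | succ k ih =>
      intro hk
      apply ih
      apply hstep (k + 1) hk
      rw [hy]
      exact Sf_mono (Fil_mono (Nat.zero_le k)) s hs0
  obtain ⟨u, hu⟩ := hgen y
  obtain ⟨k, hk⟩ := exists_mem_Fil u
  have := hy0 k (hu ▸ smul_mem_Sf hk s)
  obtain ⟨q, hq⟩ : ∃ q : K[X], y = q • s := by
    clear hy hu hstep hy0
    induction this using Submodule.span_induction with
    | zero => exact ⟨0, by simp⟩
    | add x y _ _ hx hy =>
      obtain ⟨p, rfl⟩ := hx
      obtain ⟨q, rfl⟩ := hy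
      exact ⟨p + q, by rw [add_smul]⟩
    | smul r x _ hx =>
      obtain ⟨p, rfl⟩ := hx
      exact ⟨r * p, by rw [mul_smul]⟩
    | mem x hx =>
      obtain ⟨v, hv, rfl⟩ := hx
      rw [Fil_zero] at hv
      obtain ⟨a, rfl⟩ := Submodule.mem_one.1 hv
      exact ⟨C a, (hC a s).symm⟩
  rw [hq, ← mul_smul] at hy
  have h6 : ((X - C c) * q - 1) • s = 0 := by rw [sub_smul, hy, one_smul, sub_self]
  refine hs (hinj _ s ?_ h6)
  intro h7
  have := congrArg (Polynomial.eval c) h7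
  simp at this

lemma quillen [Module.Finite K g] [CharZero K] [IsAlgClosed K] {S : Type*} [AddCommGroup S]
    [Module (UniversalEnvelopingAlgebra K g) S] [IsSimpleModule (UniversalEnvelopingAlgebra K g) S]
    (z : 𝓤) (hz : ∀ u, z * u = u * z) : ∃ c : K, ∀ s : S, (z - algebraMap K 𝓤 c) • s = 0 := by
  classical
  have hcen : ∀ (r : K[X]) (u : 𝓤), aeval z r * u = u * aeval z r := by
    intro r u
    induction r using Polynomial.induction_on' with
    | add p q hp hq => rw [map_add, add_mul, mul_add, hp, hq]
    | monomial n a =>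
      rw [aeval_monomial, mul_assoc, ((show Commute z u from hz u).pow_left n).eq, ← mul_assoc,
        Algebra.commutes, mul_assoc]
  let ρ : K[X] → (S →ₗ[𝓤] S) := fun r =>
    { toFun := fun x => aeval z r • x
      map_add' := fun x y => smul_add _ _ _
      map_smul' := fun u x => by simp only [← mul_smul, hcen, RingHom.id_apply] }
  have hρ : ∀ r, Function.Bijective (ρ r) ∨ ρ r = 0 := fun r => LinearMap.bijective_or_eq_zero _
  obtain ⟨s, hs⟩ : ∃ s : S, s ≠ 0 := by
    have := IsSimpleModule.nontrivial 𝓤 S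
    exact exists_ne 0
  by_cases hex : ∃ r : K[X], r ≠ 0 ∧ ρ r = 0
  · have hex' : ∃ n, ∃ r : K[X], r.natDegree = n ∧ r ≠ 0 ∧ ρ r = 0 := by
      obtain ⟨r, h⟩ := hex; exact ⟨_, r, rfl, h⟩
    obtain ⟨r, hrn, hr0, hr⟩ := Nat.find_spec hex'
    by_cases hd : r.degree = 0
    · exfalso
      rw [Polynomial.eq_C_of_degree_eq_zero hd] at hr hr0
      have h1 : aeval z (C (r.coeff 0)) • s = 0 := DFunLike.congr_fun hr s
      rw [aeval_C] at h1
      apply hs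
      have h2 : r.coeff 0 ≠ 0 := fun h => hr0 (by rw [h, C_0])
      have := congrArg (fun x => algebraMap K 𝓤 (r.coeff 0)⁻¹ • x) h1
      simp only [← mul_smul, ← map_mul, inv_mul_cancel₀ h2, map_one, one_smul, smul_zero] at this
      exact this
    · obtain ⟨c, hc⟩ := IsAlgClosed.exists_root r hd
      obtain ⟨q, hq⟩ := Polynomial.dvd_iff_isRoot.2 hc
      have hq0 : q ≠ 0 := by rintro rfl; simp at hq; exact hr0 hq
      refine ⟨c, ?_⟩
      rcases hρ q with h | h
      · intro x
        obtain ⟨y, hy⟩ := h.2 x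
        have h1 : aeval z r • y = 0 := DFunLike.congr_fun hr y
        rw [hq, map_mul, mul_smul] at h1
        have hy' : aeval z q • y = x := hy
        rw [hy'] at h1
        simpa using h1
      · exfalso
        refine Nat.find_min hex' (m := q.natDegree) ?_ ⟨q, rfl, hq0, h⟩
        · rw [← hrn, hq, Polynomial.natDegree_mul (Polynomial.X_sub_C_ne_zero c) hq0]
          simp
  · exfalso
    push Not at hex
    let _ : Module K[X] S := Module.compHom S (aeval z : K[X] →ₐ[K] 𝓤).toRingHom
    have hact : ∀ (r : K[X]) (x : S), r • x = aeval z r • x := fun _ _ => rfl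
    refine quillen_aux (K := K) (g := g) (S := S) ?_ ?_ ?_ ?_ s hs ?_
    · intro r u x
      rw [hact, hact, ← mul_smul, ← mul_smul, hcen]
    · intro c x
      rw [hact, aeval_C]
    · intro r x hr hx
      exact ((hρ r).resolve_right (hex r hr)).1 (by rw [map_zero]; exact hx)
    · intro r x hr
      exact ((hρ r).resolve_right (hex r hr)).2 x
    · intro x
      obtain ⟨u, hu⟩ := IsSimpleModule.toSpanSingleton_surjective 𝓤 hs x
      exact ⟨u, by rw [← hu]; rfl⟩
end PartC1

set_option linter.unusedSectionVars false
set_option autoImplicit false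
set_option linter.unusedVariables false
set_option linter.unusedSimpArgs false
open UniversalEnvelopingAlgebra
section PartD1
variable {K g : Type*} [Field K] [LieRing g] [LieAlgebra K g] [CharZero K]
  [LieAlgebra.IsSemisimple K g] [Module.Finite K g]

attribute [local instance] LieRing.ofAssociativeRing

lemma dual_sum {V M ι : Type*} [AddCommGroup V] [Module K V] [AddCommGroup M] [Module K M]
    [FiniteDimensional K V] [Fintype ι] [DecidableEq ι] (B : LinearMap.BilinForm K V)
    (hB : B.Nondegenerate) (b : Module.Basis ι K V) (A : V →ₗ[K] V)
    (hA : ∀ x y, B (A x) y = - B x (A y)) (F : V →ₗ[K] V →ₗ[K] M) :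
    ∑ i, (F (A (b i)) (B.dualBasis hB b i) + F (b i) (A (B.dualBasis hB b i))) = 0 := by
  set b' := B.dualBasis hB b with hb'
  have h1 : ∀ v, v = ∑ j, B (b' j) v • b j := by
    intro v
    conv_lhs => rw [← b.sum_repr v]
    refine Finset.sum_congr rfl fun j _ => ?_
    congr 1
    conv_rhs => rw [← b.sum_repr v]
    rw [map_sum, Finset.sum_eq_single j]
    · rw [map_smul, hb', LinearMap.BilinForm.apply_dualBasis_left]; simp
    · intro k _ hk
      rw [map_smul, hb', LinearMap.BilinForm.apply_dualBasis_left, if_neg hk, smul_zero]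
    · simp
  have h2 : ∀ v, v = ∑ j, B v (b j) • b' j := by
    intro v
    conv_lhs => rw [← b'.sum_repr v]
    refine Finset.sum_congr rfl fun j _ => ?_
    congr 1
    conv_rhs => rw [← b'.sum_repr v]
    rw [map_sum, LinearMap.sum_apply, Finset.sum_eq_single j]
    · rw [map_smul, LinearMap.smul_apply, hb', LinearMap.BilinForm.apply_dualBasis_left]; simp
    · intro k _ hk
      rw [map_smul, LinearMap.smul_apply, hb', LinearMap.BilinForm.apply_dualBasis_left,
        if_neg hk.symm, smul_zero]
    · simp
  rw [Finset.sum_add_distrib]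
  have e1 : ∑ i, F (A (b i)) (b' i) = ∑ i, ∑ j, B (b' j) (A (b i)) • F (b j) (b' i) := by
    refine Finset.sum_congr rfl fun i _ => ?_
    conv_lhs => rw [h1 (A (b i))]
    simp [map_sum, LinearMap.sum_apply]
  have e2 : ∑ i, F (b i) (A (b' i)) = ∑ i, ∑ j, B (A (b' i)) (b j) • F (b i) (b' j) := by
    refine Finset.sum_congr rfl fun i _ => ?_
    conv_lhs => rw [h2 (A (b' i))]
    simp [map_sum, LinearMap.sum_apply]
  rw [e1, e2, Finset.sum_comm, ← Finset.sum_add_distrib]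
  refine Finset.sum_eq_zero fun i _ => ?_
  rw [← Finset.sum_add_distrib]
  refine Finset.sum_eq_zero fun j _ => ?_
  rw [hA, neg_smul, add_neg_cancel]

lemma lie_perfect (J : LieIdeal K g) : ⁅J, J⁆ = J := by
  refine le_antisymm (LieSubmodule.lie_le_left _ _) ?_
  obtain ⟨C, hC⟩ := exists_isCompl (⁅J, J⁆ : LieIdeal K g)
  have hab : J ⊓ C = ⊥ := by
    have : IsLieAbelian (J ⊓ C : LieIdeal K g) := by
      refine ⟨fun x y => ?_⟩
      apply Subtype.ext
      have h1 : ⁅(x : g), (y : g)⁆ ∈ (⁅J, J⁆ : LieIdeal K g) ⊓ C :=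
        ⟨LieSubmodule.lie_mem_lie x.2.1 y.2.1, C.lie_mem y.2.2⟩
      rw [hC.inf_eq_bot] at h1
      simpa using h1
    exact LieAlgebra.HasTrivialRadical.eq_bot_of_isSolvable _
  intro x hx
  have hx' : x ∈ (⁅J, J⁆ : LieIdeal K g) ⊔ C := by rw [hC.sup_eq_top]; trivial
  obtain ⟨y, hy, z, hz, rfl⟩ := LieSubmodule.mem_sup _ _ _ |>.1 hx'
  have hzJ : z ∈ J := by
    have := J.sub_mem hx ((LieSubmodule.lie_le_left (J : LieIdeal K g) J) hy)
    simpa using this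
  have : z ∈ J ⊓ C := ⟨hzJ, hz⟩
  rw [hab] at this
  have hz0 : z = 0 := by simpa using this
  rw [hz0, add_zero]; exact hy


variable {W : Type*} [AddCommGroup W] [Module K W] [LieRingModule g W] [LieModule K g W]
  [FiniteDimensional K W]

lemma lie_eq_zero_of_trace [Nontrivial W]
    (hirr : ∀ N : LieSubmodule K g W, N = ⊥ ∨ N = ⊤) (J : LieIdeal K g)
    (hJ : ∀ x ∈ J, ∀ y ∈ J, LieModule.traceForm K g W x y = 0) (x : g) (hx : x ∈ J) (w : W) :
    ⁅x, w⁆ = 0 := by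
  have h0 : LieModule.traceForm K J W = 0 := by
    ext x y
    exact hJ x x.2 y y.2
  have hn := LieModule.isNilpotent_derivedSeries_of_traceForm_eq_zero h0
  have hnt := LieModule.nontrivial_max_triv_of_isNilpotent K (LieAlgebra.derivedSeries K J 1) W
  obtain ⟨⟨w0, hw0⟩, hne⟩ := exists_ne (0 : LieModule.maxTrivSubmodule K (LieAlgebra.derivedSeries K J 1) W)
  have hw0' : ∀ x ∈ J, ∀ y ∈ J, ⁅⁅x, y⁆, w0⁆ = 0 := by
    intro x hx y hy
    have hm : ⁅(⟨x, hx⟩ : J), (⟨y, hy⟩ : J)⁆ ∈ LieAlgebra.derivedSeries K J 1 := by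
      rw [LieAlgebra.derivedSeries_def, LieAlgebra.derivedSeriesOfIdeal_succ,
        LieAlgebra.derivedSeriesOfIdeal_zero]
      exact LieSubmodule.lie_mem_lie trivial trivial
    exact hw0 ⟨_, hm⟩
  let N : LieSubmodule K g W :=
    { carrier := {w | ∀ x ∈ J, ⁅x, w⁆ = 0}
      add_mem' := fun {a b} ha hb x hx => by rw [lie_add, ha x hx, hb x hx, add_zero]
      zero_mem' := fun x hx => lie_zero x
      smul_mem' := fun c a ha x hx => by rw [lie_smul, ha x hx, smul_zero]
      lie_mem := fun {y a} ha x hx => by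
        rw [leibniz_lie, ha _ (lie_mem_left K g J x y hx), ha x hx, lie_zero, add_zero] }
  have hN : w0 ∈ N := by
    intro x hx
    rw [← lie_perfect J] at hx
    change x ∈ (⁅J, J⁆ : LieIdeal K g).toSubmodule at hx
    rw [LieSubmodule.lieIdeal_oper_eq_linear_span'] at hx
    induction hx using Submodule.span_induction with
    | zero => simp
    | add x y _ _ hx hy => rw [add_lie, hx, hy, add_zero]
    | smul c x _ hx => rw [smul_lie, hx, smul_zero]
    | mem x hx =>
      obtain ⟨a, ha, b, hb, rfl⟩ := hx
      exact hw0' a ha b hb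
  rcases hirr N with h | h
  · exfalso
    apply hne
    rw [h] at hN
    exact Subtype.ext (by simpa using hN)
  · have : w ∈ N := by rw [h]; trivial
    exact this x hx

lemma casimir [Nontrivial W] (hirr : ∀ N : LieSubmodule K g W, N = ⊥ ∨ N = ⊤)
    (hnt : ∃ (x : g) (w : W), ⁅x, w⁆ ≠ 0) (f : g →ₗ[K] W)
    (hf : ∀ x y, f ⁅x, y⁆ = ⁅x, f y⁆ - ⁅y, f x⁆) : ∃ w, ∀ x, f x = ⁅x, w⁆ := by
  classical
  let β := LieModule.traceForm K g W
  let R : LieIdeal K g :=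
    { carrier := {x | ∀ y, β x y = 0}
      add_mem' := fun {a b} ha hb y => by rw [map_add, LinearMap.add_apply, ha, hb, add_zero]
      zero_mem' := fun y => by simp
      smul_mem' := fun c a ha y => by rw [map_smul, LinearMap.smul_apply, ha, smul_zero]
      lie_mem := fun {z a} ha y => by
        change LieModule.traceForm K g W ⁅z, a⁆ y = 0
        rw [LieModule.traceForm_apply_lie_apply']
        rw [show LieModule.traceForm K g W a ⁅z, y⁆ = 0 from ha _, neg_zero] }
  obtain ⟨R', hR'⟩ := exists_isCompl R
  have hR0 := lie_eq_zero_of_trace hirr R (fun x hx y _ => hx y)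
  let B : LinearMap.BilinForm K R' := LinearMap.BilinForm.restrict β R'.toSubmodule
  have hBa : ∀ x y : R', B x y = β x y := fun x y => rfl
  have hdec : ∀ x : g, ∃ r ∈ R, ∃ r' ∈ R', x = r + r' := by
    intro x
    have hx' : x ∈ R ⊔ R' := by rw [hR'.sup_eq_top]; trivial
    obtain ⟨y, hy, z, hz, rfl⟩ := LieSubmodule.mem_sup _ _ _ |>.1 hx'
    exact ⟨y, hy, z, hz, rfl⟩
  have hB1 : ∀ x : R', (∀ y, B x y = 0) → x = 0 := by
    intro x hx
    have : (x : g) ∈ R ⊓ R' := by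
      refine ⟨fun y => ?_, x.2⟩
      obtain ⟨r, hr, r', hr', rfl⟩ := hdec y
      have e1 : β x r = 0 := by
        rw [show β x r = β r x from LieModule.traceForm_comm _ _ _ _ _]; exact hr x
      have e2 : β x r' = 0 := hx ⟨r', hr'⟩
      rw [map_add, e1, e2, add_zero]
    rw [hR'.inf_eq_bot] at this
    exact Subtype.ext (by simpa using this)
  have hB : B.Nondegenerate := by
    refine ⟨hB1, fun y hy => hB1 y fun x => ?_⟩
    rw [hBa, show β y x = β x y from LieModule.traceForm_comm _ _ _ _ _]; exact hy x
  let b := Module.finBasis K R'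
  let b' := B.dualBasis hB b
  let φ : R' →ₗ[K] Module.End K W := (LieModule.toEnd K g W).toLinearMap ∘ₗ R'.toSubmodule.subtype
  have hφ : ∀ y w, φ y w = ⁅(y : g), w⁆ := fun _ _ => rfl
  have key : ∀ (x : g) (F : R' →ₗ[K] R' →ₗ[K] W),
      ∑ i, (F ⁅x, b i⁆ (b' i) + F (b i) ⁅x, b' i⁆) = 0 := by
    intro x F
    refine dual_sum B hB b (LieModule.toEnd K g R' x) ?_ F
    intro y z
    exact LieModule.traceForm_apply_lie_apply' K g W x y z
  let Ω : W →ₗ[K] W := ∑ i, φ (b i) * φ (b' i)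
  have hΩ : ∀ w, Ω w = ∑ i, ⁅(b i : g), ⁅(b' i : g), w⁆⁆ := by
    intro w
    simp only [Ω, LinearMap.sum_apply, Module.End.mul_apply, hφ]
  have hcomm : ∀ (x : g) (w : W), Ω ⁅x, w⁆ = ⁅x, Ω w⁆ := by
    intro x w
    let F : R' →ₗ[K] R' →ₗ[K] W := LinearMap.mk₂ K (fun y z => ⁅(y : g), ⁅(z : g), w⁆⁆)
      (by intros; simp) (by intros; simp) (by intros; simp) (by intros; simp)
    have := key x F
    simp only [F, LinearMap.mk₂_apply, LieSubmodule.coe_bracket] at this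
    rw [hΩ, hΩ, lie_sum, ← sub_eq_zero, ← neg_eq_zero, ← Finset.sum_sub_distrib,
      ← Finset.sum_neg_distrib]
    rw [← this]
    refine Finset.sum_congr rfl fun i _ => ?_
    rw [leibniz_lie x (b i : g), leibniz_lie x (b' i : g), lie_add]
    abel
  have htr : LinearMap.trace K W Ω ≠ 0 := by
    have e1 : LinearMap.trace K W Ω = ∑ i, B (b i) (b' i) := by
      simp only [Ω, map_sum]; rfl
    have e2 : ∀ i, B (b i) (b' i) = 1 := by
      intro i
      rw [hBa, show β (b i) (b' i) = β (b' i) (b i) from LieModule.traceForm_comm _ _ _ _ _, ← hBa]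
      simp only [b']
      rw [LinearMap.BilinForm.apply_dualBasis_left, if_pos rfl]
    rw [e1, Finset.sum_congr rfl fun i _ => e2 i]
    simp only [Finset.sum_const, Finset.card_univ, Fintype.card_fin, nsmul_eq_mul, mul_one]
    rw [Nat.cast_ne_zero]
    intro h0
    obtain ⟨x, w, hxw⟩ := hnt
    obtain ⟨r, hr, r', hr', rfl⟩ := hdec x
    apply hxw
    have hs := Module.finrank_zero_iff.1 h0
    have : r' = 0 := congrArg Subtype.val (Subsingleton.elim (⟨r', hr'⟩ : R') 0)
    rw [this, add_zero]; exact hR0 r hr w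
  have hinj : Function.Injective Ω := by
    let N : LieSubmodule K g W :=
      { LinearMap.ker Ω with
        lie_mem := fun {x w} hw => by
          change Ω ⁅x, w⁆ = 0
          rw [hcomm, show Ω w = 0 from hw, lie_zero] }
    rcases hirr N with h | h
    · rw [← LinearMap.ker_eq_bot]
      rw [eq_bot_iff]
      intro w hw
      have : w ∈ N := hw
      rw [h] at this
      simpa using this
    · exfalso
      apply htr
      have : Ω = 0 := by
        ext w
        have : w ∈ N := by rw [h]; trivial
        exact this
      rw [this, map_zero]
  have hsurj := LinearMap.injective_iff_surjective.1 hinj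
  let w0 : W := ∑ i, ⁅(b i : g), f (b' i)⁆
  have hw0 : ∀ x : g, ⁅x, w0⁆ = Ω (f x) := by
    intro x
    let F : R' →ₗ[K] R' →ₗ[K] W := LinearMap.mk₂ K (fun y z => ⁅(y : g), f z⁆)
      (by intros; simp) (by intros; simp) (by intros; simp) (by intros; simp)
    have := key x F
    simp only [F, LinearMap.mk₂_apply, LieSubmodule.coe_bracket] at this
    rw [hΩ, ← sub_eq_zero, ← this]
    simp only [w0]
    rw [lie_sum, ← Finset.sum_sub_distrib]
    refine Finset.sum_congr rfl fun i _ => ?_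
    rw [leibniz_lie x (b i : g), hf, lie_sub]
    abel
  obtain ⟨w1, hw1⟩ := hsurj w0
  refine ⟨w1, fun x => hinj ?_⟩
  rw [hcomm, hw1, hw0]

end PartD1

set_option linter.unusedSectionVars false
set_option autoImplicit false
set_option linter.unusedVariables false
set_option linter.unusedSimpArgs false
open UniversalEnvelopingAlgebra
section PartD2
universe w
variable {K g : Type*} [Field K] [LieRing g] [LieAlgebra K g] [CharZero K]
  [LieAlgebra.IsSemisimple K g] [Module.Finite K g]

attribute [local instance] LieRing.ofAssociativeRing

lemma whitehead (n : ℕ) : ∀ (W : Type w) [AddCommGroup W] [Module K W] [LieRingModule g W]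
    [LieModule K g W] [FiniteDimensional K W] (hn : Module.finrank K W ≤ n) (f : g →ₗ[K] W)
    (hf : ∀ x y, f ⁅x, y⁆ = ⁅x, f y⁆ - ⁅y, f x⁆), ∃ w, ∀ x, f x = ⁅x, w⁆ := by
  induction n with
  | zero =>
    intro W _ _ _ _ _ hn f hf
    have := Module.finrank_zero_iff.1 (Nat.le_zero.1 hn)
    exact ⟨0, fun x => Subsingleton.elim _ _⟩
  | succ n ih =>
    intro W _ _ _ _ _ hn f hf
    by_cases hs : Subsingleton W
    · exact ⟨0, fun x => Subsingleton.elim _ _⟩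
    rw [not_subsingleton_iff_nontrivial] at hs
    by_cases hirr : ∀ N : LieSubmodule K g W, N = ⊥ ∨ N = ⊤
    · by_cases hnt : ∃ (x : g) (w : W), ⁅x, w⁆ ≠ 0
      · exact casimir hirr hnt f hf
      · push Not at hnt
        refine ⟨0, fun x => ?_⟩
        rw [lie_zero]
        have hx : x ∈ (⁅(⊤ : LieIdeal K g), (⊤ : LieIdeal K g)⁆ : LieIdeal K g).toSubmodule := by
          rw [lie_perfect]; trivial
        rw [LieSubmodule.lieIdeal_oper_eq_linear_span'] at hx
        induction hx using Submodule.span_induction with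
        | zero => simp
        | add x y _ _ hx hy => rw [map_add, hx, hy, add_zero]
        | smul c x _ hx => rw [map_smul, hx, smul_zero]
        | mem x hx =>
          obtain ⟨a, ha, b, hb, rfl⟩ := hx
          rw [hf, hnt, hnt, sub_zero]
    · push Not at hirr
      obtain ⟨N, hN1, hN2⟩ := hirr
      have hN1' : N.toSubmodule ≠ ⊥ := by simpa using hN1
      have hN2' : N.toSubmodule ≠ ⊤ := by simpa using hN2
      have hlt : Module.finrank K N < Module.finrank K W := Submodule.finrank_lt hN2'
      have hlt2 : Module.finrank K (W ⧸ N.toSubmodule) < Module.finrank K W := by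
        have h1 := Submodule.finrank_quotient_add_finrank N.toSubmodule
        have h2 : 0 < Module.finrank K N.toSubmodule := by
          rw [Nat.pos_iff_ne_zero]
          intro h
          exact hN1' (Submodule.finrank_eq_zero.1 h)
        omega
      have : FiniteDimensional K (W ⧸ N) :=
        inferInstanceAs (FiniteDimensional K (W ⧸ N.toSubmodule))
      have hlt3 : Module.finrank K (W ⧸ N) < Module.finrank K W := hlt2
      obtain ⟨q, hq⟩ := ih (W ⧸ N) (by omega)
        ((LieSubmodule.Quotient.mk' N).toLinearMap ∘ₗ f) (fun x y => by
          simp only [LinearMap.comp_apply, hf, map_sub]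
          rw [LieModuleHom.coe_toLinearMap, LieModuleHom.map_lie, LieModuleHom.map_lie])
      obtain ⟨w, rfl⟩ := LieSubmodule.Quotient.surjective_mk' N q
      have hmem : ∀ x, f x - ⁅x, w⁆ ∈ N := by
        intro x
        rw [← LieSubmodule.Quotient.mk_eq_zero, map_sub, LieModuleHom.map_lie]
        rw [sub_eq_zero]; exact hq x
      let f' : g →ₗ[K] N :=
        { toFun := fun x => ⟨f x - ⁅x, w⁆, hmem x⟩
          map_add' := fun x y => Subtype.ext (by simp; abel)
          map_smul' := fun c x => Subtype.ext (by simp [smul_sub]) }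
      obtain ⟨m, hm⟩ := ih N (by omega) f' (fun x y => Subtype.ext (by
        simp only [f', LinearMap.coe_mk, AddHom.coe_mk, LieSubmodule.coe_bracket,
          AddSubgroupClass.coe_sub, hf, lie_sub, lie_lie]
        abel))
      refine ⟨w + m, fun x => ?_⟩
      have := congrArg Subtype.val (hm x)
      simp only [f', LinearMap.coe_mk, AddHom.coe_mk, LieSubmodule.coe_bracket] at this
      rw [lie_add, ← this]; abel

lemma weyl_compl {V : Type*} [AddCommGroup V] [Module K V] [LieRingModule g V] [LieModule K g V]
    [FiniteDimensional K V] (W : LieSubmodule K g V) :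
    ∃ C : LieSubmodule K g V, (∀ v ∈ W, v ∈ C → v = 0) ∧ ∀ v, ∃ a ∈ W, ∃ c ∈ C, v = a + c := by
  obtain ⟨p, hp⟩ := LinearMap.exists_leftInverse_of_injective W.toSubmodule.subtype (by simp)
  have hp' : ∀ w : W, p w = w := fun w => LinearMap.congr_fun hp w
  change V →ₗ[K] W at p
  let M : LieSubmodule K g (V →ₗ[K] W) :=
    { carrier := {φ | ∀ w : W, φ (w : V) = 0}
      add_mem' := fun {a b} ha hb w => by rw [LinearMap.add_apply, ha, hb, add_zero]
      zero_mem' := fun w => rfl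
      smul_mem' := fun c a ha w => by rw [LinearMap.smul_apply, ha, smul_zero]
      lie_mem := fun {x a} ha w => by
        rw [LieHom.lie_apply, ha, lie_zero, zero_sub, neg_eq_zero]
        exact ha ⟨⁅x, (w : V)⁆, W.lie_mem w.2⟩ }
  have hM : ∀ x : g, ⁅x, p⁆ ∈ M := by
    intro x w
    rw [LieHom.lie_apply, hp', sub_eq_zero]
    exact (hp' ⟨⁅x, (w : V)⁆, W.lie_mem w.2⟩).symm
  let f : g →ₗ[K] M :=
    { toFun := fun x => ⟨⁅x, p⁆, hM x⟩
      map_add' := fun x y => Subtype.ext (by simp)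
      map_smul' := fun c x => Subtype.ext (by simp) }
  obtain ⟨m, hm⟩ := whitehead _ M le_rfl f (fun x y => Subtype.ext (by
    simp only [f, LinearMap.coe_mk, AddHom.coe_mk, LieSubmodule.coe_bracket,
          AddSubgroupClass.coe_sub, lie_lie]))
  have hm' : ∀ x : g, ⁅x, p - (m : V →ₗ[K] W)⁆ = 0 := by
    intro x
    have := congrArg Subtype.val (hm x)
    simp only [f, LinearMap.coe_mk, AddHom.coe_mk, LieSubmodule.coe_bracket] at this
    rw [lie_sub, this, sub_self]
  set π : V →ₗ[K] W := p - (m : V →ₗ[K] W) with hπ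
  have h1 : ∀ w : W, π w = w := by
    intro w
    rw [hπ, LinearMap.sub_apply, hp', show (m : V →ₗ[K] W) w = 0 from m.2 w, sub_zero]
  have h2 : ∀ (x : g) v, π ⁅x, v⁆ = ⁅x, π v⁆ := by
    intro x v
    have := LinearMap.congr_fun (hm' x) v
    rw [LieHom.lie_apply] at this
    exact (sub_eq_zero.1 this).symm
  refine ⟨{ LinearMap.ker π with
            lie_mem := fun {x v} hv => by
              change π ⁅x, v⁆ = 0
              rw [h2, show π v = 0 from hv, lie_zero] }, ?_, ?_⟩
  · intro v hv hv'
    have e : π v = 0 := hv'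
    rw [h1 ⟨v, hv⟩] at e
    exact congrArg Subtype.val e
  · intro v
    refine ⟨π v, (π v).2, v - π v, ?_, by abel⟩
    change π (v - π v) = 0
    rw [map_sub, h1, sub_self]

lemma exists_fd_quot {V : Type*} [AddCommGroup V] [Module K V] [LieRingModule g V]
    [LieModule K g V] (hV : ∀ v : V, ∃ F : LieSubmodule K g V, v ∈ F ∧ FiniteDimensional K F)
    (I : LieSubmodule K g V) (y : V) (hy : y ∉ I) :
    ∃ N : LieSubmodule K g V, I ≤ N ∧ y ∉ N ∧ FiniteDimensional K (V ⧸ N.toSubmodule) := by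
  obtain ⟨N, hIN, hN⟩ := zorn_le_nonempty₀ {N : LieSubmodule K g V | I ≤ N ∧ y ∉ N}
    (by
      intro c hc hch z hz
      refine ⟨sSup c, ⟨(hc hz).1.trans (le_sSup hz), ?_⟩, fun z hz => le_sSup hz⟩
      intro hyc
      have : y ∈ sSup ((fun N : LieSubmodule K g V => N.toSubmodule) '' c) := by
        have h := (LieSubmodule.mem_toSubmodule (sSup c)).2 hyc
        rw [LieSubmodule.sSup_toSubmodule] at h
        exact h
      rw [Submodule.mem_sSup_of_directed (Set.Nonempty.image _ ⟨z, hz⟩)] at this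
      · obtain ⟨_, ⟨s, hs, rfl⟩, hys⟩ := this
        exact (hc hs).2 hys
      · rintro _ ⟨a, ha, rfl⟩ _ ⟨b, hb, rfl⟩
        rcases hch.total ha hb with h | h
        · exact ⟨_, ⟨b, hb, rfl⟩, h, le_rfl⟩
        · exact ⟨_, ⟨a, ha, rfl⟩, le_rfl, h⟩) I ⟨le_rfl, hy⟩
  have hmax : ∀ P : LieSubmodule K g V, N ≤ P → y ∉ P → P ≤ N :=
    fun P h1 h2 => hN.2 ⟨hIN.trans h1, h2⟩ h1
  have hyN : y ∉ N := hN.1.2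
  refine ⟨N, hIN, hyN, ?_⟩
  obtain ⟨F, hyF, hF⟩ := hV y
  have htop : F ⊔ N = ⊤ := by
    by_contra hne
    obtain ⟨v, hv⟩ : ∃ v, v ∉ F ⊔ N := by
      by_contra h
      push Not at h
      exact hne (by rw [eq_top_iff]; exact fun v _ => h v)
    obtain ⟨F2, hvF2, hF2⟩ := hV v
    let G := F ⊔ F2
    have : FiniteDimensional K G := by
      have : FiniteDimensional K (F.toSubmodule ⊔ F2.toSubmodule : Submodule K V) :=
        Submodule.finiteDimensional_sup _ _
      rw [← LieSubmodule.sup_toSubmodule] at this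
      exact this
    let W : LieSubmodule K g G := (F ⊔ N).comap G.incl
    obtain ⟨C, hC1, hC2⟩ := weyl_compl W
    let C' : LieSubmodule K g V := C.map G.incl
    have hC' : ∀ c ∈ C', c ∈ F ⊔ N → c = 0 := by
      intro c hc hcF
      obtain ⟨c, hc'', rfl⟩ := (LieSubmodule.mem_map _).1 hc
      rw [hC1 c hcF hc'']; rfl
    obtain ⟨a, ha, c, hc, hvac⟩ := hC2 ⟨v, (le_sup_right : F2 ≤ G) hvF2⟩
    have hvac' : v = (a : V) + (c : V) := congrArg Subtype.val hvac
    by_cases hyP : y ∈ N ⊔ C'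
    · obtain ⟨n, hn, c', hc', hnc⟩ := (LieSubmodule.mem_sup _ _ _).1 hyP
      have : c' = 0 := hC' c' hc' (by
        have : c' = y - n := by rw [← hnc]; abel
        rw [this]
        exact (F ⊔ N).sub_mem ((le_sup_left : F ≤ F ⊔ N) hyF) ((le_sup_right : N ≤ F ⊔ N) hn))
      rw [this, add_zero] at hnc
      exact hyN (hnc ▸ hn)
    · have h1 := hmax _ le_sup_left hyP
      have hcN : (c : V) ∈ N := h1 ((le_sup_right : C' ≤ N ⊔ C') ((LieSubmodule.mem_map _).2 ⟨c, hc, rfl⟩))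
      apply hv
      rw [hvac']
      exact (F ⊔ N).add_mem ha ((le_sup_right : N ≤ F ⊔ N) hcN)
  have hsurj : Function.Surjective (N.toSubmodule.mkQ ∘ₗ F.toSubmodule.subtype) := by
    intro q
    obtain ⟨v, rfl⟩ := Submodule.mkQ_surjective _ q
    have hv : v ∈ F ⊔ N := by rw [htop]; trivial
    obtain ⟨a, ha, n, hn, rfl⟩ := (LieSubmodule.mem_sup _ _ _).1 hv
    refine ⟨⟨a, ha⟩, ?_⟩
    rw [LinearMap.comp_apply, map_add]
    have : N.toSubmodule.mkQ n = 0 := by simpa using hn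
    rw [this, add_zero]; rfl
  exact Module.Finite.of_surjective _ hsurj

local notation "𝓤" => UniversalEnvelopingAlgebra K g

theorem exists_cofinite (I : Submodule K (UniversalEnvelopingAlgebra K g))
    (hI : ∀ (x : g), ∀ u ∈ I, ι K x * u - u * ι K x ∈ I) (y : UniversalEnvelopingAlgebra K g)
    (hy : y ∉ I) :
    ∃ N : Submodule K (UniversalEnvelopingAlgebra K g), I ≤ N ∧ y ∉ N ∧
      (∀ (x : g), ∀ u ∈ N, ι K x * u - u * ι K x ∈ N) ∧
      FiniteDimensional K (UniversalEnvelopingAlgebra K g ⧸ N) := by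
  let i1 : LieRingModule g 𝓤 := LieRingModule.compLieHom 𝓤 (ι K : g →ₗ⁅K⁆ 𝓤)
  let i2 : LieModule K g 𝓤 := LieModule.compLieHom 𝓤 (ι K : g →ₗ⁅K⁆ 𝓤)
  have hbr : ∀ (x : g) (u : 𝓤), ⁅x, u⁆ = ι K x * u - u * ι K x := fun x u => rfl
  obtain ⟨N, h1, h2, h3⟩ := exists_fd_quot (K := K) (g := g) (V := 𝓤) (fun u => by
    obtain ⟨k, hk⟩ := exists_mem_Fil u
    refine ⟨{ Fil K g k with
              lie_mem := fun {x v} hv => ?_ }, hk, ?_⟩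
    · rw [hbr]; exact comm_mem_Fil x hv
    · exact Module.Finite.iff_fg.2 (Fil_fg k))
    { I with lie_mem := fun {x v} hv => by rw [hbr]; exact hI x v hv } y hy
  exact ⟨N.toSubmodule, h1, h2, fun x u hu => by rw [← hbr]; exact N.lie_mem hu, h3⟩

end PartD2

set_option linter.unusedSectionVars false
set_option autoImplicit false
set_option linter.unusedVariables false
set_option linter.unusedSimpArgs false
open UniversalEnvelopingAlgebra
section PartE1
variable {K g : Type*} [Field K] [LieRing g] [LieAlgebra K g] [CharZero K]
  [LieAlgebra.IsSemisimple K g] {T : TriangularDecomposition K g}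

local notation "𝓤" => UniversalEnvelopingAlgebra K g
attribute [local instance] LieRing.ofAssociativeRing

lemma grad_mem {M : Type*} [AddCommGroup M] [Module K M] (f : M →ₗ[K] M) (Q : Submodule K M)
    (hQ : ∀ v ∈ Q, f v ∈ Q) (s : Finset ℤ) : ∀ v : ℤ → M, (∀ n ∈ s, f (v n) = (n : K) • v n) →
    ∑ n ∈ s, v n ∈ Q → ∀ n ∈ s, v n ∈ Q := by
  classical
  induction s using Finset.induction_on with
  | empty => intro v _ _ n hn; simp at hn
  | insert a s ha ih =>
    intro v hv hs
    have h1 : ∑ n ∈ s, ((n : K) - a) • v n ∈ Q := by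
      have := Q.sub_mem (hQ _ hs) (Q.smul_mem (a : K) hs)
      rw [map_sum, Finset.smul_sum, ← Finset.sum_sub_distrib, Finset.sum_insert ha,
        hv a (Finset.mem_insert_self _ _), sub_self, zero_add] at this
      convert this using 1
      refine Finset.sum_congr rfl fun n hn => ?_
      rw [hv n (Finset.mem_insert_of_mem hn), sub_smul]
    have h2 := ih (fun n => ((n : K) - a) • v n) (fun n hn => by
      rw [map_smul, hv n (Finset.mem_insert_of_mem hn), smul_comm]) h1
    have h3 : ∀ n ∈ s, v n ∈ Q := by
      intro n hn
      have hne : (n : K) - a ≠ 0 := by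
        rw [sub_ne_zero]
        intro h
        exact ha (by rw [← Int.cast_injective h]; exact hn)
      have := Q.smul_mem ((n : K) - a)⁻¹ (h2 n hn)
      rwa [smul_smul, inv_mul_cancel₀ hne, one_smul] at this
    intro n hn
    rcases Finset.mem_insert.1 hn with rfl | hn
    · rw [Finset.sum_insert ha] at hs
      have := Q.sub_mem hs (Q.sum_mem h3)
      simpa using this
    · exact h3 n hn

variable (D : T.HB)

/-- the grading element -/
noncomputable def TriangularDecomposition.HB.d : 𝓤 := ι K (D.δ : g)

/-- adjoint action of the grading element -/
noncomputable def TriangularDecomposition.HB.A : 𝓤 →ₗ[K] 𝓤 :=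
  LinearMap.mulLeft K D.d - LinearMap.mulRight K D.d

lemma TriangularDecomposition.HB.A_apply (u : 𝓤) : D.A u = D.d * u - u * D.d := rfl

/-- height of a word -/
def TriangularDecomposition.HB.ht (L : List (Fin D.N)) : ℤ := (L.map D.n).sum

/-- graded pieces -/
noncomputable def TriangularDecomposition.HB.Ug (n : ℤ) : Submodule K 𝓤 :=
  Submodule.span K (wd (K := K) D.b '' {L | D.ht L = n})

lemma TriangularDecomposition.HB.A_b (a : Fin D.N) : D.A (ι K (D.b a)) = (D.n a : K) • ι K (D.b a) := by
  rw [D.A_apply, TriangularDecomposition.HB.d, ← iota_lie, ← map_smul]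
  congr 1
  rw [← D.wn]
  exact D.mem a D.δ

lemma TriangularDecomposition.HB.A_mul (u v : 𝓤) : D.A (u * v) = D.A u * v + u * D.A v := by
  simp only [D.A_apply]; noncomm_ring

lemma TriangularDecomposition.HB.A_mem {n : ℤ} {u : 𝓤} (hu : u ∈ D.Ug n) : D.A u = (n : K) • u := by
  induction hu using Submodule.span_induction with
  | zero => simp
  | add x y _ _ hx hy => rw [map_add, hx, hy, smul_add]
  | smul c x _ hx => rw [map_smul, hx, smul_comm]
  | mem x hx =>
    obtain ⟨L, hL, rfl⟩ := hx
    replace hL : D.ht L = n := hL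
    rw [← hL]
    clear hL
    induction L with
    | nil => simp [wd, TriangularDecomposition.HB.ht, D.A_apply]
    | cons i L ih =>
      rw [wd_cons, D.A_mul, ih, D.A_b, smul_mul_assoc, mul_smul_comm, ← add_smul]
      simp [TriangularDecomposition.HB.ht]

lemma TriangularDecomposition.HB.wd_mem_Ug (L : List (Fin D.N)) : wd (K := K) D.b L ∈ D.Ug (D.ht L) :=
  Submodule.subset_span ⟨L, rfl, rfl⟩

lemma TriangularDecomposition.HB.one_mem_Ug : (1 : 𝓤) ∈ D.Ug 0 := by
  simpa [wd, TriangularDecomposition.HB.ht] using D.wd_mem_Ug []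

lemma TriangularDecomposition.HB.b_mem_Ug (a : Fin D.N) : ι K (D.b a) ∈ D.Ug (D.n a) := by
  simpa [wd, TriangularDecomposition.HB.ht] using D.wd_mem_Ug [a]

lemma TriangularDecomposition.HB.Ug_mul {m n : ℤ} {u v : 𝓤} (hu : u ∈ D.Ug m) (hv : v ∈ D.Ug n) :
    u * v ∈ D.Ug (m + n) := by
  have := Submodule.mul_mem_mul hu hv
  rw [TriangularDecomposition.HB.Ug, TriangularDecomposition.HB.Ug, Submodule.span_mul_span] at this
  refine Submodule.span_le.2 ?_ this
  rintro _ ⟨_, ⟨L, hL, rfl⟩, _, ⟨L', hL', rfl⟩, rfl⟩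
  refine Submodule.subset_span ⟨L ++ L', ?_, by simp [wd]⟩
  rw [Set.mem_ofPred_eq] at *
  rw [← hL, ← hL']; simp [TriangularDecomposition.HB.ht]

lemma TriangularDecomposition.HB.iSup_Ug : ⨆ n, D.Ug n = ⊤ := by
  rw [eq_top_iff]
  intro u _
  refine U_induct (Submodule.mem_iSup_of_mem 0 D.one_mem_Ug) ?_ u
  intro x u hu
  induction x using basis_ind D.b with
  | h0 => simp
  | ha x y hx hy => rw [map_add, add_mul]; exact add_mem hx hy
  | hs c x hx => rw [map_smul, smul_mul_assoc]; exact Submodule.smul_mem _ _ hx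
  | hc i =>
    have : (⨆ n, D.Ug n) ≤ (⨆ n, D.Ug n).comap (LinearMap.mulLeft K (ι K (D.b i))) :=
      iSup_le fun n v hv => Submodule.mem_iSup_of_mem _ (D.Ug_mul (D.b_mem_Ug i) hv)
    exact this hu

lemma TriangularDecomposition.HB.Ug_indep : iSupIndep D.Ug := by
  classical
  rw [iSupIndep_iff_finsetSum_eq_zero_imp_eq_zero]
  intro s v hv hs n hn
  have := grad_mem D.A ⊥ (by simp) s v (fun n hn => D.A_mem (hv n hn)) (by simpa using hs) n hn
  simpa using this

open Classical in
/-- graded projections -/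
noncomputable def TriangularDecomposition.HB.pr (n : ℤ) : 𝓤 →ₗ[K] 𝓤 :=
  letI := (DirectSum.isInternal_submodule_of_iSupIndep_of_iSup_eq_top D.Ug_indep
    D.iSup_Ug).chooseDecomposition
  (D.Ug n).subtype ∘ₗ DirectSum.component K ℤ (fun i => D.Ug i) n ∘ₗ
    (DirectSum.decomposeLinearEquiv D.Ug).toLinearMap

lemma TriangularDecomposition.HB.pr_mem (n : ℤ) (u : 𝓤) : D.pr n u ∈ D.Ug n := by
  simp [TriangularDecomposition.HB.pr]

lemma TriangularDecomposition.HB.pr_of_mem {n : ℤ} {u : 𝓤} (hu : u ∈ D.Ug n) : D.pr n u = u := by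
  classical
  let := (DirectSum.isInternal_submodule_of_iSupIndep_of_iSup_eq_top D.Ug_indep
    D.iSup_Ug).chooseDecomposition
  exact DirectSum.decompose_of_mem_same _ hu

lemma TriangularDecomposition.HB.pr_of_ne {n m : ℤ} (h : m ≠ n) {u : 𝓤} (hu : u ∈ D.Ug m) : D.pr n u = 0 := by
  classical
  let := (DirectSum.isInternal_submodule_of_iSupIndep_of_iSup_eq_top D.Ug_indep
    D.iSup_Ug).chooseDecomposition
  exact DirectSum.decompose_of_mem_ne _ hu h

lemma TriangularDecomposition.HB.pr_sum (u : 𝓤) : ∃ s : Finset ℤ, u = ∑ n ∈ s, D.pr n u := by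
  classical
  let := (DirectSum.isInternal_submodule_of_iSupIndep_of_iSup_eq_top D.Ug_indep
    D.iSup_Ug).chooseDecomposition
  exact ⟨_, (DirectSum.sum_support_decompose D.Ug u).symm⟩

lemma TriangularDecomposition.HB.pr_mem_of (Q : Submodule K 𝓤) (hQ : ∀ u ∈ Q, D.A u ∈ Q) {u : 𝓤} (hu : u ∈ Q)
    (n : ℤ) : D.pr n u ∈ Q := by
  classical
  obtain ⟨s, hs⟩ := D.pr_sum u
  by_cases hn : n ∈ s
  · refine grad_mem D.A Q hQ s (fun n => D.pr n u) (fun n _ => D.A_mem (D.pr_mem n u)) ?_ n hn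
    rw [← hs]; exact hu
  · rw [hs, map_sum, Finset.sum_eq_zero]
    · exact zero_mem _
    · intro m hm
      exact D.pr_of_ne (by rintro rfl; exact hn hm) (D.pr_mem m u)

lemma TriangularDecomposition.HB.tri (x : g) : ∃ a b c, a ∈ T.nneg ∧ b ∈ T.H ∧ c ∈ T.npos ∧ x = a + b + c ∧
    a ∈ Submodule.span K (D.b '' {i | D.n i < 0}) ∧ b ∈ Submodule.span K (D.b '' {i | D.n i = 0}) ∧
    c ∈ Submodule.span K (D.b '' {i | 0 < D.n i}) := by
  induction x using basis_ind D.b with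
  | h0 => exact ⟨0, 0, 0, zero_mem _, zero_mem _, zero_mem _, by simp, zero_mem _, zero_mem _, zero_mem _⟩
  | ha x y hx hy =>
    obtain ⟨a, b, c, h1, h2, h3, rfl, h4, h5, h6⟩ := hx
    obtain ⟨a', b', c', h1', h2', h3', rfl, h4', h5', h6'⟩ := hy
    exact ⟨a + a', b + b', c + c', add_mem h1 h1', add_mem h2 h2', add_mem h3 h3', by abel,
      add_mem h4 h4', add_mem h5 h5', add_mem h6 h6'⟩
  | hs r x hx =>
    obtain ⟨a, b, c, h1, h2, h3, rfl, h4, h5, h6⟩ := hx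
    exact ⟨r • a, r • b, r • c, T.nneg.smul_mem r h1, T.H.smul_mem r h2, T.npos.smul_mem r h3,
      by simp only [smul_add], Submodule.smul_mem _ r h4, Submodule.smul_mem _ r h5,
      Submodule.smul_mem _ r h6⟩
  | hc i =>
    rcases lt_trichotomy (D.n i) 0 with h | h | h
    · exact ⟨D.b i, 0, 0, D.neg i h, zero_mem _, zero_mem _, by simp, Submodule.subset_span ⟨i, h, rfl⟩,
        zero_mem _, zero_mem _⟩
    · exact ⟨0, D.b i, 0, zero_mem _, D.zer i h, zero_mem _, by simp, zero_mem _,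
        Submodule.subset_span ⟨i, h, rfl⟩, zero_mem _⟩
    · exact ⟨0, 0, D.b i, zero_mem _, zero_mem _, D.pos i h, by simp, zero_mem _, zero_mem _,
        Submodule.subset_span ⟨i, h, rfl⟩⟩

lemma TriangularDecomposition.HB.npos_span {x : g} (hx : x ∈ T.npos) :
    x ∈ Submodule.span K (D.b '' {i | 0 < D.n i}) := by
  obtain ⟨a, b, c, h1, h2, h3, rfl, h4, h5, h6⟩ := D.tri x
  obtain ⟨rfl, rfl, -⟩ := T.disj h1 h2 (sub_mem h3 hx) (by abel)
  simpa using h6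

lemma TriangularDecomposition.HB.nneg_span {x : g} (hx : x ∈ T.nneg) :
    x ∈ Submodule.span K (D.b '' {i | D.n i < 0}) := by
  obtain ⟨a, b, c, h1, h2, h3, rfl, h4, h5, h6⟩ := D.tri x
  obtain ⟨-, rfl, rfl⟩ := T.disj (sub_mem h1 hx) h2 h3 (by abel)
  simpa using h4

lemma TriangularDecomposition.HB.nn_span {x : g} (hx : x ∈ T.nneg.toSubmodule ⊔ T.npos.toSubmodule) :
    x ∈ Submodule.span K (D.b '' {i | D.n i ≠ 0}) := by
  refine (sup_le ?_ ?_ : _ ≤ Submodule.span K (D.b '' {i | D.n i ≠ 0})) hx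
  · intro x hx
    exact Submodule.span_mono (Set.image_mono fun i hi => ne_of_lt hi) (D.nneg_span hx)
  · intro x hx
    exact Submodule.span_mono (Set.image_mono fun i hi => ne_of_gt hi) (D.npos_span hx)

end PartE1

set_option linter.unusedSectionVars false
set_option autoImplicit false
set_option linter.unusedVariables false
set_option linter.unusedSimpArgs false
open UniversalEnvelopingAlgebra
section PartE2
variable {K g : Type*} [Field K] [LieRing g] [LieAlgebra K g] [CharZero K]
  [LieAlgebra.IsSemisimple K g] {T : TriangularDecomposition K g}

local notation "𝓤" => UniversalEnvelopingAlgebra K g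
attribute [local instance] LieRing.ofAssociativeRing

/-- adjoint action -/
noncomputable def adL (x : g) : 𝓤 →ₗ[K] 𝓤 :=
  LinearMap.mulLeft K (ι K x) - LinearMap.mulRight K (ι K x)

lemma adL_apply (x : g) (u : 𝓤) : adL x u = ι K x * u - u * ι K x := rfl

/-- left ideals of high degree -/
noncomputable def TriangularDecomposition.HB.LL (D : T.HB) (k : ℕ) : Ideal 𝓤 :=
  Ideal.span (⋃ n : {n : ℤ // (k : ℤ) ≤ n}, (D.Ug n : Set 𝓤))

/-- the data used to prove the separation theorem -/
structure KD (D : T.HB) (R L : Type*) [CommRing R] [Algebra K R] [AddCommGroup L] [Module K L]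
    [Module R L] where
  s : R
  P : Module.Dual K (UniversalEnvelopingAlgebra K g) →ₗ[K] UniversalEnvelopingAlgebra K g →ₗ[K] L
  hs : ¬ IsUnit s
  inj : ∀ v : L, s • v = 0 → v = 0
  hp : ∀ a (m : ℕ), D.n a = m → ∀ ξ u, P ξ (u * ι K (D.b a)) =
    s ^ m • P ξ (ι K (D.b a) * u) - P (ξ ∘ₗ adL (D.b a)) u
  hm : ∀ a (m : ℕ), D.n a = - m → ∀ ξ u, s ^ m • (P ξ (u * ι K (D.b a)) + P (ξ ∘ₗ adL (D.b a)) u) =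
    P ξ (ι K (D.b a) * u)
  h0 : ∀ ξ u, P ξ u = 0 → ξ u = 0
  hI : ∀ ξ u, (∀ v, ξ (v * u) = 0) → P ξ u = 0

variable {D : T.HB} {R L : Type*} [CommRing R] [Algebra K R] [AddCommGroup L] [Module K L]
    [Module R L] [IsScalarTower K R L] (E : KD D R L)
    (N : Submodule K (UniversalEnvelopingAlgebra K g))
    (hN : ∀ (x : g), ∀ u ∈ N, ι K x * u - u * ι K x ∈ N)

/-- the lattice -/
def KD.FF (k : ℕ) : Submodule R L :=
  Submodule.span R {v | ∃ ξ ∈ N.dualAnnihilator, ∃ u ∈ Fil K g k, v = E.P ξ u}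

lemma KD.mem_FF {k : ℕ} {ξ} (hξ : ξ ∈ N.dualAnnihilator) {u} (hu : u ∈ Fil K g k) :
    E.P ξ u ∈ E.FF N k := Submodule.subset_span ⟨ξ, hξ, u, hu, rfl⟩

lemma KD.FF_mono {k l : ℕ} (h : k ≤ l) : E.FF N k ≤ E.FF N l :=
  Submodule.span_mono fun _ ⟨ξ, hξ, u, hu, e⟩ => ⟨ξ, hξ, u, Fil_mono h hu, e⟩

lemma KD.FF_fg [Module.Finite K g] [FiniteDimensional K (UniversalEnvelopingAlgebra K g ⧸ N)] (k : ℕ) :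
    (E.FF N k).FG := by
  obtain ⟨S, hS⟩ := Fil_fg (K := K) (g := g) k
  have hX : FiniteDimensional K N.dualAnnihilator :=
    Module.Finite.equiv N.dualQuotEquivDualAnnihilator
  obtain ⟨S', hS'⟩ := Module.Finite.iff_fg.1 hX
  classical
  refine ⟨Finset.image₂ (fun ξ u => E.P ξ u) S' S, ?_⟩
  apply le_antisymm
  · rw [Submodule.span_le]
    intro v hv
    obtain ⟨ξ, hξ, u, hu, rfl⟩ := Finset.mem_image₂.1 hv
    exact E.mem_FF N (hS' ▸ Submodule.subset_span hξ) (hS ▸ Submodule.subset_span hu)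
  · refine Submodule.span_le.2 ?_
    rintro _ ⟨ξ, hξ, u, hu, rfl⟩
    have h := Submodule.apply_mem_map₂ E.P hξ hu
    rw [← hS, ← hS', Submodule.map₂_span_span] at h
    have := Submodule.span_le_restrictScalars K R _ h
    rw [← Finset.coe_image₂] at this
    exact this

lemma dual_comp_mem (hN : ∀ (x : g), ∀ u ∈ N, ι K x * u - u * ι K x ∈ N) {ξ}
    (hξ : ξ ∈ N.dualAnnihilator) (x : g) : ξ ∘ₗ adL x ∈ N.dualAnnihilator := by
  rw [Submodule.mem_dualAnnihilator] at *
  intro u hu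
  exact hξ _ (hN x u hu)

lemma KD.FF_stab [IsLocalRing R] (Z : T.CZ) (I : Ideal 𝓤) (hIN : ∀ u ∈ I, u ∈ N)
    (hN : ∀ (x : g), ∀ u ∈ N, ι K x * u - u * ι K x ∈ N)
    (hIr : ∀ u ∈ I, ∀ v, u * v ∈ I)
    (hz : ∀ d, ∃ c : K, Z.z d - algebraMap K 𝓤 c ∈ I) (k : ℕ) :
    E.FF N k ≤ E.FF N (Z.N * Z.N) := by
  let G : ℕ → Submodule K 𝓤 := fun k => match k with
    | 0 => ⊤
    | k + 1 => ⨅ ξ : N.dualAnnihilator, ((E.FF N k).restrictScalars K).comap (E.P ξ)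
  have hG : ∀ k u, u ∈ G (k + 1) ↔ ∀ ξ ∈ N.dualAnnihilator, E.P ξ u ∈ E.FF N k := by
    intro k u
    simp [G, Submodule.mem_iInf]
  have hI0 : ∀ ξ ∈ N.dualAnnihilator, ∀ u ∈ I, E.P ξ u = 0 := by
    intro ξ hξ u hu
    refine E.hI ξ u fun v => ?_
    exact (Submodule.mem_dualAnnihilator _).1 hξ _ (hIN _ (I.mul_mem_left v hu))
  have hsm : E.s ∈ IsLocalRing.maximalIdeal R := (IsLocalRing.mem_maximalIdeal _).2 E.hs
  have hunit : ∀ m : ℕ, m ≠ 0 → IsUnit (1 - E.s ^ m) := by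
    intro m hm
    by_contra h
    have h1 := (IsLocalRing.mem_maximalIdeal _).2 h
    have h2 := Ideal.add_mem _ h1 (Ideal.pow_mem_of_mem _ hsm m (Nat.pos_of_ne_zero hm))
    rw [sub_add_cancel] at h2
    exact (Ideal.ne_top_iff_one _).1 (IsLocalRing.maximalIdeal.isMaximal R).ne_top h2
  have hred := Z.red G (fun k u hu => (hG k u).2 fun ξ hξ => E.mem_FF N hξ hu) ?_ ?_
  · induction k with
    | zero => exact E.FF_mono N (Nat.zero_le _)
    | succ k ih =>
      by_cases hk : Z.N * Z.N < k + 1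
      · refine le_trans ?_ ih
        refine Submodule.span_le.2 ?_
        rintro _ ⟨ξ, hξ, u, hu, rfl⟩
        exact (hG k u).1 (hred _ hk hu) ξ hξ
      · exact E.FF_mono N (not_lt.1 hk)
  · intro k x hx u hu
    refine (Submodule.span_le.2 ?_ : Submodule.span K (D.b '' {i | D.n i ≠ 0}) ≤ (G (k + 1)).comap
      (LinearMap.mulRight K u ∘ₗ iotaL K g)) (D.nn_span hx)
    rintro _ ⟨a, ha, rfl⟩
    change ι K (D.b a) * u ∈ G (k + 1)
    rw [hG]
    intro ξ hξ
    have h1 := E.mem_FF N hξ (comm_mem_Fil (D.b a) hu)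
    have h2 := E.mem_FF N (dual_comp_mem N hN hξ (D.b a)) hu
    rw [map_sub] at h1
    obtain ⟨m, hm | hm⟩ := Int.eq_nat_or_neg (D.n a)
    · have h3 := E.hp a m hm ξ u
      have hm0 : m ≠ 0 := by rintro rfl; exact ha (by simpa using hm)
      rw [← Submodule.smul_mem_iff_of_isUnit _ (hunit m hm0), sub_smul, one_smul]
      have := Submodule.sub_mem _ h1 h2
      convert this using 1
      rw [h3]; abel
    · have h3 := E.hm a m hm ξ u
      have hm0 : m ≠ 0 := by rintro rfl; exact ha (by simpa using hm)
      rw [← Submodule.smul_mem_iff_of_isUnit _ (hunit m hm0), sub_smul, one_smul]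
      have := Submodule.smul_mem _ (E.s ^ m) (Submodule.add_mem _ (Submodule.neg_mem _ h1) h2)
      convert this using 1
      nth_rewrite 1 [← h3]
      simp only [smul_add, smul_neg, smul_sub]; abel
  · intro k d u hu
    rw [show k + (d + 1) = (k + d) + 1 by ring, hG]
    intro ξ hξ
    obtain ⟨c, hc⟩ := hz (d + 1)
    have h1 := hI0 ξ hξ _ (hIr _ hc u)
    rw [sub_mul, map_sub, sub_eq_zero] at h1
    rw [h1, ← Algebra.smul_def, map_smul]
    exact (Submodule.smul_mem ((E.FF N (k + d)).restrictScalars K) c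
      (E.FF_mono N (Nat.le_add_right k d) (E.mem_FF N hξ hu)))

/-- functional of a given weight -/
def TriangularDecomposition.HB.IsWt (D : T.HB) (ξ : Module.Dual K 𝓤) (a : ℤ) : Prop :=
  ∀ m, m ≠ a → ∀ u ∈ D.Ug m, ξ u = 0

lemma TriangularDecomposition.HB.exists_bound [FiniteDimensional K (UniversalEnvelopingAlgebra K g ⧸ N)] :
    ∃ r : ℕ, ∀ ξ ∈ N.dualAnnihilator, ∀ a, D.IsWt ξ a → a < -(r : ℤ) → ξ = 0 := by
  have hbd : ∀ u : 𝓤, ∃ r : ℕ, ∀ ξ a, D.IsWt ξ a → a < -(r : ℤ) → ξ u = 0 := by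
    intro u
    obtain ⟨s, hs⟩ := D.pr_sum u
    refine ⟨∑ n ∈ s, n.natAbs, fun ξ a hξ ha => ?_⟩
    rw [hs, map_sum]
    refine Finset.sum_eq_zero fun n hn => hξ n ?_ _ (D.pr_mem n u)
    rintro rfl
    have := Finset.single_le_sum (f := fun n : ℤ => n.natAbs) (fun _ _ => Nat.zero_le _) hn
    omega
  choose r hr using hbd
  obtain ⟨S, hS⟩ := Module.Finite.fg_top (R := K) (M := 𝓤 ⧸ N)
  choose out hout using N.mkQ_surjective
  refine ⟨∑ q ∈ S, r (out q), fun ξ hξ a ha hlt => ?_⟩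
  ext u
  have hu : N.mkQ u ∈ Submodule.span K (S : Set (𝓤 ⧸ N)) := by rw [hS]; trivial
  have hker : N ≤ LinearMap.ker ξ := fun u hu =>
    LinearMap.mem_ker.2 ((Submodule.mem_dualAnnihilator _).1 hξ u hu)
  have hle : Submodule.span K (S : Set (𝓤 ⧸ N)) ≤
      LinearMap.ker (N.liftQ ξ hker) := by
    rw [Submodule.span_le]
    intro q hq
    have h1 := Finset.single_le_sum (f := fun q => r (out q)) (fun _ _ => Nat.zero_le _) hq
    have h2 := hr (out q) ξ a ha (by omega)
    rw [SetLike.mem_coe, LinearMap.mem_ker]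
    have : q = N.mkQ (out q) := (hout q).symm
    rw [this, Submodule.mkQ_apply, Submodule.liftQ_apply, h2]
  have := hle hu
  rw [LinearMap.mem_ker, Submodule.mkQ_apply, Submodule.liftQ_apply] at this
  simpa using this

lemma KD.high (F : Submodule R L) (hF : ∀ ξ ∈ N.dualAnnihilator, ∀ u, E.P ξ u ∈ F)
    (hN : ∀ (x : g), ∀ u ∈ N, ι K x * u - u * ι K x ∈ N)
    (r : ℕ) (hr : ∀ ξ ∈ N.dualAnnihilator, ∀ a, D.IsWt ξ a → a < -(r : ℤ) → ξ = 0)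
    (W : List (Fin D.N)) : ∀ (b : 𝓤), ∀ ξ ∈ N.dualAnnihilator, ∀ a, D.IsWt ξ a → ∀ e : ℕ,
      (e : ℤ) ≤ D.ht W.reverse - a - r → ∃ v ∈ F, E.P ξ (b * wd D.b W.reverse) = E.s ^ e • v := by
  induction W with
  | nil =>
    intro b ξ hξ a ha e he
    by_cases h : a < -(r : ℤ)
    · rw [hr ξ hξ a ha h]
      exact ⟨0, zero_mem _, by simp⟩
    · have : e = 0 := by simp [TriangularDecomposition.HB.ht] at he; omega
      subst this
      exact ⟨_, hF ξ hξ _, by rw [pow_zero, one_smul]⟩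
  | cons i W ih =>
    intro b ξ hξ a ha e he
    have hw : wd (K := K) D.b (i :: W).reverse = wd D.b W.reverse * ι K (D.b i) := by simp [wd]
    have hht : D.ht (i :: W).reverse = D.ht W.reverse + D.n i := by
      simp [TriangularDecomposition.HB.ht]
    rw [hht] at he
    have hξ' := dual_comp_mem N hN hξ (D.b i)
    have hwt : D.IsWt (ξ ∘ₗ adL (D.b i)) (a - D.n i) := by
      intro m hm u hu
      rw [LinearMap.comp_apply, adL_apply, map_sub]
      rw [ha (D.n i + m) (by omega) _ (D.Ug_mul (D.b_mem_Ug i) hu),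
        ha (m + D.n i) (by omega) _ (D.Ug_mul hu (D.b_mem_Ug i)), sub_zero]
    obtain ⟨v2, hv2, e2⟩ := ih b _ hξ' _ hwt e (by omega)
    rw [hw, ← mul_assoc]
    obtain ⟨m, hm | hm⟩ := Int.eq_nat_or_neg (D.n i)
    · have h3 := E.hp i m hm ξ (b * wd D.b W.reverse)
      rw [← mul_assoc, e2] at h3
      rw [h3]
      by_cases h : m ≤ e
      · obtain ⟨v1, hv1, e1⟩ := ih (ι K (D.b i) * b) ξ hξ a ha (e - m) (by push_cast [h]; omega)
        refine ⟨v1 - v2, F.sub_mem hv1 hv2, ?_⟩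
        rw [e1, smul_smul, ← pow_add, Nat.add_sub_cancel' h, smul_sub]
      · refine ⟨E.s ^ (m - e) • E.P ξ (ι K (D.b i) * b * wd D.b W.reverse) - v2,
          F.sub_mem (F.smul_mem _ (hF ξ hξ _)) hv2, ?_⟩
        rw [smul_sub, smul_smul, ← pow_add, Nat.add_sub_cancel' (by omega)]
    · obtain ⟨v1, hv1, e1⟩ := ih (ι K (D.b i) * b) ξ hξ a ha (e + m) (by push_cast; omega)
      refine ⟨v1 - v2, F.sub_mem hv1 hv2, ?_⟩
      have h3 := E.hm i m hm ξ (b * wd D.b W.reverse)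
      rw [← mul_assoc, e1, e2] at h3
      have hinj : ∀ (m : ℕ) (v : L), E.s ^ m • v = 0 → v = 0 := by
        intro m
        induction m with
        | zero => intro v hv; simpa using hv
        | succ m ihm =>
          intro v hv
          rw [pow_succ, mul_smul] at hv
          exact E.inj v (ihm _ hv)
      rw [← sub_eq_zero]
      apply hinj m
      rw [smul_add, ← sub_eq_zero] at h3
      rw [← h3, smul_sub, smul_sub, smul_sub, pow_add, mul_comm, mul_smul]
      abel

theorem KD.key (E : KD D R L) [Module.Finite K g] [IsLocalRing R] [IsNoetherianRing R] (Z : T.CZ) (I : Ideal 𝓤)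
    (hIr : ∀ u ∈ I, ∀ v, u * v ∈ I)
    (hz : ∀ d, ∃ c : K, Z.z d - algebraMap K 𝓤 c ∈ I) (y : 𝓤) (hy : ∀ k, y ∈ I ⊔ D.LL k) : y ∈ I := by
  by_contra hyI
  obtain ⟨N, hIN, hyN, hN, hfd⟩ := exists_cofinite (I.restrictScalars K)
    (fun x u hu => I.sub_mem (I.mul_mem_left _ hu) (hIr _ hu _)) y hyI
  -- choose the functional
  obtain ⟨s, hs⟩ := D.pr_sum y
  obtain ⟨n, hns, hn⟩ : ∃ n ∈ s, D.pr n y ∉ N := by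
    by_contra! h
    exact hyN (hs ▸ N.sum_mem h)
  have hA : ∀ u ∈ N, D.A u ∈ N := fun u hu => hN _ u hu
  obtain ⟨ξ0, hξ0, hξy⟩ : ∃ ξ0 : Module.Dual K 𝓤, ξ0 (D.pr n y) ≠ 0 ∧ N ≤ LinearMap.ker ξ0 := by
    obtain ⟨f, hf1, hf2⟩ := Submodule.exists_le_ker_of_notMem hn
    exact ⟨f, hf1, hf2⟩
  let ξ : Module.Dual K 𝓤 := ξ0 ∘ₗ D.pr n
  have hξ : ξ ∈ N.dualAnnihilator := by
    rw [Submodule.mem_dualAnnihilator]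
    intro u hu
    exact hξy (D.pr_mem_of N hA hu n)
  have hwt : D.IsWt ξ n := by
    intro m hm u hu
    change ξ0 (D.pr n u) = 0
    rw [D.pr_of_ne hm hu, map_zero]
  obtain ⟨r, hr⟩ := TriangularDecomposition.HB.exists_bound (D := D) N
  let F := E.FF N (Z.N * Z.N)
  have hF : ∀ ξ ∈ N.dualAnnihilator, ∀ u, E.P ξ u ∈ F := by
    intro ξ hξ u
    obtain ⟨k, hk⟩ := exists_mem_Fil u
    exact E.FF_stab N Z I hIN hN hIr hz k (E.mem_FF N hξ hk)
  have hfin : Module.Finite R F := Module.Finite.iff_fg.2 (E.FF_fg N _)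
  have hbot : (⨅ i : ℕ, IsLocalRing.maximalIdeal R ^ i • ⊤ : Submodule R F) = ⊥ :=
    Ideal.iInf_pow_smul_eq_bot_of_isLocalRing _ (IsLocalRing.maximalIdeal.isMaximal R).ne_top
  have hsm : E.s ∈ IsLocalRing.maximalIdeal R := (IsLocalRing.mem_maximalIdeal _).2 E.hs
  have hmem : ∀ e : ℕ, ∃ v ∈ F, E.P ξ y = E.s ^ e • v := by
    intro e
    let G : Submodule R L := F.map (LinearMap.lsmul R L (E.s ^ e))
    suffices h : E.P ξ y ∈ G by
      obtain ⟨v, hv, h⟩ := h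
      exact ⟨v, hv, h.symm⟩
    obtain ⟨i, hi, l, hl, rfl⟩ := Submodule.mem_sup.1 (hy (e + n + r).toNat)
    rw [map_add]
    refine G.add_mem ?_ ?_
    · rw [E.hI ξ i fun v => (Submodule.mem_dualAnnihilator _).1 hξ _ (hIN (I.mul_mem_left v hi))]
      exact zero_mem _
    · have hll : ∀ l ∈ D.LL (e + n + r).toNat, ∀ c, E.P ξ (c * l) ∈ G := by
        intro l hl
        induction hl using Submodule.span_induction with
        | zero => intro c; simp
        | add x y _ _ hx hy => intro c; rw [mul_add, map_add]; exact G.add_mem (hx c) (hy c)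
        | smul a x _ hx => intro c; rw [smul_eq_mul, ← mul_assoc]; exact hx _
        | mem x hx =>
          intro c
          obtain ⟨⟨m, hm⟩, hx'⟩ := Set.mem_iUnion.1 hx
          clear hx
          change x ∈ Submodule.span K _ at hx'
          induction hx' using Submodule.span_induction with
          | zero => simp
          | add x y _ _ hx hy => rw [mul_add, map_add]; exact G.add_mem hx hy
          | smul a x _ hx =>
            rw [mul_smul_comm, map_smul]
            exact Submodule.smul_mem (G.restrictScalars K) a hx
          | mem x hx =>
            obtain ⟨W, hW, rfl⟩ := hx
            replace hW : D.ht W = m := hW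
            obtain ⟨v, hv, h⟩ := E.high N F hF hN r hr W.reverse c ξ hξ n hwt e (by
              rw [List.reverse_reverse, hW]
              omega)
            rw [List.reverse_reverse] at h
            exact ⟨v, hv, h.symm⟩
      simpa using hll l hl 1
  have h0 : (⟨E.P ξ y, hF ξ hξ y⟩ : F) ∈ (⨅ i : ℕ, IsLocalRing.maximalIdeal R ^ i • ⊤ : Submodule R F) := by
    rw [Submodule.mem_iInf]
    intro e
    obtain ⟨v, hv, h⟩ := hmem e
    rw [show (⟨E.P ξ y, hF ξ hξ y⟩ : F) = E.s ^ e • (⟨v, hv⟩ : F) from Subtype.ext h]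
    exact Submodule.smul_mem_smul (Ideal.pow_mem_pow hsm e) trivial
  rw [hbot] at h0
  have h1 : E.P ξ y = 0 := congrArg Subtype.val ((Submodule.mem_bot R).1 h0)
  exact hξ0 (E.h0 ξ y h1)

end PartE2

set_option linter.unusedSectionVars false
set_option autoImplicit false
set_option linter.unusedVariables false
set_option linter.unusedSimpArgs false
open UniversalEnvelopingAlgebra
section PartE3
variable {K g : Type*} [Field K] [LieRing g] [LieAlgebra K g] [CharZero K]
  [LieAlgebra.IsSemisimple K g] {T : TriangularDecomposition K g}

local notation "𝓤" => UniversalEnvelopingAlgebra K g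
attribute [local instance] LieRing.ofAssociativeRing
open PowerSeries in
/-- exponential series -/
noncomputable def ES (a : K) : PowerSeries K := rescale a (exp K)

lemma ES_coeff (a : K) (n : ℕ) : PowerSeries.coeff n (ES a) = a ^ n * (n.factorial : K)⁻¹ := by
  simp [ES, PowerSeries.coeff_rescale, PowerSeries.coeff_exp]

lemma ES_mul (a b : K) : ES a * ES b = ES (a + b) := PowerSeries.exp_mul_exp_eq_exp_add a b

lemma ES_zero : ES (0 : K) = 1 := by
  ext n
  rw [ES_coeff, PowerSeries.coeff_one]
  rcases n with _ | n <;> simp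

lemma ES_pow (a : K) (m : ℕ) : ES a ^ m = ES (m * a) := by
  induction m with
  | zero => simp [ES_zero]
  | succ m ih => rw [pow_succ, ih, ES_mul]; congr 1; push_cast; ring

lemma ES_ne_one {a : K} (ha : a ≠ 0) : ES a ≠ 1 := by
  intro h
  have := congrArg (PowerSeries.coeff 1) h
  rw [ES_coeff, PowerSeries.coeff_one] at this
  simp at this
  exact ha this

lemma ES_transc {a : K} (ha : a ≠ 0) (n : ℕ) : ∀ p : Polynomial K, p.natDegree ≤ n →
    Polynomial.aeval (ES a) p = 0 → p = 0 := by
  have key : ∀ p : Polynomial K, Polynomial.aeval (ES a) p = 0 → p.IsRoot 1 := by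
    intro p hp
    have h1 := congrArg (PowerSeries.constantCoeff (R := K)) hp
    rw [Polynomial.aeval_def, Polynomial.hom_eval₂, map_zero] at h1
    have h2 : PowerSeries.constantCoeff (R := K) (ES a) = 1 := by
      rw [← PowerSeries.coeff_zero_eq_constantCoeff_apply, ES_coeff]; simp
    rw [h2] at h1
    have h3 : (PowerSeries.constantCoeff (R := K)).comp (algebraMap K (PowerSeries K)) = RingHom.id K := by
      ext; simp
    rw [h3] at h1
    exact h1
  induction n with
  | zero =>
    intro p hd hp
    have h := key p hp
    rw [Polynomial.eq_C_of_natDegree_le_zero hd] at h ⊢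
    simp only [Polynomial.IsRoot, Polynomial.eval_C] at h
    rw [h, map_zero]
  | succ n ih =>
    intro p hd hp
    by_contra hne
    obtain ⟨q, rfl⟩ := Polynomial.dvd_iff_isRoot.2 (key p hp)
    have hq : q ≠ 0 := right_ne_zero_of_mul hne
    rw [Polynomial.natDegree_mul (Polynomial.X_sub_C_ne_zero 1) hq, Polynomial.natDegree_X_sub_C] at hd
    rw [map_mul] at hp
    rcases mul_eq_zero.1 hp with h | h
    · apply ES_ne_one ha
      rw [map_sub, Polynomial.aeval_X, Polynomial.aeval_C, map_one, sub_eq_zero] at h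
      exact h
    · exact hq (ih q (by omega) h)

variable (D : T.HB)

/-- formal exponential functional -/
noncomputable def TriangularDecomposition.HB.Psi :
    Module.Dual K 𝓤 →ₗ[K] 𝓤 →ₗ[K] PowerSeries K :=
  LinearMap.mk₂ K (fun ξ u => PowerSeries.mk fun n => (n.factorial : K)⁻¹ * ξ (D.d ^ n * u))
    (fun _ _ _ => by ext; simp [mul_add]) (fun _ _ _ => by ext; simp; ring)
    (fun _ _ _ => by ext; simp [mul_add]) (fun _ _ _ => by ext; simp; ring)

lemma TriangularDecomposition.HB.Psi_coeff (ξ : Module.Dual K 𝓤) (u : 𝓤) (n : ℕ) :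
    PowerSeries.coeff n (D.Psi ξ u) = (n.factorial : K)⁻¹ * ξ (D.d ^ n * u) := by
  simp [TriangularDecomposition.HB.Psi]

lemma TriangularDecomposition.HB.b_d_pow (a : Fin D.N) (n : ℕ) :
    ι K (D.b a) * D.d ^ n = (D.d + algebraMap K 𝓤 (-(D.n a : K))) ^ n * ι K (D.b a) := by
  induction n with
  | zero => simp
  | succ n ih =>
    have h := D.A_b a
    rw [D.A_apply, Algebra.smul_def, sub_eq_iff_eq_add] at h
    have h2 : ι K (D.b a) * D.d = (D.d + algebraMap K 𝓤 (-(D.n a : K))) * ι K (D.b a) := by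
      rw [add_mul, h, map_neg]; noncomm_ring
    rw [pow_succ, ← mul_assoc, ih, mul_assoc, h2, ← mul_assoc, ← pow_succ]

lemma TriangularDecomposition.HB.Psi_b (a : Fin D.N) (ξ : Module.Dual K 𝓤) (u : 𝓤) :
    D.Psi ξ (u * ι K (D.b a)) + D.Psi (ξ ∘ₗ adL (D.b a)) u =
      ES (-(D.n a : K)) * D.Psi ξ (ι K (D.b a) * u) := by
  ext n
  rw [map_add, D.Psi_coeff, D.Psi_coeff, PowerSeries.coeff_mul, LinearMap.comp_apply, adL_apply,
    map_sub, ← mul_assoc, ← mul_assoc, D.b_d_pow, mul_assoc ((_ + _) ^ n)]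
  have hc : Commute D.d (algebraMap K 𝓤 (-(D.n a : K))) := (Algebra.commutes _ _).symm
  rw [add_comm D.d, hc.symm.add_pow', Finset.sum_mul, map_sum]
  rw [mul_sub, add_comm, sub_add_cancel, Finset.mul_sum]
  refine Finset.sum_congr rfl fun p hp => ?_
  rw [ES_coeff, D.Psi_coeff]
  obtain ⟨i, j⟩ := p
  rw [Finset.HasAntidiagonal.mem_antidiagonal] at hp
  simp only at hp ⊢
  subst hp
  rw [← map_pow, ← Algebra.smul_def, smul_mul_assoc, smul_mul_assoc, map_nsmul, map_smul,
    nsmul_eq_mul, smul_eq_mul]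
  have h0 := Nat.choose_mul_factorial_mul_factorial (Nat.le_add_right i j)
  rw [Nat.add_sub_cancel_left] at h0
  have h0' : ((i + j).choose i : K) * i.factorial * j.factorial = (i + j).factorial := by
    exact_mod_cast h0
  have h2 : (i.factorial : K) ≠ 0 := by exact_mod_cast i.factorial_ne_zero
  have h3 : (j.factorial : K) ≠ 0 := by exact_mod_cast j.factorial_ne_zero
  have h1 : ((i + j).choose i : K) ≠ 0 := by
    intro h; rw [h, zero_mul, zero_mul] at h0'
    exact (i + j).factorial_ne_zero (by exact_mod_cast h0'.symm)
  rw [← h0']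
  field_simp

open Polynomial in
theorem TriangularDecomposition.HB.separation [Module.Finite K g] (Z : T.CZ) (I : Ideal 𝓤)
    (hIr : ∀ u ∈ I, ∀ v, u * v ∈ I)
    (hz : ∀ d, ∃ c : K, Z.z d - algebraMap K 𝓤 c ∈ I) (y : 𝓤) (hy : ∀ k, y ∈ I ⊔ D.LL k) : y ∈ I := by
  let L := FractionRing (PowerSeries K)
  let P : Ideal K[X] := Ideal.span {X}
  have hP : P.IsPrime := (Ideal.span_singleton_prime X_ne_zero).2 prime_X
  let R := Localization.AtPrime P
  let j : PowerSeries K →ₐ[K] L := IsScalarTower.toAlgHom K (PowerSeries K) L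
  have hj : Function.Injective j := IsFractionRing.injective (PowerSeries K) L
  let φ0 : K[X] →ₐ[K] L := j.comp (aeval (ES (-1 : K)))
  have hφ0 : ∀ y : P.primeCompl, IsUnit (φ0.toRingHom y) := by
    rintro ⟨p, hp⟩
    rw [isUnit_iff_ne_zero]
    intro h
    have h1 : aeval (ES (-1 : K)) p = 0 := hj (by rw [map_zero]; exact h)
    have h2 := ES_transc (by simp) _ p le_rfl h1
    exact hp (h2 ▸ P.zero_mem)
  let φ : R →+* L := IsLocalization.lift hφ0
  have hφ : ∀ p, φ (algebraMap K[X] R p) = φ0 p := fun p => IsLocalization.lift_eq hφ0 p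
  letI : Algebra R L := φ.toAlgebra
  have hsm : ∀ (r : R) (v : L), r • v = φ r * v := fun r v => rfl
  have : IsScalarTower K R L := IsScalarTower.of_algebraMap_eq fun c => by
    change _ = φ (algebraMap K R c)
    rw [IsScalarTower.algebraMap_apply K K[X] R, hφ]
    change _ = φ0 (algebraMap K K[X] c)
    rw [AlgHom.commutes]
  have : IsNoetherianRing R := IsLocalization.isNoetherianRing P.primeCompl R inferInstance
  let s : R := algebraMap K[X] R X
  have hφs : φ s = j (ES (-1)) := by
    rw [hφ]; change j (aeval (ES (-1 : K)) X) = _; rw [aeval_X]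
  have hφsm : ∀ m : ℕ, φ (s ^ m) = j (ES (-(m : K))) := by
    intro m; rw [map_pow, hφs, ← map_pow, ES_pow, mul_neg_one]
  have hps : ∀ m : ℕ, ES (-(m : K)) * ES (m : K) = 1 := by
    intro m; rw [ES_mul, neg_add_cancel, ES_zero]
  let E : KD D R L :=
    { s := s
      P := D.Psi.compr₂ j.toLinearMap
      hs := by
        intro h
        rw [IsLocalization.AtPrime.isUnit_to_map_iff R P] at h
        exact h (Ideal.mem_span_singleton_self _)
      inj := by
        intro v hv
        rw [hsm, hφs] at hv
        rcases mul_eq_zero.1 hv with h | h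
        · exfalso
          have h1 : ES (-1 : K) = 0 := hj (by rw [h, map_zero])
          have h2 := hps 1
          rw [Nat.cast_one, h1, zero_mul] at h2
          exact zero_ne_one h2
        · exact h
      hp := by
        intro a m hm ξ u
        simp only [LinearMap.compr₂_apply, AlgHom.toLinearMap_apply]
        rw [hsm, hφsm, ← map_mul, ← map_sub]
        have := D.Psi_b a ξ u
        rw [hm, Int.cast_natCast] at this
        rw [← this, add_sub_cancel_right]
      hm := by
        intro a m hm ξ u
        simp only [LinearMap.compr₂_apply, AlgHom.toLinearMap_apply]
        rw [hsm, hφsm, ← map_add, ← map_mul]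
        have := D.Psi_b a ξ u
        rw [hm, Int.cast_neg, Int.cast_natCast, neg_neg] at this
        rw [this, ← mul_assoc, hps, one_mul]
      h0 := by
        intro ξ u h
        simp only [LinearMap.compr₂_apply, AlgHom.toLinearMap_apply] at h
        have h1 : D.Psi ξ u = 0 := hj (by rw [h, map_zero])
        have h2 := D.Psi_coeff ξ u 0
        rw [h1] at h2
        simpa using h2.symm
      hI := by
        intro ξ u h
        simp only [LinearMap.compr₂_apply, AlgHom.toLinearMap_apply]
        have : D.Psi ξ u = 0 := by
          ext n
          rw [D.Psi_coeff, h, mul_zero, map_zero]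
        rw [this, map_zero] }
  exact E.key Z I hIr hz y hy

end PartE3

set_option linter.unusedSectionVars false
set_option autoImplicit false
set_option linter.unusedVariables false
set_option linter.unusedSimpArgs false
open UniversalEnvelopingAlgebra
section PartF1

lemma artin_chars {K C : Type*} [Field K] [IsAlgClosed K] [CommRing C] [Algebra K C] (a : Ideal C)
    [Module.Finite K (C ⧸ a)] : ∃ Ξ : Finset (C →ₐ[K] K), (∀ χ ∈ Ξ, ∀ q ∈ a, χ q = 0) ∧
      ∃ (r : Ideal C) (c : ℕ), r ^ c ≤ a ∧ ∀ q, (∀ χ ∈ Ξ, χ q = 0) → q ∈ r := by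
  classical
  have : IsArtinianRing (C ⧸ a) := IsArtinianRing.of_finite K _
  have : Fintype ((C ⧸ a) →ₐ[K] K) := Fintype.ofFinite _
  refine ⟨Finset.univ.image fun χ : (C ⧸ a) →ₐ[K] K => χ.comp (Ideal.Quotient.mkₐ K a), ?_, ?_⟩
  · intro χ hχ q hq
    obtain ⟨χ, -, rfl⟩ := Finset.mem_image.1 hχ
    simp [Ideal.Quotient.eq_zero_iff_mem.2 hq]
  · obtain ⟨c, hc⟩ := IsArtinianRing.isNilpotent_nilradical (R := C ⧸ a)
    refine ⟨(nilradical (C ⧸ a)).comap (Ideal.Quotient.mk a), c, ?_, ?_⟩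
    · refine (Ideal.le_comap_pow _ c).trans ?_
      rw [hc]
      intro q hq
      exact Ideal.Quotient.eq_zero_iff_mem.1 hq
    · intro q hq
      rw [Ideal.mem_comap, nilradical_eq_sInf, Ideal.mem_sInf]
      intro m hm
      have hm' : m.IsPrime := hm
      have hb := IsAlgClosed.algebraMap_bijective_of_isIntegral (k := K) (K := (C ⧸ a) ⧸ m)
      let e := AlgEquiv.ofBijective (Algebra.ofId K ((C ⧸ a) ⧸ m)) hb
      let χ : (C ⧸ a) →ₐ[K] K := e.symm.toAlgHom.comp (Ideal.Quotient.mkₐ K m)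
      have h1 := hq (χ.comp (Ideal.Quotient.mkₐ K a))
        (Finset.mem_image.2 ⟨χ, Finset.mem_univ _, rfl⟩)
      have h2 : e.symm (Ideal.Quotient.mk m (Ideal.Quotient.mk a q)) = 0 := h1
      rw [EmbeddingLike.map_eq_zero_iff] at h2
      exact Ideal.Quotient.eq_zero_iff_mem.1 h2

variable {K g : Type*} [Field K] [LieRing g] [LieAlgebra K g] [CharZero K]
  [LieAlgebra.IsSemisimple K g] {T : TriangularDecomposition K g}

local notation "𝓤" => UniversalEnvelopingAlgebra K g
attribute [local instance] LieRing.ofAssociativeRing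

/-- enveloping algebra of the Cartan subalgebra -/
def TriangularDecomposition.Ch (T : TriangularDecomposition K g) : Subalgebra K 𝓤 :=
  Algebra.adjoin K (Set.range fun h : T.H => ι K (h : g))

lemma TriangularDecomposition.Ch_comm : IsMulCommutative T.Ch :=
  Algebra.isMulCommutative_adjoin K (by
    rintro _ ⟨h, rfl⟩ _ ⟨h2, rfl⟩
    simp only
    rw [iota_comm, T.abelian, map_zero, add_zero])

noncomputable instance TriangularDecomposition.ChRing : CommRing T.Ch :=
  { (inferInstance : Ring T.Ch) with mul_comm := T.Ch_comm.is_comm.comm }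

variable (D : T.HB)

lemma TriangularDecomposition.HB.pr_mul {m : ℤ} {x : 𝓤} (hx : x ∈ D.Ug m) (n : ℤ) (u : 𝓤) :
    D.pr n (x * u) = x * D.pr (n - m) u := by
  obtain ⟨s, hs⟩ := D.pr_sum u
  have h : ∀ v ∈ ⨆ i, D.Ug i, D.pr n (x * v) = x * D.pr (n - m) v := by
    intro v hv
    refine Submodule.iSup_induction _ (motive := fun v => D.pr n (x * v) = x * D.pr (n - m) v) hv
      ?_ (by simp) (fun a b ha hb => by rw [mul_add, map_add, map_add, ha, hb, mul_add])
    intro i v hv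
    by_cases h : i = n - m
    · subst h
      rw [D.pr_of_mem hv, D.pr_of_mem]
      simpa using D.Ug_mul hx hv
    · rw [D.pr_of_ne h hv, D.pr_of_ne (m := m + i) (by omega) (D.Ug_mul hx hv), mul_zero]
  exact h u (D.iSup_Ug ▸ Submodule.mem_top)

lemma TriangularDecomposition.HB.pr_mul' {m : ℤ} {x : 𝓤} (hx : x ∈ D.Ug m) (n : ℤ) (u : 𝓤) :
    D.pr n (u * x) = D.pr (n - m) u * x := by
  have h : ∀ v ∈ ⨆ i, D.Ug i, D.pr n (v * x) = D.pr (n - m) v * x := by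
    intro v hv
    refine Submodule.iSup_induction _ (motive := fun v => D.pr n (v * x) = D.pr (n - m) v * x) hv
      ?_ (by simp) (fun a b ha hb => by rw [add_mul, map_add, map_add, ha, hb, add_mul])
    intro i v hv
    by_cases h : i = n - m
    · subst h
      rw [D.pr_of_mem hv, D.pr_of_mem]
      simpa using D.Ug_mul hv hx
    · rw [D.pr_of_ne h hv, D.pr_of_ne (m := i + m) (by omega) (D.Ug_mul hv hx), zero_mul]
  exact h u (D.iSup_Ug ▸ Submodule.mem_top)

lemma TriangularDecomposition.HB.iota_H_mem (h : T.H) : ι K (h : g) ∈ D.Ug 0 := by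
  have h1 : (h : g) ∈ Submodule.span K (D.b '' {i | D.n i = 0}) := by
    obtain ⟨a, b, c, ha, hb, hc, he, -, hb', -⟩ := D.tri (h : g)
    have : a + (b - h) + c = 0 := by rw [he]; abel
    have h2 := (T.disj ha (sub_mem hb h.2) hc this).2.1
    rw [← sub_eq_zero.1 h2]; exact hb'
  have h2 : Submodule.span K (D.b '' {i | D.n i = 0}) ≤ (D.Ug 0).comap (iotaL K g) := by
    rw [Submodule.span_le]
    rintro _ ⟨i, hi, rfl⟩
    have := D.b_mem_Ug i
    rw [hi] at this
    exact this
  exact h2 h1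

lemma TriangularDecomposition.HB.Ch_mem {q : 𝓤} (hq : q ∈ T.Ch) : q ∈ D.Ug 0 := by
  induction hq using Algebra.adjoin_induction with
  | mem x hx => obtain ⟨h, rfl⟩ := hx; exact D.iota_H_mem h
  | algebraMap r => rw [Algebra.algebraMap_eq_smul_one]; exact Submodule.smul_mem _ _ D.one_mem_Ug
  | add x y _ _ hx hy => exact add_mem hx hy
  | mul x y _ _ hx hy => simpa using D.Ug_mul hx hy

lemma idealK_smul {I : Ideal 𝓤} (c : K) {u : 𝓤} (h : u ∈ I) : c • u ∈ I := by
  rw [Algebra.smul_def]; exact I.mul_mem_left _ h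

/-- triangular structure -/
lemma TriangularDecomposition.HB.triang (P : Ideal 𝓤) (hP : ∀ a, 0 < D.n a → ι K (D.b a) ∈ P) :
    (∀ n : ℤ, 0 < n → ∀ u, D.pr n u ∈ P) ∧ ∀ u, ∃ q ∈ T.Ch, D.pr 0 u - q ∈ P := by
  let W1 : Submodule K 𝓤 := ⨅ n : {n : ℤ // 0 < n}, (P.restrictScalars K).comap (D.pr n)
  let W2 : Submodule K 𝓤 := (Subalgebra.toSubmodule T.Ch ⊔ P.restrictScalars K)
  have hW1 : ∀ u, u ∈ W1 ↔ ∀ n : ℤ, 0 < n → D.pr n u ∈ P := by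
    intro u; simp [W1]
  have hPW : ∀ u ∈ P, u ∈ W2 := fun u hu => Submodule.mem_sup_right hu
  have hb0 : ∀ a, D.n a = 0 → ∀ u ∈ W2, ι K (D.b a) * u ∈ W2 := by
    intro a ha u hu
    obtain ⟨q, hq, x, hx, rfl⟩ := Submodule.mem_sup.1 hu
    rw [mul_add]
    refine add_mem (Submodule.mem_sup_left ?_) (hPW _ (P.mul_mem_left _ hx))
    exact T.Ch.mul_mem (Algebra.subset_adjoin ⟨⟨_, D.zer a ha⟩, rfl⟩) hq
  have key : ∀ k, Fil K g k ≤ W1 ⊓ W2.comap (D.pr 0) := by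
    intro k
    induction k with
    | zero =>
      rw [Fil_zero, Submodule.one_le]
      refine ⟨(hW1 _).2 fun n hn => ?_, ?_⟩
      · rw [D.pr_of_ne (by omega) D.one_mem_Ug]; exact P.zero_mem
      · rw [Submodule.comap_coe, Set.mem_preimage, D.pr_of_mem D.one_mem_Ug]
        exact Submodule.mem_sup_left T.Ch.one_mem
    | succ k ih =>
      refine Fil_succ_le ih fun x u hu => ?_
      have hspan : x ∈ Submodule.span K (Set.range D.b) := by rw [D.b.span_eq]; trivial
      induction hspan using Submodule.span_induction with
      | zero => rw [map_zero, zero_mul]; exact zero_mem _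
      | add x y _ _ hx hy => rw [map_add, add_mul]; exact add_mem hx hy
      | smul c x _ hx => rw [map_smul, smul_mul_assoc]; exact Submodule.smul_mem _ _ hx
      | mem x hx =>
        obtain ⟨a, rfl⟩ := hx
        obtain ⟨h1, h2⟩ := ih hu
        rw [SetLike.mem_coe, hW1] at h1
        rcases lt_trichotomy (D.n a) 0 with ha | ha | ha
        · refine ⟨(hW1 _).2 fun n hn => ?_, ?_⟩
          · rw [D.pr_mul (D.b_mem_Ug a)]; exact P.mul_mem_left _ (h1 _ (by omega))
          · change D.pr 0 _ ∈ W2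
            rw [D.pr_mul (D.b_mem_Ug a)]; exact hPW _ (P.mul_mem_left _ (h1 _ (by omega)))
        · refine ⟨(hW1 _).2 fun n hn => ?_, ?_⟩
          · rw [D.pr_mul (D.b_mem_Ug a)]; exact P.mul_mem_left _ (h1 _ (by omega))
          · change D.pr 0 _ ∈ W2
            rw [D.pr_mul (D.b_mem_Ug a), ha, sub_zero]; exact hb0 a ha _ h2
        · have h3 := ih (comm_mem_Fil (D.b a) hu)
          have h4 : ι K (D.b a) * u = u * ι K (D.b a) + (ι K (D.b a) * u - u * ι K (D.b a)) := by
            abel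
          rw [h4]
          refine add_mem ⟨(hW1 _).2 fun n hn => ?_, ?_⟩ h3
          · rw [D.pr_mul' (D.b_mem_Ug a)]; exact P.mul_mem_left _ (hP a ha)
          · change D.pr 0 _ ∈ W2
            rw [D.pr_mul' (D.b_mem_Ug a)]; exact hPW _ (P.mul_mem_left _ (hP a ha))
  have key' : ∀ u, u ∈ W1 ⊓ W2.comap (D.pr 0) := fun u => by
    obtain ⟨k, hk⟩ := exists_mem_Fil u
    exact key k hk
  refine ⟨fun n hn u => (hW1 _).1 (key' u).1 n hn, fun u => ?_⟩
  obtain ⟨q, hq, x, hx, h⟩ := Submodule.mem_sup.1 (key' u).2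
  exact ⟨q, hq, by rw [← h, add_sub_cancel_left]; exact hx⟩

lemma TriangularDecomposition.HB.Ug_le_LL {n : ℤ} {k : ℕ} (h : (k : ℤ) ≤ n) {u : 𝓤}
    (hu : u ∈ D.Ug n) : u ∈ D.LL k :=
  Ideal.subset_span (Set.mem_iUnion.2 ⟨⟨n, h⟩, hu⟩)

lemma TriangularDecomposition.HB.LL1_le (P : Ideal 𝓤)
    (hP : ∀ a, 0 < D.n a → ι K (D.b a) ∈ P) : D.LL 1 ≤ P := by
  refine Ideal.span_le.2 fun u hu => ?_
  obtain ⟨⟨n, hn⟩, hu⟩ := Set.mem_iUnion.1 hu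
  have := (D.triang P hP).1 n (by push_cast at hn; omega) u
  rwa [D.pr_of_mem hu] at this

lemma TriangularDecomposition.HB.b_LL (a : Fin D.N) (ha : 0 < D.n a) : ι K (D.b a) ∈ D.LL 1 :=
  D.Ug_le_LL (by push_cast; omega) (D.b_mem_Ug a)

lemma TriangularDecomposition.HB.ex_q (u : 𝓤) : ∃ q ∈ T.Ch, D.pr 0 u - q ∈ D.LL 1 :=
  (D.triang _ D.b_LL).2 u

lemma TriangularDecomposition.HB.LL_mul {k : ℕ} {x t : 𝓤} (hx : x ∈ D.LL k) (ht : t ∈ D.Ug 0) :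
    x * t ∈ D.LL k := by
  refine Submodule.span_induction ?_ (by simp) (fun a b _ _ ha hb => ?_) (fun a b _ hb => ?_) hx
  · intro u hu
    obtain ⟨⟨n, hn⟩, hu⟩ := Set.mem_iUnion.1 hu
    exact D.Ug_le_LL (n := n + 0) (by omega) (D.Ug_mul hu ht)
  · rw [add_mul]; exact add_mem ha hb
  · rw [smul_eq_mul, mul_assoc]; exact Ideal.mul_mem_left _ _ hb

lemma TriangularDecomposition.HB.d_mem : D.d ∈ D.Ug 0 := D.iota_H_mem D.δ

/-- left ideals stable under right multiplication by δ are graded -/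
lemma TriangularDecomposition.HB.pr_ideal (Q : Ideal 𝓤) (hQ : ∀ u ∈ Q, u * D.d ∈ Q) {u : 𝓤}
    (hu : u ∈ Q) (n : ℤ) : D.pr n u ∈ Q :=
  D.pr_mem_of (Q.restrictScalars K) (fun v hv => by
    rw [D.A_apply]; exact sub_mem (Q.mul_mem_left _ hv) (hQ _ hv)) hu n

/-- finite-dimensionality -/
theorem TriangularDecomposition.HB.fd [Module.Finite K g] (Z : T.CZ) (I : Ideal 𝓤)
    (hIr : ∀ u ∈ I, ∀ v, u * v ∈ I) (hz : ∀ d, ∃ c : K, Z.z d - algebraMap K 𝓤 c ∈ I) :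
    ∃ k, ∀ q ∈ D.Ug 0, ∃ f ∈ Fil K g k, q - f ∈ I ⊔ D.LL 1 := by
  let P := I ⊔ D.LL 1
  let B : Submodule K 𝓤 := (P.restrictScalars K).comap (D.pr 0)
  have hP0 : ∀ u ∈ P, D.pr 0 u ∈ P := fun u hu => by
    refine D.pr_ideal P (fun v hv => ?_) hu 0
    obtain ⟨i, hi, x, hx, rfl⟩ := Submodule.mem_sup.1 hv
    rw [add_mul]
    exact add_mem (Ideal.mem_sup_left (hIr _ hi _)) (Ideal.mem_sup_right (D.LL_mul hx D.d_mem))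
  let G : ℕ → Submodule K 𝓤 := fun k => Fil K g (k - 1) ⊔ B
  have hred := Z.red G (fun k => le_sup_left) (fun k x hx u hu => ?_) (fun k d u hu => ?_)
  · refine ⟨Z.N * Z.N, fun q hq => ?_⟩
    have hall : ∀ k, Fil K g k ≤ Fil K g (Z.N * Z.N) ⊔ B := by
      intro k
      induction k with
      | zero => exact (Fil_mono (Nat.zero_le _)).trans le_sup_left
      | succ k ih =>
        by_cases hk : Z.N * Z.N < k + 1
        · refine (hred (k + 1) hk).trans (sup_le ?_ le_sup_right)
          exact ih
        · exact (Fil_mono (by omega)).trans le_sup_left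
    obtain ⟨k, hk⟩ := exists_mem_Fil q
    obtain ⟨f, hf, y, hy, h⟩ := Submodule.mem_sup.1 (hall k hk)
    refine ⟨D.pr 0 f, D.pr_mem_of _ (fun v hv => ?_) hf 0, ?_⟩
    · rw [D.A_apply]; exact comm_mem_Fil _ hv
    · have : q - D.pr 0 f = D.pr 0 y := by
        conv_lhs => rw [← D.pr_of_mem hq, ← h, map_add, add_sub_cancel_left]
      rw [this]; exact hy
  · change _ ∈ Fil K g k ⊔ B
    let φ : g →ₗ[K] 𝓤 := LinearMap.mulRight K u ∘ₗ iotaL K g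
    have h1 : Submodule.span K (D.b '' {i | D.n i < 0}) ≤ (Fil K g k ⊔ B).comap φ := by
      rw [Submodule.span_le]
      rintro _ ⟨i, hi, rfl⟩
      refine Submodule.mem_sup_right ?_
      change D.pr 0 (ι K (D.b i) * u) ∈ P
      rw [D.pr_mul (D.b_mem_Ug i)]
      refine P.mul_mem_left _ (Ideal.mem_sup_right (D.Ug_le_LL ?_ (D.pr_mem _ _)))
      have : D.n i < 0 := hi
      push_cast; omega
    have h2 : Submodule.span K (D.b '' {i | 0 < D.n i}) ≤ (Fil K g k ⊔ B).comap φ := by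
      rw [Submodule.span_le]
      rintro _ ⟨i, hi, rfl⟩
      change ι K (D.b i) * u ∈ Fil K g k ⊔ B
      have h4 : ι K (D.b i) * u = (ι K (D.b i) * u - u * ι K (D.b i)) + u * ι K (D.b i) := by abel
      rw [h4]
      exact add_mem (Submodule.mem_sup_left (comm_mem_Fil _ hu)) (Submodule.mem_sup_right
        (hP0 _ (Ideal.mem_sup_right (Ideal.mul_mem_left _ _ (D.b_LL i hi)))))
    obtain ⟨y, hy, x, hx2, rfl⟩ := Submodule.mem_sup.1 hx
    rw [map_add, add_mul]
    exact add_mem (h1 (D.nneg_span hy)) (h2 (D.npos_span hx2))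
  · obtain ⟨c, hc⟩ := hz (d + 1)
    have : Z.z (d + 1) * u = c • u + (Z.z (d + 1) - algebraMap K 𝓤 c) * u := by
      rw [Algebra.smul_def, sub_mul]; abel
    rw [this]
    refine add_mem (Submodule.mem_sup_left (Submodule.smul_mem _ _ (Fil_mono (by omega) hu)))
      (Submodule.mem_sup_right (hP0 _ (Ideal.mem_sup_left (hIr _ hc _))))

end PartF1

set_option linter.unusedSectionVars false
set_option autoImplicit false
set_option linter.unusedVariables false
set_option linter.unusedSimpArgs false
open UniversalEnvelopingAlgebra
section PartF2
variable {K g : Type*} [Field K] [LieRing g] [LieAlgebra K g] [CharZero K]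
  [LieAlgebra.IsSemisimple K g] {T : TriangularDecomposition K g}

local notation "𝓤" => UniversalEnvelopingAlgebra K g
attribute [local instance] LieRing.ofAssociativeRing
open Polynomial

variable (D : T.HB)

/-- generalized eigenvectors modulo Q -/
def TriangularDecomposition.HB.Gen (Q : Ideal 𝓤) (b : K) (v : 𝓤) : Prop :=
  ∃ e : ℕ, aeval D.d ((X - C b) ^ e) * v ∈ Q

lemma bezout_mem {Q : Ideal 𝓤} {d v : 𝓤} {f h : K[X]} (hc : IsCoprime f h)
    (h1 : aeval d f * v ∈ Q) (h2 : aeval d h * v ∈ Q) : v ∈ Q := by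
  obtain ⟨a, b, hab⟩ := hc
  have : v = aeval d a * (aeval d f * v) + aeval d b * (aeval d h * v) := by
    rw [← mul_assoc, ← mul_assoc, ← map_mul, ← map_mul, ← add_mul, ← map_add, hab, map_one, one_mul]
  rw [this]
  exact add_mem (Q.mul_mem_left _ h1) (Q.mul_mem_left _ h2)

lemma coprime_pow (b : K) (e : ℕ) {q : K[X]} (hq : q.eval b ≠ 0) : IsCoprime ((X - C b) ^ e) q :=
  IsCoprime.pow_left (((irreducible_X_sub_C b).coprime_iff_not_dvd).2
    (fun h => hq (dvd_iff_isRoot.1 h)))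

lemma TriangularDecomposition.HB.mul_aeval {m : ℤ} {x : 𝓤} (hx : x ∈ D.Ug m) (f : K[X]) :
    x * aeval D.d (f.comp (X + C (m : K))) = aeval D.d f * x := by
  have h0 : x * (D.d + algebraMap K 𝓤 m) = D.d * x := by
    have h := D.A_mem hx
    rw [D.A_apply, Algebra.smul_def, sub_eq_iff_eq_add] at h
    rw [h, mul_add, ← Algebra.commutes, add_comm]
  have h1 : aeval D.d (X + C (m : K)) = D.d + algebraMap K 𝓤 m := by simp
  rw [aeval_comp, h1]
  induction f using Polynomial.induction_on' with
  | add p q hp hq => rw [map_add, mul_add, hp, hq, map_add, add_mul]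
  | monomial n c =>
    rw [aeval_monomial, aeval_monomial, ← mul_assoc, ← Algebra.commutes, mul_assoc, mul_assoc]
    congr 1
    induction n with
    | zero => simp
    | succ n ih => rw [pow_succ, ← mul_assoc, ih, mul_assoc, h0, pow_succ, mul_assoc]

lemma TriangularDecomposition.HB.Gen_mul {Q : Ideal 𝓤} {b : K} {v : 𝓤} (hv : D.Gen Q b v) {m : ℤ}
    {x : 𝓤} (hx : x ∈ D.Ug m) : D.Gen Q (b + m) (x * v) := by
  obtain ⟨e, he⟩ := hv
  refine ⟨e, ?_⟩
  rw [← mul_assoc, ← D.mul_aeval hx, mul_assoc]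
  have : ((X - C (b + m)) ^ e : K[X]).comp (X + C (m : K)) = (X - C b) ^ e := by
    simp [Polynomial.pow_comp]
  rw [this]
  exact Q.mul_mem_left _ he

lemma TriangularDecomposition.HB.LL_tail {k : ℕ} (v : 𝓤) :
    ∃ m : ℕ, ∀ n : ℤ, (m : ℤ) ≤ n → ∀ x ∈ D.Ug n, x * v ∈ D.LL k := by
  obtain ⟨s, hs⟩ := D.pr_sum v
  refine ⟨k + ∑ i ∈ s, i.natAbs, fun n hn x hx => ?_⟩
  rw [hs, Finset.mul_sum]
  refine Submodule.sum_mem _ fun i hi => D.Ug_le_LL ?_ (D.Ug_mul hx (D.pr_mem i v))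
  push_cast at hn
  have h3 : ((i.natAbs : ℕ) : ℤ) ≤ ∑ i ∈ s, |i| := by
    have := Finset.single_le_sum (f := fun i : ℤ => |i|) (fun _ _ => abs_nonneg _) hi
    simpa using this
  have h4 : -i ≤ (i.natAbs : ℤ) := by omega
  omega

section
variable {I : Ideal (UniversalEnvelopingAlgebra K g)} (hIr : ∀ u ∈ I, ∀ v, u * v ∈ I) {p : K[X]} (hp0 : p ≠ 0)
  (hp : aeval D.d p ∈ I ⊔ D.LL 1) {Q : Ideal (UniversalEnvelopingAlgebra K g)} (hIQ : I ≤ Q) {k : ℕ} (hkQ : D.LL k ≤ Q)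

lemma TriangularDecomposition.HB.sing_mul (hIr : ∀ u ∈ I, ∀ v, u * v ∈ I) (hIQ : I ≤ Q) {w : 𝓤}
    (hw : ∀ n : ℤ, 1 ≤ n → ∀ x ∈ D.Ug n, x * w ∈ Q) {y : 𝓤} (hy : y ∈ I ⊔ D.LL 1) : y * w ∈ Q := by
  obtain ⟨i, hi, x, hx, rfl⟩ := Submodule.mem_sup.1 hy
  rw [add_mul]
  refine add_mem (hIQ (hIr _ hi _)) ?_
  refine Submodule.span_induction ?_ (by simp) (fun a b _ _ ha hb => ?_) (fun a b _ hb => ?_) hx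
  · intro u hu
    obtain ⟨⟨n, hn⟩, hu⟩ := Set.mem_iUnion.1 hu
    exact hw n (by exact_mod_cast hn) u hu
  · rw [add_mul]; exact add_mem ha hb
  · rw [smul_eq_mul, mul_assoc]; exact Ideal.mul_mem_left _ _ hb

/-- every vector is killed by a polynomial modulo Q -/
lemma TriangularDecomposition.HB.loc (hIr : ∀ u ∈ I, ∀ v, u * v ∈ I) (hp0 : p ≠ 0)
    (hp : aeval D.d p ∈ I ⊔ D.LL 1) (hIQ : I ≤ Q) (hkQ : D.LL k ≤ Q) (v : 𝓤) :
    ∃ f : K[X], f ≠ 0 ∧ aeval D.d f * v ∈ Q := by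
  have key : ∀ m : ℕ, ∀ v : 𝓤, (∀ n : ℤ, (m : ℤ) ≤ n → ∀ x ∈ D.Ug n, x * v ∈ Q) →
      ∃ f : K[X], f ≠ 0 ∧ aeval D.d f * v ∈ Q := by
    intro m
    induction m with
    | zero => exact fun v hv => ⟨1, one_ne_zero, by
        simpa using hv 0 le_rfl 1 D.one_mem_Ug⟩
    | succ m ih =>
      intro v hv
      let f := p.comp (X + C ((m : ℤ) : K))
      have hf : f ≠ 0 := by
        intro h
        rw [comp_eq_zero_iff] at h
        rcases h with h | h
        · exact hp0 h
        · have := congrArg natDegree h.2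
          rw [natDegree_X_add_C, natDegree_C] at this
          omega
      obtain ⟨f2, h2, h3⟩ := ih (aeval D.d f * v) (fun n hn x hx => by
        rcases hn.lt_or_eq with h | h
        · rw [← mul_assoc]
          have hfd : aeval D.d f ∈ D.Ug 0 := D.Ch_mem (by
            have : D.d ∈ T.Ch := Algebra.subset_adjoin ⟨D.δ, rfl⟩
            exact (aeval (⟨D.d, this⟩ : T.Ch) f).2 |> fun h => by
              rwa [← Subalgebra.coe_val, ← Polynomial.aeval_algHom_apply] at h)
          exact hv n (by push_cast; omega) _ (by simpa using D.Ug_mul hx hfd)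
        · subst h
          rw [← mul_assoc, D.mul_aeval hx, mul_assoc]
          refine D.sing_mul hIr hIQ (fun n hn y hy => ?_) hp
          rw [← mul_assoc]
          exact hv (n + m) (by push_cast; omega) _ (D.Ug_mul hy hx))
      exact ⟨f2 * f, mul_ne_zero h2 hf, by rwa [map_mul, mul_assoc]⟩
  obtain ⟨m, hm⟩ := D.LL_tail (k := k) v
  exact key m v fun n hn x hx => hkQ (hm n hn x hx)

/-- upward search for singular vectors -/
lemma TriangularDecomposition.HB.up (hIr : ∀ u ∈ I, ∀ v, u * v ∈ I)
    (hp : aeval D.d p ∈ I ⊔ D.LL 1) (hIQ : I ≤ Q) (hkQ : D.LL k ≤ Q) {b : K} {v : 𝓤}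
    (hv : D.Gen Q b v) (hvQ : v ∉ Q) : ∃ m : ℕ, p.eval (b + m) = 0 ∧ ∃ x : 𝓤,
      D.Gen Q (b + m) (x * v) ∧ x * v ∉ Q := by
  classical
  have hex : ∃ m : ℕ, ∀ n : ℤ, (m : ℤ) ≤ n → ∀ x ∈ D.Ug n, x * v ∈ Q := by
    obtain ⟨m, hm⟩ := D.LL_tail (k := k) v
    exact ⟨m, fun n hn x hx => hkQ (hm n hn x hx)⟩
  have hs := Nat.find_spec hex
  have hmin := fun j => Nat.find_min hex (m := j)
  generalize Nat.find hex = m at hs hmin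
  rcases m with _ | m
  · exact absurd (by simpa using hs 0 le_rfl 1 D.one_mem_Ug) hvQ
  · have h1 := hmin m (Nat.lt_succ_self m)
    push Not at h1
    obtain ⟨n, hn, x, hx, hxv⟩ := h1
    have hnm : n = m := by
      by_contra h
      exact hxv (hs n (by push_cast; omega) x hx)
    subst hnm
    have hg := D.Gen_mul hv hx
    rw [Int.cast_natCast] at hg
    refine ⟨m, ?_, x, hg, hxv⟩
    by_contra hne
    obtain ⟨e, he⟩ := hg
    refine hxv (bezout_mem (coprime_pow _ e hne) he ?_)
    refine D.sing_mul hIr hIQ (fun n hn y hy => ?_) hp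
    rw [← mul_assoc]
    exact hs (n + m) (by push_cast; omega) _ (D.Ug_mul hy hx)

end

lemma find_eig [IsAlgClosed K] {Q : Ideal 𝓤} {d w : 𝓤} (hw : w ∉ Q) : ∀ (n : ℕ) (f : K[X]),
    f.natDegree ≤ n → f ≠ 0 → aeval d f * w ∈ Q → ∃ (b : K) (h : K[X]), aeval d h * w ∉ Q ∧
      aeval d (X - C b) * (aeval d h * w) ∈ Q := by
  intro n
  induction n with
  | zero =>
    intro f hf hf0 h
    rw [eq_C_of_natDegree_le_zero hf, aeval_C] at h
    have hc : f.coeff 0 ≠ 0 := fun h0 => hf0 (by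
      rw [eq_C_of_natDegree_le_zero hf, h0, C_0])
    rw [← Algebra.smul_def] at h
    have := idealK_smul (f.coeff 0)⁻¹ h
    rw [smul_smul, inv_mul_cancel₀ hc, one_smul] at this
    exact absurd this hw
  | succ n ih =>
    intro f hf hf0 h
    by_cases hd : f.natDegree ≤ n
    · exact ih f hd hf0 h
    have hdeg : f.degree ≠ 0 := by
      intro h0
      have : f.natDegree = 0 := natDegree_eq_zero_iff_degree_le_zero.2 h0.le
      omega
    obtain ⟨b, hb⟩ := IsAlgClosed.exists_root f hdeg
    obtain ⟨f', rfl⟩ := dvd_iff_isRoot.2 hb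
    by_cases h1 : aeval d f' * w ∈ Q
    · have hf' : f' ≠ 0 := right_ne_zero_of_mul hf0
      refine ih f' ?_ hf' h1
      rw [natDegree_mul (X_sub_C_ne_zero b) hf', natDegree_X_sub_C] at hf
      omega
    · exact ⟨b, f', h1, by rwa [← mul_assoc, ← map_mul]⟩

end PartF2

set_option linter.unusedSectionVars false
set_option autoImplicit false
set_option linter.unusedVariables false
set_option linter.unusedSimpArgs false
open UniversalEnvelopingAlgebra
section PartF3
variable {K g : Type*} [Field K] [LieRing g] [LieAlgebra K g] [CharZero K]
  [LieAlgebra.IsSemisimple K g] {T : TriangularDecomposition K g}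

local notation "𝓤" => UniversalEnvelopingAlgebra K g
attribute [local instance] LieRing.ofAssociativeRing
open Polynomial

lemma exists_top {A : Finset K} (hA : A.Nonempty) : ∃ a ∈ A, ∀ n : ℕ, 0 < n → a + n ∉ A := by
  obtain ⟨a0, h0⟩ := hA
  have hfin : {n : ℕ | a0 + n ∈ A}.Finite :=
    A.finite_toSet.preimage (f := fun n : ℕ => a0 + (n : K))
      (fun x _ y _ h => Nat.cast_injective (add_left_cancel h))
  obtain ⟨m, hm, hmax⟩ := Finset.exists_max_image hfin.toFinset id ⟨0, by simpa using h0⟩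
  rw [Set.Finite.mem_toFinset] at hm
  refine ⟨a0 + m, hm, fun n hn h => ?_⟩
  have := hmax (m + n) (by
    rw [Set.Finite.mem_toFinset]; simp only [Set.mem_ofPred_eq]; push_cast; rwa [← add_assoc])
  simp only [id] at this
  omega

variable (D : T.HB)

lemma TriangularDecomposition.HB.bez {I : Ideal 𝓤} (hIr : ∀ u ∈ I, ∀ v, u * v ∈ I)
    {p : K[X]} (hp0 : p ≠ 0) (hp : aeval D.d p ∈ I ⊔ D.LL 1) {Q Q1 N : Ideal 𝓤} (hIQ : I ≤ Q)
    {k : ℕ} (hkQ : D.LL k ≤ Q) {b : K} {v : 𝓤} (hvN : v ∈ N) (hv : D.Gen Q1 b v) :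
    ∃ w ∈ N, D.Gen Q b w ∧ v - w ∈ Q1 := by
  obtain ⟨e, he⟩ := hv
  obtain ⟨f, hf0, hf⟩ := D.loc hIr hp0 hp hIQ hkQ v
  obtain ⟨q, hq, hnd⟩ := exists_eq_pow_rootMultiplicity_mul_and_not_dvd f hf0 b
  have hqb : q.eval b ≠ 0 := fun h => hnd (dvd_iff_isRoot.2 h)
  obtain ⟨α, β, hab⟩ := coprime_pow b e hqb
  refine ⟨aeval D.d (β * q) * v, N.mul_mem_left _ hvN, ⟨f.rootMultiplicity b, ?_⟩, ?_⟩
  · rw [← mul_assoc, ← map_mul]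
    have : (X - C b) ^ f.rootMultiplicity b * (β * q) = β * f := by
      conv_rhs => rw [hq]
      ring
    rw [this, map_mul, mul_assoc]
    exact Q.mul_mem_left _ hf
  · have : v - aeval D.d (β * q) * v = aeval D.d α * (aeval D.d ((X - C b) ^ e) * v) := by
      rw [sub_eq_iff_eq_add, ← mul_assoc, ← map_mul, ← add_mul, ← map_add, hab, map_one, one_mul]
    rw [this]
    exact Q1.mul_mem_left _ he

lemma TriangularDecomposition.HB.Gen_mono {Q Q1 : Ideal 𝓤} (h : Q ≤ Q1) {b : K} {v : 𝓤}
    (hv : D.Gen Q b v) : D.Gen Q1 b v := ⟨hv.choose, h hv.choose_spec⟩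

theorem TriangularDecomposition.HB.core [IsAlgClosed K] {I : Ideal 𝓤}
    (hIr : ∀ u ∈ I, ∀ v, u * v ∈ I) {J : Ideal 𝓤} (hJr : ∀ u ∈ J, ∀ v, u * v ∈ J)
    {p : K[X]} (hp0 : p ≠ 0) (hp : aeval D.d p ∈ I ⊔ D.LL 1)
    (S : ℕ → Set 𝓤) (hS1 : 1 ∈ S 0) (hS0 : ∀ i, ∀ t ∈ S i, t ∈ D.Ug 0)
    (hS : ∀ i, ∀ j ∈ J, j ∈ D.Ug 0 → ∀ t ∈ S i, j * t ∈ S (i + 1))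
    (c : ℕ) (hSc : ∀ t ∈ S c, t ∈ I ⊔ D.LL 1) :
    ∃ r : ℕ, ∀ k : ℕ, (fun N : Ideal 𝓤 => J * N)^[r] ⊤ ≤ I ⊔ D.LL k := by
  classical
  set F : Ideal 𝓤 → Ideal 𝓤 := fun N => J * N with hF
  have hFm : Monotone F := fun N N' h => Ideal.mul_mono_right h
  have claim : ∀ A : Finset K, ∃ r, ∀ (Q N : Ideal 𝓤) (k : ℕ), I ≤ Q → D.LL k ≤ Q →
      (∀ b, p.eval b = 0 → b ∉ A → ∀ v ∈ N, D.Gen Q b v → v ∈ Q) → F^[r] N ≤ Q := by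
    intro A
    induction A using Finset.strongInduction with
    | H A ih =>
    rcases A.eq_empty_or_nonempty with rfl | hA
    · refine ⟨0, fun Q N k hIQ hkQ h v hv => ?_⟩
      by_contra hvQ
      obtain ⟨f, hf0, hf⟩ := D.loc hIr hp0 hp hIQ hkQ v
      obtain ⟨b, q, h1, h2⟩ := find_eig hvQ _ f le_rfl hf0 hf
      obtain ⟨m, hm, x, hx, hx'⟩ := D.up hIr hp hIQ hkQ ⟨1, by rwa [pow_one]⟩ h1
      exact hx' (h _ hm (by simp) _ (N.mul_mem_left _ (N.mul_mem_left _ hv)) hx)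
    · obtain ⟨a, haA, hatop⟩ := exists_top hA
      obtain ⟨r, hr⟩ := ih (A.erase a) (Finset.erase_ssubset haA)
      refine ⟨(r + 1) * c + r, fun Q N k hIQ hkQ h => ?_⟩
      have hsing : ∀ v ∈ N, D.Gen Q a v → ∀ n : ℤ, 1 ≤ n → ∀ x ∈ D.Ug n, x * v ∈ Q := by
        intro v hv hg n hn x hx
        by_contra hxQ
        have hg2 := D.Gen_mul hg hx
        obtain ⟨m, hm, y, hy, hy'⟩ := D.up hIr hp hIQ hkQ hg2 hxQ
        refine hy' (h _ hm (fun hin => ?_) _ (N.mul_mem_left _ (N.mul_mem_left _ hv)) hy)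
        refine hatop (n.toNat + m) (by omega) ?_
        have : ((n.toNat : ℕ) : K) = (n : K) := by
          rw [← Int.cast_natCast, Int.toNat_of_nonneg (by omega)]
        push_cast
        rwa [this, ← add_assoc]
      let Qs : ℕ → Ideal 𝓤 := fun i => Ideal.span {y | ∃ t ∈ S i, ∃ v ∈ N, D.Gen Q a v ∧ y = t * v}
      have hQsN : ∀ i, Qs i ≤ N := fun i => Ideal.span_le.2 (by
        rintro _ ⟨t, ht, v, hv, hg, rfl⟩; exact N.mul_mem_left _ hv)
      have hQc : Qs c ≤ Q := Ideal.span_le.2 (by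
        rintro _ ⟨t, ht, v, hv, hg, rfl⟩
        exact D.sing_mul hIr hIQ (hsing v hv hg) (hSc t ht))
      have h0 : F^[r] N ≤ Q ⊔ Qs 0 := by
        refine hr _ _ k (hIQ.trans le_sup_left) (hkQ.trans le_sup_left) fun b hb hbA v hv hg => ?_
        obtain ⟨w, hwN, hwg, hvw⟩ := D.bez hIr hp0 hp hIQ hkQ hv hg
        have : w ∈ Q ⊔ Qs 0 := by
          by_cases hba : b = a
          · subst hba
            exact Ideal.mem_sup_right (Ideal.subset_span ⟨1, hS1, w, hwN, hwg, (one_mul w).symm⟩)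
          · exact Ideal.mem_sup_left (h b hb (fun hin => hbA (Finset.mem_erase.2 ⟨hba, hin⟩))
              w hwN hwg)
        have h3 := add_mem hvw this
        rwa [sub_add_cancel] at h3
      have hstep : ∀ i, F^[r + 1] (Q ⊔ Qs i) ≤ Q ⊔ Qs (i + 1) := by
        intro i
        let Q1 := Q ⊔ Qs (i + 1)
        let Dec : 𝓤 → Prop := fun x => ∃ w0 ∈ Q1, ∃ w ∈ N, x = w0 + w ∧
          ∃ q : K[X], q.eval a ≠ 0 ∧ aeval D.d q * w ∈ Q
        have hD0 : ∀ x ∈ Q1, Dec x := fun x hx =>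
          ⟨x, hx, 0, N.zero_mem, (add_zero x).symm, 1, by simp, by simp⟩
        have hDa : ∀ x y, Dec x → Dec y → Dec (x + y) := by
          rintro _ _ ⟨x0, hx0, x, hx, rfl, q, hq, hqx⟩ ⟨y0, hy0, y, hy, rfl, f, hf, hfy⟩
          refine ⟨x0 + y0, add_mem hx0 hy0, x + y, add_mem hx hy, by abel, f * q,
            by rw [eval_mul]; exact mul_ne_zero hf hq, ?_⟩
          rw [mul_add]
          refine add_mem ?_ ?_
          · rw [map_mul, mul_assoc]; exact Q.mul_mem_left _ hqx
          · rw [mul_comm, map_mul, mul_assoc]; exact Q.mul_mem_left _ hfy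
        have hDJ : ∀ s ∈ Qs i, ∀ j ∈ J, Dec (j * s) := by
          intro s hs
          refine Submodule.span_induction (p := fun s _ => ∀ j ∈ J, Dec (j * s)) ?_ ?_ ?_ ?_ hs
          · rintro _ ⟨t, ht, v, hv, hg, rfl⟩ j hj
            obtain ⟨s, hs⟩ := D.pr_sum j
            rw [hs, Finset.sum_mul]
            refine Finset.sum_induction _ Dec hDa (hD0 0 Q1.zero_mem) fun n _ => ?_
            by_cases hn : n = 0
            · subst hn
              refine hD0 _ (Ideal.mem_sup_right (Ideal.subset_span
                ⟨D.pr 0 j * t, hS i _ (D.pr_ideal J (fun u hu => hJr u hu _) hj 0)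
                  (D.pr_mem 0 j) t ht, v, hv, hg, (mul_assoc _ _ _).symm⟩))
            · have hg2 := D.Gen_mul (D.Gen_mul hg (hS0 i t ht)) (D.pr_mem n j)
              rw [Int.cast_zero, add_zero] at hg2
              obtain ⟨e, he⟩ := hg2
              refine ⟨0, Q1.zero_mem, _, N.mul_mem_left _ (N.mul_mem_left _ hv), (zero_add _).symm,
                _, ?_, he⟩
              simp only [eval_pow, eval_sub, eval_X, eval_C]
              refine pow_ne_zero _ ?_
              rw [sub_add_cancel_left, neg_ne_zero]
              exact_mod_cast hn
          · intro j hj; rw [mul_zero]; exact hD0 0 Q1.zero_mem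
          · intro x y _ _ hx hy j hj; rw [mul_add]; exact hDa _ _ (hx j hj) (hy j hj)
          · intro u x _ hx j hj; rw [smul_eq_mul, ← mul_assoc]; exact hx _ (hJr j hj u)
        rw [Function.iterate_succ_apply]
        refine hr _ _ k (hIQ.trans le_sup_left) (hkQ.trans le_sup_left) fun b hb hbA v hv hg => ?_
        have hdec : Dec v := by
          refine Submodule.smul_induction_on (p := Dec) hv (fun j hj y hy => ?_) hDa
          obtain ⟨x, hx, s, hs, rfl⟩ := Submodule.mem_sup.1 hy
          rw [smul_eq_mul, mul_add]
          exact hDa _ _ (hD0 _ (Ideal.mem_sup_left (Q.mul_mem_left _ hx))) (hDJ s hs j hj)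
        obtain ⟨w0, hw0, w, hw, rfl, q, hq, hqw⟩ := hdec
        refine add_mem hw0 ?_
        obtain ⟨e, he⟩ := hg
        have he2 : aeval D.d ((X - C b) ^ e) * w ∈ Q1 := by
          rw [mul_add] at he
          exact (add_mem_cancel_left (Q1.mul_mem_left _ hw0)).1 he
        by_cases hba : b = a
        · subst hba
          exact bezout_mem (coprime_pow b e hq) he2 (Ideal.mem_sup_left hqw)
        · obtain ⟨w2, hw2N, hw2g, hww⟩ := D.bez hIr hp0 hp hIQ hkQ hw ⟨e, he2⟩
          have := h b hb (fun hin => hbA (Finset.mem_erase.2 ⟨hba, hin⟩)) w2 hw2N hw2g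
          have h3 := add_mem hww (Ideal.mem_sup_left this)
          rwa [sub_add_cancel] at h3
      have hall : ∀ i, F^[(r + 1) * i] (Q ⊔ Qs 0) ≤ Q ⊔ Qs i := by
        intro i
        induction i with
        | zero => exact le_rfl
        | succ i ih =>
          rw [Nat.mul_succ, Nat.add_comm, Function.iterate_add_apply]
          exact (hFm.iterate _ ih).trans (hstep i)
      rw [Function.iterate_add_apply]
      exact (hFm.iterate _ h0).trans ((hall c).trans (sup_le le_rfl hQc))
  obtain ⟨r, hr⟩ := claim p.roots.toFinset
  refine ⟨r, fun k => hr _ _ k le_sup_left le_sup_right fun b hb hbA => ?_⟩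
  exact absurd (by rw [Multiset.mem_toFinset, mem_roots hp0]; exact hb) hbA

end PartF3

set_option linter.unusedSectionVars false
set_option autoImplicit false
set_option linter.unusedVariables false
set_option linter.unusedSimpArgs false
open UniversalEnvelopingAlgebra
section PartG1
variable {K g : Type*} [Field K] [LieRing g] [LieAlgebra K g] [CharZero K]
  [LieAlgebra.IsSemisimple K g] {T : TriangularDecomposition K g}

local notation "𝓤" => UniversalEnvelopingAlgebra K g
attribute [local instance] LieRing.ofAssociativeRing

lemma TriangularDecomposition.iota_Ch (h : T.H) : ι K (h : g) ∈ T.Ch :=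
  Algebra.subset_adjoin ⟨h, rfl⟩

/-- weight of a character -/
noncomputable def TriangularDecomposition.muOf (χ : T.Ch →ₐ[K] K) : Module.Dual K T.H where
  toFun h := χ ⟨ι K (h : g), T.iota_Ch h⟩
  map_add' x y := by
    rw [← map_add]; congr 1; ext; simp
  map_smul' c x := by
    rw [RingHom.id_apply, ← map_smul]; congr 1; ext; simp

lemma quot_max {R : Type*} [Ring R] {V Q : Ideal R} (hVQ : V ≤ Q) (hQ : Q ≠ ⊤)
    (hmax : ∀ Q' : Ideal R, V ≤ Q' → Q' ≠ ⊤ → Q' ≤ Q) : ∃ N : Submodule R (R ⧸ V),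
      (N ≠ ⊤ ∧ ∀ P : Submodule R (R ⧸ V), P ≠ ⊤ → P ≤ N) ∧
      ∀ j : R, (∀ m : (R ⧸ V) ⧸ N, j • m = 0) ↔ ∀ u, j * u ∈ Q := by
  have hc : (Submodule.map V.mkQ Q).comap V.mkQ = Q := by
    rw [Submodule.comap_map_mkQ, sup_eq_right.2 hVQ]
  refine ⟨Submodule.map V.mkQ Q, ⟨fun h => hQ ?_, fun P hP => ?_⟩, fun j => ⟨fun h u => ?_, ?_⟩⟩
  · rw [← hc, h, Submodule.comap_top]
  · have h1 : V ≤ P.comap V.mkQ := by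
      intro v hv
      rw [Submodule.mem_comap, Submodule.mkQ_apply, (Submodule.Quotient.mk_eq_zero V).2 hv]
      exact P.zero_mem
    have h2 := hmax _ h1 (fun h => hP (by
      rw [eq_top_iff]
      intro x _
      obtain ⟨y, rfl⟩ := V.mkQ_surjective x
      have : y ∈ P.comap V.mkQ := h ▸ Submodule.mem_top
      exact this))
    intro x hx
    obtain ⟨y, rfl⟩ := V.mkQ_surjective x
    exact Submodule.mem_map_of_mem (h2 hx)
  · have := h (Submodule.Quotient.mk (V.mkQ u))
    rw [← Submodule.Quotient.mk_smul, Submodule.Quotient.mk_eq_zero, ← map_smul] at this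
    rw [← hc]
    exact this
  · intro h m
    obtain ⟨m, rfl⟩ := Submodule.mkQ_surjective _ m
    obtain ⟨u, rfl⟩ := V.mkQ_surjective m
    rw [← map_smul, ← map_smul, Submodule.mkQ_apply, Submodule.Quotient.mk_eq_zero]
    exact Submodule.mem_map_of_mem (h u)

lemma TriangularDecomposition.HB.verma_data (D : T.HB) {I : Ideal 𝓤}
    (hIr : ∀ u ∈ I, ∀ v, u * v ∈ I) (χ : T.Ch →ₐ[K] K)
    (hχ : ∀ q : T.Ch, (q : 𝓤) ∈ I ⊔ D.LL 1 → χ q = 0) :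
    ∃ Q : Ideal 𝓤, vermaIdeal T (T.muOf χ) ≤ Q ∧ Q ≠ ⊤ ∧
      (∀ Q' : Ideal 𝓤, vermaIdeal T (T.muOf χ) ≤ Q' → Q' ≠ ⊤ → Q' ≤ Q) ∧ I ≤ Q ∧
      ∀ (q : T.Ch) (j : 𝓤), j - q ∈ D.LL 1 → j ∈ Q → χ q = 0 := by
  set V := vermaIdeal T (T.muOf χ) with hV
  have hVh : ∀ h : T.H, ι K (h : g) - algebraMap K 𝓤 (χ ⟨_, T.iota_Ch h⟩) ∈ V := fun h =>
    Ideal.subset_span (Or.inr ⟨h, rfl⟩)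
  have hVn : ∀ x ∈ T.npos, ι K x ∈ V := fun x hx => Ideal.subset_span (Or.inl ⟨⟨x, hx⟩, rfl⟩)
  have hLV : D.LL 1 ≤ V := D.LL1_le V fun a ha => hVn _ (D.pos a ha)
  have hqV : ∀ q : T.Ch, (q : 𝓤) - algebraMap K 𝓤 (χ q) ∈ V := by
    rintro ⟨q, hq⟩
    refine Algebra.adjoin_induction
      (p := fun q hq => q - algebraMap K 𝓤 (χ (⟨q, hq⟩ : T.Ch)) ∈ V) ?_ ?_ ?_ ?_ hq
    · rintro _ ⟨h, rfl⟩; exact hVh h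
    · intro r
      have : χ (⟨algebraMap K 𝓤 r, T.Ch.algebraMap_mem r⟩ : T.Ch) = r := χ.commutes r
      rw [this, sub_self]; exact V.zero_mem
    · intro x y hx hy h1 h2
      have : χ (⟨x + y, T.Ch.add_mem hx hy⟩ : T.Ch) = χ (⟨x, hx⟩ : T.Ch) + χ (⟨y, hy⟩ : T.Ch) :=
        map_add χ (⟨x, hx⟩ : T.Ch) ⟨y, hy⟩
      rw [this, map_add, add_sub_add_comm]; exact add_mem h1 h2
    · intro x y hx hy h1 h2
      have : χ (⟨x * y, T.Ch.mul_mem hx hy⟩ : T.Ch) = χ (⟨x, hx⟩ : T.Ch) * χ (⟨y, hy⟩ : T.Ch) :=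
        map_mul χ (⟨x, hx⟩ : T.Ch) ⟨y, hy⟩
      have h3 : x * y - algebraMap K 𝓤 (χ (⟨x, hx⟩ : T.Ch) * χ (⟨y, hy⟩ : T.Ch)) =
          x * (y - algebraMap K 𝓤 (χ (⟨y, hy⟩ : T.Ch))) + algebraMap K 𝓤 (χ (⟨y, hy⟩ : T.Ch)) *
            (x - algebraMap K 𝓤 (χ (⟨x, hx⟩ : T.Ch))) := by
        rw [mul_sub, mul_sub, ← Algebra.commutes _ x, mul_comm (χ _), map_mul]; abel
      rw [this, h3]
      exact add_mem (V.mul_mem_left _ h2) (V.mul_mem_left _ h1)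
  have hdstab : ∀ Q' : Ideal 𝓤, V ≤ Q' → ∀ u ∈ Q', u * D.d ∈ Q' := by
    intro Q' h u hu
    have : u * D.d = u * (D.d - algebraMap K 𝓤 (χ ⟨_, T.iota_Ch D.δ⟩)) +
        algebraMap K 𝓤 (χ ⟨_, T.iota_Ch D.δ⟩) * u := by
      rw [mul_sub, Algebra.commutes]; abel
    rw [this]
    exact add_mem (Q'.mul_mem_left _ (h (hVh D.δ))) (Q'.mul_mem_left _ hu)
  have hP0 : ∀ u ∈ D.LL 1, D.pr 0 u ∈ D.LL 1 := fun u hu =>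
    D.pr_ideal _ (fun v hv => D.LL_mul hv D.d_mem) hu 0
  let G : 𝓤 → Prop := fun u => ∃ q : T.Ch, χ q = 0 ∧ D.pr 0 u - q ∈ I ⊔ D.LL 1
  have hG0 : ∀ u, D.pr 0 u ∈ I ⊔ D.LL 1 → G u := fun u hu => ⟨0, map_zero χ, by
    rw [ZeroMemClass.coe_zero, sub_zero]; exact hu⟩
  have hGa : ∀ x y, G x → G y → G (x + y) := by
    rintro x y ⟨q, hq, hx⟩ ⟨q', hq', hy⟩
    refine ⟨q + q', by rw [map_add, hq, hq', add_zero], ?_⟩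
    rw [map_add, AddMemClass.coe_add, add_sub_add_comm]
    exact add_mem hx hy
  have hGV : ∀ v ∈ V, ∀ u, G (u * v) := by
    intro v hv
    refine Submodule.span_induction (p := fun v _ => ∀ u, G (u * v)) ?_ ?_ ?_ ?_ hv
    · rintro _ (⟨x, rfl⟩ | ⟨h, rfl⟩) u
      · refine hG0 _ (Ideal.mem_sup_right (hP0 _ (Ideal.mul_mem_left _ _ ?_)))
        have h1 : Submodule.span K (D.b '' {i | 0 < D.n i}) ≤
            ((D.LL 1).restrictScalars K).comap (iotaL K g) := by
          rw [Submodule.span_le]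
          rintro _ ⟨i, hi, rfl⟩
          exact D.b_LL i hi
        exact h1 (D.npos_span x.2)
      · let w : T.Ch := ⟨ι K (h : g), T.iota_Ch h⟩ - algebraMap K T.Ch (T.muOf χ h)
        have hw : (w : 𝓤) = ι K (h : g) - algebraMap K 𝓤 (T.muOf χ h) := rfl
        have hχw : χ w = 0 := by
          rw [map_sub, AlgHom.commutes, sub_eq_zero]; rfl
        obtain ⟨q, hq, hqx⟩ := D.ex_q u
        refine ⟨⟨q, hq⟩ * w, by rw [map_mul, hχw, mul_zero], Ideal.mem_sup_right ?_⟩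
        have hw0 : (w : 𝓤) ∈ D.Ug 0 := D.Ch_mem w.2
        change D.pr 0 (u * (w : 𝓤)) - q * (w : 𝓤) ∈ _
        rw [D.pr_mul' hw0, sub_zero, ← sub_mul]
        exact D.LL_mul hqx hw0
    · intro u; rw [mul_zero]; exact hG0 _ (by rw [map_zero]; exact zero_mem _)
    · intro x y _ _ hx hy u; rw [mul_add]; exact hGa _ _ (hx u) (hy u)
    · intro a x _ hx u; rw [smul_eq_mul, ← mul_assoc]; exact hx _
  have hIV : I ⊔ V ≠ ⊤ := by
    intro htop
    have h1 : (1 : 𝓤) ∈ I ⊔ V := htop ▸ Submodule.mem_top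
    obtain ⟨i, hi, v, hv, h⟩ := Submodule.mem_sup.1 h1
    have hG1 : G 1 := by
      rw [← h]
      refine hGa _ _ (hG0 _ (Ideal.mem_sup_left (D.pr_ideal I (fun u hu => hIr u hu _) hi 0))) ?_
      have := hGV v hv 1
      rwa [one_mul] at this
    obtain ⟨q, hq, h2⟩ := hG1
    rw [D.pr_of_mem D.one_mem_Ug] at h2
    have h3 := hχ (1 - q) h2
    rw [map_sub, map_one, hq, sub_zero] at h3
    exact one_ne_zero h3
  have h1V : (1 : 𝓤) ∉ V := fun h =>
    hIV ((Ideal.eq_top_iff_one _).2 (Ideal.mem_sup_right h))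
  let Q : Ideal 𝓤 :=
    { carrier := {u | ∀ x, D.pr 0 (x * u) ∈ V}
      add_mem' := fun {a b} ha hb x => by rw [mul_add, map_add]; exact add_mem (ha x) (hb x)
      zero_mem' := fun x => by rw [mul_zero, map_zero]; exact V.zero_mem
      smul_mem' := fun c a ha x => by rw [smul_eq_mul, ← mul_assoc]; exact ha _ }
  have hVQ : V ≤ Q := fun v hv x => D.pr_ideal V (hdstab V le_rfl) (V.mul_mem_left x hv) 0
  have hval : ∀ (Q' : Ideal 𝓤), V ≤ Q' → Q' ≠ ⊤ → ∀ (q : T.Ch) (j : 𝓤), j - q ∈ D.LL 1 →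
      j ∈ Q' → χ q = 0 := by
    intro Q' hQ' hQt q j hj hjQ
    by_contra hne
    apply hQt
    rw [Ideal.eq_top_iff_one]
    have h1 : algebraMap K 𝓤 (χ q) ∈ Q' := by
      have : algebraMap K 𝓤 (χ q) = j - (j - q) - (q - algebraMap K 𝓤 (χ q)) := by abel
      rw [this]
      exact sub_mem (sub_mem hjQ (hQ' (hLV hj))) (hQ' (hqV q))
    have := Q'.mul_mem_left (algebraMap K 𝓤 (χ q)⁻¹) h1
    rwa [← map_mul, inv_mul_cancel₀ hne, map_one] at this
  have hQt : Q ≠ ⊤ := by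
    intro h
    have h1 : (1 : 𝓤) ∈ Q := h ▸ Submodule.mem_top
    have h2 := h1 1
    rw [one_mul, D.pr_of_mem D.one_mem_Ug] at h2
    exact h1V h2
  have hmax : ∀ Q' : Ideal 𝓤, V ≤ Q' → Q' ≠ ⊤ → Q' ≤ Q := by
    intro Q' hQ' hQt u hu x
    have h1 := D.pr_ideal Q' (hdstab Q' hQ') (Q'.mul_mem_left x hu) 0
    obtain ⟨q, hq, hqx⟩ := D.ex_q (x * u)
    have h2 := hval Q' hQ' hQt ⟨q, hq⟩ _ hqx h1
    have h3 := add_mem (hLV hqx) (hqV ⟨q, hq⟩)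
    rw [h2, map_zero, sub_zero] at h3
    simpa using h3
  exact ⟨Q, hVQ, hQt, hmax, le_sup_left.trans (hmax _ le_sup_right hIV), hval Q hVQ hQt⟩

end PartG1

set_option linter.unusedSectionVars false
set_option autoImplicit false
set_option linter.unusedVariables false
set_option linter.unusedSimpArgs false
open UniversalEnvelopingAlgebra
section PartG2
variable {K g : Type*} [Field K] [LieRing g] [LieAlgebra K g] [CharZero K]
  [LieAlgebra.IsSemisimple K g] {T : TriangularDecomposition K g}

local notation "𝓤" => UniversalEnvelopingAlgebra K g
attribute [local instance] LieRing.ofAssociativeRing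
open Polynomial

/-- contraction to the Cartan part -/
def TriangularDecomposition.contr (P : Ideal 𝓤) : Ideal T.Ch where
  carrier := {q | (q : 𝓤) ∈ P}
  add_mem' ha hb := P.add_mem ha hb
  zero_mem' := P.zero_mem
  smul_mem' c a ha := P.mul_mem_left (c : 𝓤) ha

lemma contr_finite [Module.Finite K g] (P : Ideal 𝓤) (k : ℕ)
    (h : ∀ q ∈ T.Ch, ∃ f ∈ Fil K g k, q - f ∈ P) :
    Module.Finite K (T.Ch ⧸ (TriangularDecomposition.contr P : Ideal T.Ch)) := by
  let a : Ideal T.Ch := TriangularDecomposition.contr P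
  let P' := P.restrictScalars K
  let φ : T.Ch →ₗ[K] 𝓤 ⧸ P' := P'.mkQ ∘ₗ T.Ch.val.toLinearMap
  let W := (Fil K g k).map P'.mkQ
  have hW : Module.Finite K W := Module.Finite.iff_fg.2 ((Fil_fg k).map _)
  have hφ : ∀ q, φ q ∈ W := by
    intro q
    obtain ⟨f, hf, hq⟩ := h q q.2
    refine ⟨f, hf, ?_⟩
    exact ((Submodule.Quotient.eq P').2 hq).symm
  let ψ : (T.Ch ⧸ a.restrictScalars K) →ₗ[K] W := (a.restrictScalars K).liftQ
    (φ.codRestrict W hφ) (fun q hq => by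
      rw [LinearMap.mem_ker]; ext; exact (Submodule.Quotient.mk_eq_zero P').2 hq)
  have hψ : Function.Injective ψ := by
    rw [← LinearMap.ker_eq_bot]
    refine Submodule.ker_liftQ_eq_bot _ _ _ fun q hq => ?_
    have h1 : φ q = 0 := congrArg Subtype.val (LinearMap.mem_ker.1 hq)
    exact (Submodule.Quotient.mk_eq_zero P').1 h1
  have : Module.Finite K (T.Ch ⧸ a.restrictScalars K) := Module.Finite.of_injective ψ hψ
  exact Module.Finite.equiv (Submodule.Quotient.restrictScalarsEquiv K a)

theorem duflo_aux [IsAlgClosed K] (T : TriangularDecomposition K g) {S : Type*} [AddCommGroup S]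
    [Module 𝓤 S] [IsSimpleModule 𝓤 S] (I : Ideal 𝓤) (hI : ∀ u : 𝓤, u ∈ I ↔ ∀ s : S, u • s = 0) :
    ∃ (mu : Module.Dual K T.H) (Q : Ideal 𝓤), vermaIdeal T mu ≤ Q ∧ Q ≠ ⊤ ∧
      (∀ Q' : Ideal 𝓤, vermaIdeal T mu ≤ Q' → Q' ≠ ⊤ → Q' ≤ Q) ∧
      ∀ j, j ∈ I ↔ ∀ u, j * u ∈ Q := by
  classical
  have := T.finite
  obtain ⟨D⟩ := T.exists_hb
  obtain ⟨Z⟩ := T.exists_cz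
  have hIr : ∀ u ∈ I, ∀ v, u * v ∈ I := fun u hu v => (hI _).2 fun s => by
    rw [mul_smul]; exact (hI _).1 hu _
  have hz : ∀ d, ∃ c : K, Z.z d - algebraMap K 𝓤 c ∈ I := fun d => by
    obtain ⟨c, hc⟩ := quillen (S := S) (Z.z d) (Z.comm d)
    exact ⟨c, (hI _).2 hc⟩
  have hprime : ∀ x y, x ∉ I → y ∉ I → ∃ u, x * u * y ∉ I := by
    intro x y hx hy
    rw [hI] at hx hy
    push Not at hx hy
    obtain ⟨s, hs⟩ := hx
    obtain ⟨t, ht⟩ := hy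
    obtain ⟨u, hu⟩ := IsSimpleModule.toSpanSingleton_surjective 𝓤 ht s
    refine ⟨u, fun h => hs ?_⟩
    have h1 := (hI _).1 h t
    rw [LinearMap.toSpanSingleton_apply] at hu
    rw [mul_smul, mul_smul, hu] at h1
    exact h1
  have h1I : (1 : 𝓤) ∉ I := fun h => by
    have := IsSimpleModule.nontrivial 𝓤 S
    obtain ⟨s, hs⟩ := exists_ne (0 : S)
    exact hs (by simpa using (hI _).1 h s)
  obtain ⟨k, hk⟩ := D.fd Z I hIr hz
  let P := I ⊔ D.LL 1
  let a : Ideal T.Ch := TriangularDecomposition.contr P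
  have hfin : Module.Finite K (T.Ch ⧸ a) := contr_finite P k fun q hq => hk q (D.Ch_mem hq)
  obtain ⟨Ξ, hΞ, r, c, hrc, hr⟩ := artin_chars (K := K) a
  have hdata := fun χ (hχ : χ ∈ Ξ) => D.verma_data hIr χ (fun q hq => hΞ χ hχ q hq)
  choose! Q hVQ hQt hmax hIQ hval using hdata
  by_contra hcon
  have hcon' : ∀ χ ∈ Ξ, ∃ j, (∀ u, j * u ∈ Q χ) ∧ j ∉ I := by
    intro χ hχ
    by_contra h
    push Not at h
    exact hcon ⟨T.muOf χ, Q χ, hVQ χ hχ, hQt χ hχ, hmax χ hχ, fun j =>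
      ⟨fun hj u => hIQ χ hχ (hIr j hj u), h j⟩⟩
  let J : Ideal 𝓤 :=
    { carrier := {j | ∀ χ ∈ Ξ, ∀ u, j * u ∈ Q χ}
      add_mem' := fun {a b} ha hb χ hχ u => by rw [add_mul]; exact add_mem (ha χ hχ u) (hb χ hχ u)
      zero_mem' := fun χ hχ u => by rw [zero_mul]; exact zero_mem _
      smul_mem' := fun c a ha χ hχ u => by
        rw [smul_eq_mul, mul_assoc]; exact Ideal.mul_mem_left _ _ (ha χ hχ u) }
  have hJr : ∀ u ∈ J, ∀ v, u * v ∈ J := fun u hu v χ hχ w => by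
    rw [mul_assoc]; exact hu χ hχ _
  have hJI : ∃ y ∈ J, y ∉ I := by
    have : ∀ Ξ' : Finset (T.Ch →ₐ[K] K), Ξ' ⊆ Ξ → ∃ y, y ∉ I ∧ ∀ χ ∈ Ξ', ∀ u, y * u ∈ Q χ := by
      intro Ξ'
      induction Ξ' using Finset.induction_on with
      | empty => exact fun _ => ⟨1, h1I, by simp⟩
      | insert χ Ξ' _ ih =>
        intro hsub
        obtain ⟨y, hy, hyQ⟩ := ih ((Finset.subset_insert _ _).trans hsub)
        obtain ⟨j, hj, hjI⟩ := hcon' χ (hsub (Finset.mem_insert_self _ _))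
        obtain ⟨w, hw⟩ := hprime j y hjI hy
        refine ⟨j * w * y, hw, fun χ' hχ' u => ?_⟩
        rcases Finset.mem_insert.1 hχ' with rfl | h
        · rw [mul_assoc, mul_assoc]; exact hj _
        · rw [mul_assoc]; exact Ideal.mul_mem_left _ _ (hyQ χ' h u)
    obtain ⟨y, hy, hyQ⟩ := this Ξ (Finset.Subset.refl _)
    exact ⟨y, hyQ, hy⟩
  obtain ⟨y, hyJ, hyI⟩ := hJI
  -- polynomial
  let dC : T.Ch := ⟨D.d, T.iota_Ch D.δ⟩
  have hint : IsIntegral K (Ideal.Quotient.mk a dC) := Algebra.IsIntegral.isIntegral _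
  let p := minpoly K (Ideal.Quotient.mk a dC)
  have hp0 : p ≠ 0 := (minpoly.monic hint).ne_zero
  have hp : aeval D.d p ∈ I ⊔ D.LL 1 := by
    have h1 : aeval (Ideal.Quotient.mkₐ K a dC) p = 0 := minpoly.aeval K (Ideal.Quotient.mk a dC)
    rw [Polynomial.aeval_algHom_apply] at h1
    have h2 : aeval dC p ∈ a := Ideal.Quotient.eq_zero_iff_mem.1 h1
    have h3 : ((aeval dC p : T.Ch) : 𝓤) = aeval D.d p :=
      (Polynomial.aeval_algHom_apply T.Ch.val dC p).symm
    rw [← h3]; exact h2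
  let St : ℕ → Set 𝓤 := fun i => {t | t ∈ D.Ug 0 ∧ ∃ q : T.Ch, q ∈ r ^ i ∧ t - q ∈ D.LL 1}
  obtain ⟨R, hR⟩ := D.core hIr hJr hp0 hp St
    ⟨D.one_mem_Ug, 1, by simp, by simp⟩ (fun i t ht => ht.1)
    (fun i j hj hj0 t ht => by
      obtain ⟨ht0, q, hq, htq⟩ := ht
      obtain ⟨q', hq', hjq⟩ := D.ex_q j
      rw [D.pr_of_mem hj0] at hjq
      refine ⟨by simpa using D.Ug_mul hj0 ht0, ⟨q', hq'⟩ * q, ?_, ?_⟩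
      · rw [pow_succ']
        refine Ideal.mul_mem_mul (hr _ fun χ hχ => ?_) hq
        have := hj χ hχ 1
        rw [mul_one] at this
        exact hval χ hχ ⟨q', hq'⟩ j hjq this
      · change j * t - q' * (q : 𝓤) ∈ D.LL 1
        have : j * t - q' * (q : 𝓤) = j * (t - q) + (j - q') * q := by noncomm_ring
        rw [this]
        exact add_mem (Ideal.mul_mem_left _ _ htq) (D.LL_mul hjq (D.Ch_mem q.2)))
    c (fun t ht => by
      obtain ⟨ht0, q, hq, htq⟩ := ht
      have h1 : (q : 𝓤) ∈ I ⊔ D.LL 1 := hrc hq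
      have := add_mem (Ideal.mem_sup_right htq) h1
      rwa [sub_add_cancel] at this)
  have hnot : ∀ n : ℕ, ∃ x ∈ (fun N : Ideal 𝓤 => J * N)^[n] ⊤, x ∉ I := by
    intro n
    induction n with
    | zero => exact ⟨1, Submodule.mem_top, h1I⟩
    | succ n ih =>
      obtain ⟨x, hx, hxI⟩ := ih
      obtain ⟨u, hu⟩ := hprime y x hyI hxI
      refine ⟨y * u * x, ?_, hu⟩
      rw [Function.iterate_succ_apply']
      exact Ideal.mul_mem_mul (hJr y hyJ u) hx
  obtain ⟨x, hx, hxI⟩ := hnot R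
  exact hxI (D.separation Z I hIr hz x fun k => hR k hx)

end PartG2

theorem primitive_ideal_eq_annihilator_simple_highest_weight_of_isAlgClosed
    {K : Type u} {g : Type v} [Field K] [CharZero K] [IsAlgClosed K]
    [LieRing g] [LieAlgebra K g] [LieAlgebra.IsSemisimple K g]
    (T : TriangularDecomposition K g)
    (I : TwoSidedIdeal (UniversalEnvelopingAlgebra K g))
    -- `I` is primitive: it is the annihilator of a simple left `U(g)`-module
    (hprimitive : ∃ (S : Type (max u v)) (_ : AddCommGroup S)
      (_ : Module (UniversalEnvelopingAlgebra K g) S),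
      IsSimpleModule (UniversalEnvelopingAlgebra K g) S ∧
        I = annihilatorTwoSided (UniversalEnvelopingAlgebra K g) S) :
    ∃ (mu : Module.Dual K ↥T.H)
      (N : Submodule (UniversalEnvelopingAlgebra K g) (VermaModule T mu)),
      (N ≠ ⊤ ∧ ∀ P : Submodule (UniversalEnvelopingAlgebra K g) (VermaModule T mu),
        P ≠ ⊤ → P ≤ N) ∧
      I = annihilatorTwoSided (UniversalEnvelopingAlgebra K g) (VermaModule T mu ⧸ N) := by
  obtain ⟨S, _, _, hS, rfl⟩ := hprimitive
  obtain ⟨mu, Q, hVQ, hQt, hmax, hj⟩ := duflo_aux (S := S) T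
    (annihilatorTwoSided (UniversalEnvelopingAlgebra K g) S).asIdeal (fun u => by
      rw [TwoSidedIdeal.mem_asIdeal, annihilatorTwoSided, TwoSidedIdeal.mem_mk']; rfl)
  obtain ⟨N, hN, hNj⟩ := quot_max hVQ hQt hmax
  refine ⟨mu, N, hN, ?_⟩
  ext j
  rw [← TwoSidedIdeal.mem_asIdeal, hj, ← hNj, annihilatorTwoSided, TwoSidedIdeal.mem_mk']
  rfl
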